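/- arXiv:math/9807080 — 17 statements merged into one kernel-verified Lean document; each statement's English description precedes it below -/
import Mathlib

section
/- Let L : ℝⁿ × ℝⁿ → ℝ be smooth (C^∞) and let q : ℝ × ℝ → ℝⁿ, (ε,t) ↦ q(ε,t), be smooth. Fix real numbers a < b, and set q₀(t) = q(0,t) and δq(t) = ∂q/∂ε(0,t). Then d/dε|_{ε=0} ∫ₐᵇ L(q(ε,t), ∂q/∂t(ε,t)) dt = ∫ₐᵇ ( D₁L(q₀(t),q₀'(t)) − (d/dt)[ t ↦ D₂L(q₀(t),q₀'(t)) ] )(δq(t)) dt + D₂L(q₀(b),q₀'(b))(δq(b)) − D₂L(q₀(a),q₀'(a))(δq(a)). -/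
open intervalIntegral

namespace Stmt0

/-- Partial Fréchet derivative of `L` in its first `ℝⁿ` argument, as a linear functional. -/
noncomputable def D1 {n : ℕ} (L : (Fin n → ℝ) × (Fin n → ℝ) → ℝ)
    (p : (Fin n → ℝ) × (Fin n → ℝ)) : (Fin n → ℝ) →L[ℝ] ℝ :=
  (fderiv ℝ L p).comp (ContinuousLinearMap.inl ℝ (Fin n → ℝ) (Fin n → ℝ))

/-- Partial Fréchet derivative of `L` in its second `ℝⁿ` argument, as a linear functional. -/
noncomputable def D2 {n : ℕ} (L : (Fin n → ℝ) × (Fin n → ℝ) → ℝ)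
    (p : (Fin n → ℝ) × (Fin n → ℝ)) : (Fin n → ℝ) →L[ℝ] ℝ :=
  (fderiv ℝ L p).comp (ContinuousLinearMap.inr ℝ (Fin n → ℝ) (Fin n → ℝ))

/-- Differentiation of the integral of a `C¹` map with respect to a parameter. -/
theorem hasDerivAt_intervalIntegral_of_contDiff {E : Type*} [NormedAddCommGroup E] [NormedSpace ℝ E]
    {G : ℝ × ℝ → E} (hG : ContDiff ℝ 1 G)
    (a b x : ℝ) :
    HasDerivAt (fun y => ∫ t in a..b, G (y, t)) (∫ t in a..b, fderiv ℝ G (x, t) (1, 0)) x := by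
  have hcont : Continuous fun p : ℝ × ℝ => fderiv ℝ G p (1, 0) :=
    (hG.continuous_fderiv one_ne_zero).clm_apply continuous_const
  obtain ⟨C, hC⟩ := ((isCompact_closedBall x 1).prod (isCompact_uIcc (a := a) (b := b))
    ).exists_bound_of_continuousOn hcont.continuousOn
  have hGc := hG.continuous
  refine (intervalIntegral.hasDerivAt_integral_of_dominated_loc_of_deriv_le (bound := fun _ => C)
    (F := fun y t => G (y, t)) (F' := fun y t => fderiv ℝ G (y, t) (1, 0))
    (Metric.closedBall_mem_nhds x one_pos) ?_ ?_ ?_ ?_ ?_ ?_).2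
  · exact .of_forall fun y => (by fun_prop : Continuous fun t => G (y, t)).aestronglyMeasurable
  · exact (by fun_prop : Continuous fun t => G (x, t)).intervalIntegrable _ _
  · exact (by fun_prop : Continuous fun t => fderiv ℝ G (x, t) (1, 0)).aestronglyMeasurable
  · exact .of_forall fun t ht y hy => hC (y, t) ⟨hy, Set.uIoc_subset_uIcc ht⟩
  · exact intervalIntegrable_const
  · exact .of_forall fun t _ y _ =>
      ((hG.differentiable one_ne_zero (y, t)).hasFDerivAt).comp_hasDerivAt y
        ((hasDerivAt_id y).prodMk (hasDerivAt_const y t))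

/-- Second directional derivatives of a `C²` map commute. -/
theorem fderiv_fderiv_apply_comm {E F : Type*} [NormedAddCommGroup E] [NormedSpace ℝ E]
    [NormedAddCommGroup F] [NormedSpace ℝ F] {f : E → F} (hf : ContDiff ℝ 2 f) (x v w : E) :
    fderiv ℝ (fun y => fderiv ℝ f y v) x w = fderiv ℝ (fun y => fderiv ℝ f y w) x v := by
  have hd : DifferentiableAt ℝ (fderiv ℝ f) x :=
    (hf.fderiv_right (m := 1) (by norm_num)).differentiable one_ne_zero x
  have hs : IsSymmSndFDerivAt ℝ f x := hf.contDiffAt.isSymmSndFDerivAt (by simp)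
  simpa [fderiv_clm_apply hd (differentiableAt_const _)] using hs w v

theorem fderiv_apply_prodMk {n : ℕ} (L : (Fin n → ℝ) × (Fin n → ℝ) → ℝ)
    (p : (Fin n → ℝ) × (Fin n → ℝ)) (u w : Fin n → ℝ) :
    fderiv ℝ L p (u, w) = D1 L p u + D2 L p w := by
  simp [D1, D2, ← map_add]

theorem contDiff_D2 {n : ℕ} {L : (Fin n → ℝ) × (Fin n → ℝ) → ℝ}
    (hL : ContDiff ℝ (⊤ : ℕ∞) L) : ContDiff ℝ (⊤ : ℕ∞) (D2 L) :=
  (hL.fderiv_right (m := (⊤ : ℕ∞)) (by simp)).clm_comp contDiff_const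

theorem contDiff_D1 {n : ℕ} {L : (Fin n → ℝ) × (Fin n → ℝ) → ℝ}
    (hL : ContDiff ℝ (⊤ : ℕ∞) L) : ContDiff ℝ (⊤ : ℕ∞) (D1 L) :=
  (hL.fderiv_right (m := (⊤ : ℕ∞)) (by simp)).clm_comp contDiff_const

/-- Integration by parts for a family of functionals `A` paired with a family of vectors `u`. -/
theorem integral_add_clm_apply_deriv {E F : Type*} [NormedAddCommGroup E] [NormedSpace ℝ E]
    [NormedAddCommGroup F] [NormedSpace ℝ F] [CompleteSpace F] {f : ℝ → F} {A : ℝ → E →L[ℝ] F}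
    {u : ℝ → E} (hf : Continuous f) (hA : ContDiff ℝ 1 A) (hu : ContDiff ℝ 1 u) (a b : ℝ) :
    ∫ t in a..b, (f t + A t (deriv u t)) =
      (∫ t in a..b, (f t - deriv A t (u t))) + A b (u b) - A a (u a) := by
  have hA' : Continuous fun t => deriv A t (u t) :=
    (hA.continuous_deriv le_rfl).clm_apply hu.continuous
  have hu' : Continuous fun t => A t (deriv u t) :=
    hA.continuous.clm_apply (hu.continuous_deriv le_rfl)
  have hparts := integral_eq_sub_of_hasDerivAt (a := a) (b := b)
    (fun t _ => (hA.differentiable one_ne_zero t).hasDerivAt.clm_apply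
      (hu.differentiable one_ne_zero t).hasDerivAt) ((hA'.add hu').intervalIntegrable a b)
  rw [add_sub_assoc, ← hparts]
  refine Eq.trans ?_ (integral_add ((hf.sub hA').intervalIntegrable a b)
    ((hA'.add hu').intervalIntegrable a b))
  simp only [← add_assoc, sub_add_cancel]

theorem statement0 {n : ℕ} (L : (Fin n → ℝ) × (Fin n → ℝ) → ℝ)
    (hL : ContDiff ℝ (⊤ : ℕ∞) L)
    (q : ℝ × ℝ → Fin n → ℝ) (hq : ContDiff ℝ (⊤ : ℕ∞) q)
    (a b : ℝ) (hab : a < b)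
    (q₀ : ℝ → Fin n → ℝ) (hq₀ : ∀ t, q₀ t = q (0, t))
    (δq : ℝ → Fin n → ℝ) (hδq : ∀ t, δq t = fderiv ℝ q (0, t) (1, 0)) :
    HasDerivAt
      (fun ε : ℝ => ∫ t in a..b, L (q (ε, t), fderiv ℝ q (ε, t) (0, 1)))
      ((∫ t in a..b,
          (D1 L (q₀ t, deriv q₀ t) (δq t)
            - deriv (fun s => D2 L (q₀ s, deriv q₀ s)) t (δq t)))
        + D2 L (q₀ b, deriv q₀ b) (δq b)
        - D2 L (q₀ a, deriv q₀ a) (δq a)) 0 := by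
  obtain rfl : q₀ = fun t => q (0, t) := funext hq₀
  obtain rfl : δq = fun t => fderiv ℝ q (0, t) (1, 0) := funext hδq
  have hline : ∀ {f : ℝ × ℝ → Fin n → ℝ}, ContDiff ℝ (⊤ : ℕ∞) f → ∀ t,
      deriv (fun s => f (0, s)) t = fderiv ℝ f (0, t) (0, 1) := fun {f} hf t =>
    ((hf.differentiable (by simp) (0, t)).hasFDerivAt.comp_hasDerivAt t
      ((hasDerivAt_const t (0 : ℝ)).prodMk (hasDerivAt_id t))).deriv
  have hpartial : ∀ e : ℝ × ℝ, ContDiff ℝ (⊤ : ℕ∞) fun p => fderiv ℝ q p e := fun e =>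
    (hq.fderiv_right (m := (⊤ : ℕ∞)) (by simp)).clm_apply contDiff_const
  have hjet : ContDiff ℝ (⊤ : ℕ∞) fun p => (q p, fderiv ℝ q p (0, 1)) := hq.prodMk (hpartial _)
  have hslice : ContDiff ℝ (⊤ : ℕ∞) fun t : ℝ => ((0 : ℝ), t) := contDiff_const.prodMk contDiff_id
  have hδ : ContDiff ℝ (⊤ : ℕ∞) fun t => fderiv ℝ q (0, t) (1, 0) := (hpartial (1, 0)).comp hslice
  have hle : (1 : WithTop ℕ∞) ≤ ((⊤ : ℕ∞) : WithTop ℕ∞) := by exact_mod_cast le_top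
  have hvar : ∀ t, fderiv ℝ (fun p => L (q p, fderiv ℝ q p (0, 1))) (0, t) (1, 0) =
      D1 L (q (0, t), fderiv ℝ q (0, t) (0, 1)) (fderiv ℝ q (0, t) (1, 0)) +
        D2 L (q (0, t), fderiv ℝ q (0, t) (0, 1))
          (deriv (fun s => fderiv ℝ q (0, s) (1, 0)) t) := fun t => by
    rw [hline (hpartial (1, 0)), fderiv_fderiv_apply_comm (hq.of_le (WithTop.coe_le_coe.2 le_top)),
      ← fderiv_apply_prodMk]
    have hG := ((hL.differentiable (by simp) _).hasFDerivAt).comp (0, t)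
      ((hq.differentiable (by simp) (0, t)).hasFDerivAt.prodMk
        ((hpartial (0, 1)).differentiable (by simp) (0, t)).hasFDerivAt)
    exact congrArg (· (1, 0)) hG.fderiv
  have hderiv := hasDerivAt_intervalIntegral_of_contDiff ((hL.comp hjet).of_le hle) a b 0
  refine hderiv.congr_deriv ?_
  simp only [hline hq]
  refine (integral_congr fun t _ => hvar t).trans ?_
  exact integral_add_clm_apply_deriv
    (((contDiff_D1 hL).comp (hjet.comp hslice)).continuous.clm_apply hδ.continuous)
    (((contDiff_D2 hL).comp (hjet.comp hslice)).of_le hle) (hδ.of_le hle) a b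

end Stmt0
end

section
/- Let L : ℝⁿ × ℝⁿ → ℝ be smooth, let a < b, and let q : ℝ → ℝⁿ be smooth. Suppose that for every smooth δ : ℝ → ℝⁿ with δ(a) = 0 and δ(b) = 0 one has d/dε|_{ε=0} ∫ₐᵇ L(q(t) + ε δ(t), q'(t) + ε δ'(t)) dt = 0. Then q satisfies the Euler–Lagrange equations on [a,b], i.e. for every t ∈ [a,b] the map t ↦ D₂L(q(t),q'(t)) is differentiable with derivative equal to D₁L(q(t),q'(t)). -/
open intervalIntegral

namespace Stmt1

/-- Partial Fréchet derivative of `L` in its first `ℝⁿ` argument, as a linear functional. -/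
noncomputable def D1 {n : ℕ} (L : (Fin n → ℝ) × (Fin n → ℝ) → ℝ)
    (p : (Fin n → ℝ) × (Fin n → ℝ)) : (Fin n → ℝ) →L[ℝ] ℝ :=
  (fderiv ℝ L p).comp (ContinuousLinearMap.inl ℝ (Fin n → ℝ) (Fin n → ℝ))

/-- Partial Fréchet derivative of `L` in its second `ℝⁿ` argument, as a linear functional. -/
noncomputable def D2 {n : ℕ} (L : (Fin n → ℝ) × (Fin n → ℝ) → ℝ)
    (p : (Fin n → ℝ) × (Fin n → ℝ)) : (Fin n → ℝ) →L[ℝ] ℝ :=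
  (fderiv ℝ L p).comp (ContinuousLinearMap.inr ℝ (Fin n → ℝ) (Fin n → ℝ))

/-- First variation: differentiation under the integral sign along an affine family of curves. -/
lemma hasDerivAt_integral_comp_add_smul {V : Type*} [NormedAddCommGroup V] [NormedSpace ℝ V]
    {L : V → ℝ} (hL : ContDiff ℝ 1 L) {γ η : ℝ → V} (hγ : Continuous γ) (hη : Continuous η)
    (a b : ℝ) :
    HasDerivAt (fun ε : ℝ => ∫ t in a..b, L (γ t + ε • η t))
      (∫ t in a..b, fderiv ℝ L (γ t) (η t)) 0 := by
  have hL' : Continuous (fderiv ℝ L) := hL.continuous_fderiv one_ne_zero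
  have hF : Continuous fun p : ℝ × ℝ => fderiv ℝ L (γ p.2 + p.1 • η p.2) (η p.2) := by
    fun_prop
  have hLc := hL.continuous
  obtain ⟨C, hC⟩ := ((isCompact_closedBall (0 : ℝ) 1).prod
    (isCompact_uIcc (a := a) (b := b))).exists_bound_of_continuousOn hF.continuousOn
  have key := hasDerivAt_integral_of_dominated_loc_of_deriv_le (μ := MeasureTheory.volume)
    (F := fun (ε t : ℝ) => L (γ t + ε • η t))
    (F' := fun (ε t : ℝ) => fderiv ℝ L (γ t + ε • η t) (η t)) (x₀ := (0 : ℝ))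
    (a := a) (b := b) (bound := fun _ => C)
    (Metric.closedBall_mem_nhds 0 one_pos)
    (.of_forall fun ε => Continuous.aestronglyMeasurable (by fun_prop))
    (Continuous.intervalIntegrable (by fun_prop) _ _)
    (Continuous.aestronglyMeasurable (by fun_prop))
    (.of_forall fun t ht ε hε => hC (ε, t) ⟨hε, Set.uIoc_subset_uIcc ht⟩)
    intervalIntegrable_const
    (.of_forall fun t _ ε _ => by
      have h : HasDerivAt (fun ε : ℝ => γ t + ε • η t) (η t) ε := by
        simpa using ((hasDerivAt_id ε).smul_const (η t)).const_add (γ t)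
      exact ((hL.differentiable one_ne_zero _).hasFDerivAt).comp_hasDerivAt ε h)
  simpa using key.2

lemma fderiv_apply_prod {n : ℕ} (L : (Fin n → ℝ) × (Fin n → ℝ) → ℝ)
    (p : (Fin n → ℝ) × (Fin n → ℝ)) (v w : Fin n → ℝ) :
    fderiv ℝ L p (v, w) = D1 L p v + D2 L p w := by
  simp [D1, D2, ← map_add]

lemma sum_mul_apply_single {n : ℕ} (f : (Fin n → ℝ) →L[ℝ] ℝ) :
    f (fun i => f (Pi.single i 1)) = ∑ i, f (Pi.single i 1) ^ 2 := by
  conv_lhs => rw [pi_eq_sum_univ' (fun i => f (Pi.single i 1))]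
  simp only [map_sum, map_smul, smul_eq_mul, sq]

/-- Fundamental lemma of the calculus of variations, for smooth covector-valued curves. -/
lemma eq_zero_of_integral_apply_eq_zero {n : ℕ} {a b : ℝ} (hab : a < b)
    {E : ℝ → (Fin n → ℝ) →L[ℝ] ℝ} (hE : ContDiff ℝ (⊤ : ℕ∞) E)
    (h : ∀ δ : ℝ → Fin n → ℝ, ContDiff ℝ (⊤ : ℕ∞) δ → δ a = 0 → δ b = 0 →
      ∫ t in a..b, E t (δ t) = 0) :
    ∀ t ∈ Set.Icc a b, E t = 0 := by
  have hEc := hE.continuous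
  have hopen : Set.Ioo a b ⊆ {t | E t = 0} := by
    intro t ht
    by_contra hne
    have hsmooth : ContDiff ℝ (⊤ : ℕ∞)
        (fun s => ((s - a) * (b - s)) • fun i => E s (Pi.single i 1)) := by
      fun_prop
    have hzero := h _ hsmooth (by simp) (by simp)
    simp only [map_smul, sum_mul_apply_single, smul_eq_mul] at hzero
    refine (integral_pos hab (by fun_prop) (fun s hs => ?_) ⟨t, ⟨ht.1.le, ht.2.le⟩, ?_⟩).ne' hzero
    · exact mul_nonneg (mul_nonneg (sub_nonneg.2 hs.1.le) (sub_nonneg.2 hs.2))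
        (Finset.sum_nonneg fun i _ => sq_nonneg _)
    · refine mul_pos (mul_pos (sub_pos.2 ht.1) (sub_pos.2 ht.2)) ?_
      refine (Finset.sum_nonneg fun i _ => sq_nonneg _).lt_of_ne' fun hsum => hne ?_
      rw [Finset.sum_eq_zero_iff_of_nonneg fun i _ => sq_nonneg _] at hsum
      refine ContinuousLinearMap.coe_injective (LinearMap.pi_ext' fun i => ?_)
      ext
      simpa using hsum i (Finset.mem_univ i)
  rw [← closure_Ioo hab.ne]
  exact closure_minimal hopen (isClosed_eq hEc continuous_const)

theorem statement1 {n : ℕ} (L : (Fin n → ℝ) × (Fin n → ℝ) → ℝ)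
    (hL : ContDiff ℝ (⊤ : ℕ∞) L)
    (a b : ℝ) (hab : a < b)
    (q : ℝ → Fin n → ℝ) (hq : ContDiff ℝ (⊤ : ℕ∞) q)
    (hstat : ∀ δ : ℝ → Fin n → ℝ, ContDiff ℝ (⊤ : ℕ∞) δ → δ a = 0 → δ b = 0 →
      HasDerivAt
        (fun ε : ℝ => ∫ t in a..b, L (q t + ε • δ t, deriv q t + ε • deriv δ t)) 0 0) :
    ∀ t ∈ Set.Icc a b,
      HasDerivAt (fun s => D2 L (q s, deriv q s)) (D1 L (q t, deriv q t)) t := by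
  have hγ : ContDiff ℝ (⊤ : ℕ∞) fun s => (q s, deriv q s) :=
    hq.prodMk (contDiff_infty_iff_deriv.1 hq).2
  have hdL : ContDiff ℝ (⊤ : ℕ∞) fun s => fderiv ℝ L (q s, deriv q s) :=
    (contDiff_infty_iff_fderiv.1 hL).2.comp hγ
  have hD1 : ContDiff ℝ (⊤ : ℕ∞) fun s => D1 L (q s, deriv q s) :=
    hdL.clm_comp contDiff_const
  have hD2 : ContDiff ℝ (⊤ : ℕ∞) fun s => D2 L (q s, deriv q s) :=
    hdL.clm_comp contDiff_const
  obtain ⟨hD2diff, hD2'⟩ := contDiff_infty_iff_deriv.1 hD2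
  have hEL := eq_zero_of_integral_apply_eq_zero hab (hD1.sub hD2') ?_
  · intro t ht
    rw [sub_eq_zero.1 (hEL t ht)]
    exact (hD2diff t).hasDerivAt
  intro δ hδ hδa hδb
  obtain ⟨hδdiff, hδ'⟩ := contDiff_infty_iff_deriv.1 hδ
  have hδc := hδ.continuous
  have hδ'c := hδ'.continuous
  have hD1c := hD1.continuous
  have hD2c := hD2.continuous
  have hD2'c := hD2'.continuous
  have hvar := (hasDerivAt_integral_comp_add_smul (hL.of_le (by norm_cast))
    hγ.continuous (hδc.prodMk hδ'c) a b).unique (hstat δ hδ hδa hδb)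
  have hparts := integral_eq_sub_of_hasDerivAt (a := a) (b := b)
    (fun t _ => (hD2diff t).hasDerivAt.clm_apply (hδdiff t).hasDerivAt)
    (Continuous.intervalIntegrable (by fun_prop) _ _)
  simp only [hδa, hδb, map_zero, sub_zero] at hparts
  simp only [fderiv_apply_prod] at hvar
  rw [← sub_zero (0 : ℝ)]
  nth_rewrite 1 [← hvar]
  rw [← hparts, ← integral_sub (Continuous.intervalIntegrable (by fun_prop) _ _)
    (Continuous.intervalIntegrable (by fun_prop) _ _)]
  refine integral_congr fun t _ => ?_
  simp

end Stmt1
end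

section
/- Let L : ℝⁿ × ℝⁿ → ℝ be smooth and let F : ℝ × (ℝⁿ × ℝⁿ) → ℝⁿ × ℝⁿ be smooth with F(0,x) = x for all x, such that for each x = (q,v), writing F(s,x) = (Q(s,x), V(s,x)), one has ∂Q/∂s(s,x) = V(s,x) and the map s ↦ D₂L(Q(s,x),V(s,x)) is differentiable with derivative D₁L(Q(s,x),V(s,x)) (i.e. each trajectory solves the Euler–Lagrange equations). Define S_t(x) = ∫₀ᵗ L(F(s,x)) ds, and define θ_L(q,v) ∈ (ℝⁿ × ℝⁿ)* by θ_L(q,v)(a,b) = D₂L(q,v)(a). Then for all t, all x, and all w ∈ ℝⁿ × ℝⁿ: D_x S_t(x)(w) = θ_L(F(t,x))( D_x F(t,x)(w) ) − θ_L(x)(w), where D_x denotes the Fréchet derivative with respect to x. -/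
open intervalIntegral

namespace Stmt2

/-- Partial Fréchet derivative of `L` in its first `ℝⁿ` argument, as a linear functional. -/
noncomputable def D1 {n : ℕ} (L : (Fin n → ℝ) × (Fin n → ℝ) → ℝ)
    (p : (Fin n → ℝ) × (Fin n → ℝ)) : (Fin n → ℝ) →L[ℝ] ℝ :=
  (fderiv ℝ L p).comp (ContinuousLinearMap.inl ℝ (Fin n → ℝ) (Fin n → ℝ))

/-- Partial Fréchet derivative of `L` in its second `ℝⁿ` argument, as a linear functional. -/
noncomputable def D2 {n : ℕ} (L : (Fin n → ℝ) × (Fin n → ℝ) → ℝ)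
    (p : (Fin n → ℝ) × (Fin n → ℝ)) : (Fin n → ℝ) →L[ℝ] ℝ :=
  (fderiv ℝ L p).comp (ContinuousLinearMap.inr ℝ (Fin n → ℝ) (Fin n → ℝ))

/-- The Lagrange 1-form: `θ_L(q,v)(a,b) = D₂L(q,v)(a)`. -/
noncomputable def thetaL {n : ℕ} (L : (Fin n → ℝ) × (Fin n → ℝ) → ℝ)
    (p : (Fin n → ℝ) × (Fin n → ℝ)) : ((Fin n → ℝ) × (Fin n → ℝ)) →L[ℝ] ℝ :=
  (D2 L p).comp (ContinuousLinearMap.fst ℝ (Fin n → ℝ) (Fin n → ℝ))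

open Set Metric in
/-- Differentiation under the integral sign for a `C¹` integrand on a compact interval. -/
theorem hasFDerivAt_intervalIntegral_of_contDiff {E : Type*} [NormedAddCommGroup E]
    [NormedSpace ℝ E] [ProperSpace E] {G : ℝ × E → ℝ} (hG : ContDiff ℝ 1 G) (a b : ℝ) (x : E) :
    HasFDerivAt (fun y => ∫ s in a..b, G (s, y))
      (∫ s in a..b, (fderiv ℝ G (s, x)).comp (ContinuousLinearMap.inr ℝ ℝ E)) x := by
  have hcont : Continuous fun p : ℝ × E =>
      (fderiv ℝ G p).comp (ContinuousLinearMap.inr ℝ ℝ E) :=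
    (hG.continuous_fderiv one_ne_zero).clm_comp continuous_const
  obtain ⟨C, hC⟩ := (isCompact_uIcc (a := a) (b := b)).prod (isCompact_closedBall x 1)
    |>.exists_bound_of_continuousOn hcont.continuousOn
  refine intervalIntegral.hasFDerivAt_integral_of_dominated_of_fderiv_le
    (F' := fun y s => (fderiv ℝ G (s, y)).comp (ContinuousLinearMap.inr ℝ ℝ E))
    (bound := fun _ => C) (closedBall_mem_nhds x one_pos) ?_ ?_ ?_ ?_ ?_ ?_
  · exact .of_forall fun y =>
      (hG.continuous.comp (by fun_prop : Continuous fun s : ℝ => (s, y))).aestronglyMeasurable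
  · exact (hG.continuous.comp
      (by fun_prop : Continuous fun s : ℝ => (s, x))).intervalIntegrable a b
  · exact (hcont.comp (by fun_prop : Continuous fun s : ℝ => (s, x))).aestronglyMeasurable
  · exact .of_forall fun s hs y hy => hC (s, y) ⟨uIoc_subset_uIcc hs, hy⟩
  · exact intervalIntegrable_const
  · exact .of_forall fun s _ y _ =>
      ((hG.differentiable one_ne_zero) (s, y)).hasFDerivAt.comp y (hasFDerivAt_prodMk_right s y)

/-- Symmetry of second derivatives: the time derivative of a spatial derivative is the spatial
derivative of the time derivative. -/
theorem hasDerivAt_fderiv_inr_of_contDiff {E H : Type*} [NormedAddCommGroup E] [NormedSpace ℝ E]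
    [NormedAddCommGroup H] [NormedSpace ℝ H] {G g : ℝ × E → H} (hG : ContDiff ℝ 2 G)
    (hg : ∀ s x, HasDerivAt (fun r => G (r, x)) (g (s, x)) s) (s : ℝ) (x w : E) :
    HasDerivAt (fun r => fderiv ℝ G (r, x) (0, w)) (fderiv ℝ g (s, x) (0, w)) s := by
  have hg' : g = fun p => fderiv ℝ G p (1, 0) := by
    funext ⟨r, y⟩
    exact (hg r y).unique <|
      ((hG.differentiable two_ne_zero) (r, y)).hasFDerivAt.comp_hasDerivAt r
        ((hasDerivAt_id r).prodMk (hasDerivAt_const r y))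
  have hd : DifferentiableAt ℝ (fderiv ℝ G) (s, x) :=
    ((hG.fderiv_right (m := 1) le_rfl).differentiable one_ne_zero) (s, x)
  have hsymm : fderiv ℝ g (s, x) (0, w) = fderiv ℝ (fderiv ℝ G) (s, x) (1, 0) (0, w) := by
    rw [hg', fderiv_clm_apply hd (differentiableAt_const _)]
    simpa using (hG.contDiffAt.isSymmSndFDerivAt (by simp)).eq (0, w) (1, 0)
  rw [hsymm]
  have h := hd.hasFDerivAt.comp_hasDerivAt s ((hasDerivAt_id s).prodMk (hasDerivAt_const s x))
  simpa using h.clm_apply (hasDerivAt_const s ((0 : ℝ), w))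

/-- A differential splits as the sum of its two partial derivatives. -/
theorem D1_add_D2 {n : ℕ} (L : (Fin n → ℝ) × (Fin n → ℝ) → ℝ)
    (p u : (Fin n → ℝ) × (Fin n → ℝ)) : D1 L p u.1 + D2 L p u.2 = fderiv ℝ L p u := by
  simp [D1, D2, ← map_add]

theorem statement2 {n : ℕ} (L : (Fin n → ℝ) × (Fin n → ℝ) → ℝ)
    (hL : ContDiff ℝ (⊤ : ℕ∞) L)
    (F : ℝ × ((Fin n → ℝ) × (Fin n → ℝ)) → (Fin n → ℝ) × (Fin n → ℝ))
    (hF : ContDiff ℝ (⊤ : ℕ∞) F)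
    (hF0 : ∀ x, F (0, x) = x)
    (hsecond : ∀ (x : (Fin n → ℝ) × (Fin n → ℝ)) (s : ℝ),
      HasDerivAt (fun r => (F (r, x)).1) ((F (s, x)).2) s)
    (hEL : ∀ (x : (Fin n → ℝ) × (Fin n → ℝ)) (s : ℝ),
      HasDerivAt (fun r => D2 L (F (r, x))) (D1 L (F (s, x))) s) :
    ∀ (t : ℝ) (x w : (Fin n → ℝ) × (Fin n → ℝ)),
      fderiv ℝ (fun x' => ∫ s in (0:ℝ)..t, L (F (s, x'))) x w
        = thetaL L (F (t, x)) (fderiv ℝ (fun x' => F (t, x')) x w) - thetaL L x w := by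
  intro t x w
  have hFd : Differentiable ℝ F := hF.differentiable (by simp)
  have hLd : Differentiable ℝ L := hL.differentiable (by simp)
  have hLF : ContDiff ℝ 1 (L ∘ F) := (hL.comp hF).of_le (by simp)
  have hslice (r : ℝ) : fderiv ℝ (fun y => F (r, y)) x w = fderiv ℝ F (r, x) (0, w) := by
    have h := ((hFd (r, x)).hasFDerivAt.comp x (hasFDerivAt_prodMk_right r x)).fderiv
    exact DFunLike.congr_fun h w
  have hderiv (s : ℝ) : HasDerivAt (fun r => thetaL L (F (r, x)) (fderiv ℝ F (r, x) (0, w)))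
      (fderiv ℝ (L ∘ F) (s, x) (0, w)) s := by
    have hvar := hasDerivAt_fderiv_inr_of_contDiff (G := fun p => (F p).1)
      (g := fun p => (F p).2) (contDiff_infty.1 hF.fst 2)
      (fun r y => hsecond y r) s x w
    simp only [fun p => fderiv.fst (hFd p), fun p => fderiv.snd (hFd p)] at hvar
    have h := (hEL x s).clm_apply hvar
    rw [fderiv_comp (s, x) (hLd _) (hFd _), ContinuousLinearMap.comp_apply, ← D1_add_D2]
    exact h
  have hcont : Continuous fun s : ℝ =>
      (fderiv ℝ (L ∘ F) (s, x)).comp (ContinuousLinearMap.inr ℝ ℝ ((Fin n → ℝ) × (Fin n → ℝ))) :=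
    ((hLF.continuous_fderiv one_ne_zero).comp (by fun_prop)).clm_comp continuous_const
  have hFTC := intervalIntegral.integral_eq_sub_of_hasDerivAt (fun s _ => hderiv s)
    ((hcont.clm_apply continuous_const).intervalIntegrable 0 t)
  have hS := (hasFDerivAt_intervalIntegral_of_contDiff hLF 0 t x).fderiv
  simp only [Function.comp_apply] at hS
  rw [hS, ContinuousLinearMap.intervalIntegral_apply (hcont.intervalIntegrable 0 t)]
  refine hFTC.trans ?_
  rw [← hslice, ← hslice, hF0]
  simp [hF0]

end Stmt2
end

section
/- Let L : ℝⁿ × ℝⁿ → ℝ be smooth and let F : ℝ × (ℝⁿ × ℝⁿ) → ℝⁿ × ℝⁿ be smooth with F(0,x) = x for all x, such that for each x = (q,v), writing F(s,x) = (Q(s,x), V(s,x)), one has ∂Q/∂s(s,x) = V(s,x) and the map s ↦ D₂L(Q(s,x),V(s,x)) is differentiable with derivative D₁L(Q(s,x),V(s,x)). Define Θ : ℝⁿ × ℝⁿ → (ℝⁿ × ℝⁿ)* by Θ(x)(a,b) = D₂L(x)(a), and define the Lagrange 2-form ω_L(x)(w₁,w₂) = DΘ(x)(w₁)(w₂) −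 DΘ(x)(w₂)(w₁), where DΘ(x) is the Fréchet derivative of Θ at x. Then the flow is symplectic: for all t, x and all w₁, w₂ ∈ ℝⁿ × ℝⁿ, ω_L(F(t,x))( D_x F(t,x)(w₁), D_x F(t,x)(w₂) ) = ω_L(x)(w₁,w₂). -/
namespace Stmt3

/-- Partial Fréchet derivative of `L` in its first `ℝⁿ` argument, as a linear functional. -/
noncomputable def D1 {n : ℕ} (L : (Fin n → ℝ) × (Fin n → ℝ) → ℝ)
    (p : (Fin n → ℝ) × (Fin n → ℝ)) : (Fin n → ℝ) →L[ℝ] ℝ :=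
  (fderiv ℝ L p).comp (ContinuousLinearMap.inl ℝ (Fin n → ℝ) (Fin n → ℝ))

/-- Partial Fréchet derivative of `L` in its second `ℝⁿ` argument, as a linear functional. -/
noncomputable def D2 {n : ℕ} (L : (Fin n → ℝ) × (Fin n → ℝ) → ℝ)
    (p : (Fin n → ℝ) × (Fin n → ℝ)) : (Fin n → ℝ) →L[ℝ] ℝ :=
  (fderiv ℝ L p).comp (ContinuousLinearMap.inr ℝ (Fin n → ℝ) (Fin n → ℝ))

/-- The Lagrange 1-form: `Θ(x)(a,b) = D₂L(x)(a)`. -/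
noncomputable def Theta {n : ℕ} (L : (Fin n → ℝ) × (Fin n → ℝ) → ℝ)
    (p : (Fin n → ℝ) × (Fin n → ℝ)) : ((Fin n → ℝ) × (Fin n → ℝ)) →L[ℝ] ℝ :=
  (D2 L p).comp (ContinuousLinearMap.fst ℝ (Fin n → ℝ) (Fin n → ℝ))

/-- The Lagrange 2-form: `ω_L(x)(w₁,w₂) = DΘ(x)(w₁)(w₂) − DΘ(x)(w₂)(w₁)`. -/
noncomputable def omegaL {n : ℕ} (L : (Fin n → ℝ) × (Fin n → ℝ) → ℝ)
    (x w₁ w₂ : (Fin n → ℝ) × (Fin n → ℝ)) : ℝ :=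
  fderiv ℝ (Theta L) x w₁ w₂ - fderiv ℝ (Theta L) x w₂ w₁

/-- Interchange of derivatives: if `H` is the time derivative of a `C²` map `G`, then the time
derivative of the space derivative of `G` is the space derivative of `H`. -/
lemma hasDerivAt_fderiv_slice {E X : Type*} [NormedAddCommGroup E] [NormedSpace ℝ E]
    [NormedAddCommGroup X] [NormedSpace ℝ X] {G H : ℝ × E → X} (hG : ContDiff ℝ 2 G)
    (hGH : ∀ x s, HasDerivAt (fun r => G (r, x)) (H (s, x)) s) (s : ℝ) (x w : E) :
    HasDerivAt (fun r => fderiv ℝ (fun x' => G (r, x')) x w)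
      (fderiv ℝ (fun x' => H (s, x')) x w) s := by
  have hd : Differentiable ℝ G := hG.differentiable (by norm_num)
  have hd2 : Differentiable ℝ (fderiv ℝ G) :=
    (hG.fderiv_right (m := 1) (by norm_num)).differentiable (by norm_num)
  have htime : ∀ (r : ℝ) (y : E), HasDerivAt (fun r' => (r', y)) ((1 : ℝ), (0 : E)) r :=
    fun r y => (hasDerivAt_id r).prodMk (hasDerivAt_const r y)
  have hspace : ∀ (r : ℝ) (y : E),
      HasFDerivAt (fun y' => (r, y')) (ContinuousLinearMap.inr ℝ ℝ E) y :=
    fun r y => hasFDerivAt_prodMk_right r y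
  have hH : ∀ r y, H (r, y) = fderiv ℝ G (r, y) (1, 0) := fun r y =>
    (hGH y r).unique ((hd (r, y)).hasFDerivAt.comp_hasDerivAt r (htime r y))
  have hGs : ∀ r, fderiv ℝ (fun x' => G (r, x')) x w = fderiv ℝ G (r, x) (0, w) := fun r => by
    have h : HasFDerivAt (fun x' => G (r, x'))
        ((fderiv ℝ G (r, x)).comp (ContinuousLinearMap.inr ℝ ℝ E)) x :=
      (hd (r, x)).hasFDerivAt.comp x (hspace r x)
    rw [h.fderiv]
    simp
  have hHs : fderiv ℝ (fun x' => H (s, x')) x w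
      = fderiv ℝ (fderiv ℝ G) (s, x) (0, w) (1, 0) := by
    have h : HasFDerivAt (fun x' => fderiv ℝ G (s, x'))
        ((fderiv ℝ (fderiv ℝ G) (s, x)).comp (ContinuousLinearMap.inr ℝ ℝ E)) x :=
      (hd2 (s, x)).hasFDerivAt.comp x (hspace s x)
    simp_rw [hH]
    rw [(h.clm_apply (hasFDerivAt_const ((1 : ℝ), (0 : E)) x)).fderiv]
    simp
  have hsymm := second_derivative_symmetric (fun y => (hd y).hasFDerivAt)
    (hd2 (s, x)).hasFDerivAt (0, w) (1, 0)
  rw [hHs, hsymm]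
  simp_rw [hGs]
  have h : HasDerivAt (fun r => fderiv ℝ G (r, x))
      (fderiv ℝ (fderiv ℝ G) (s, x) (1, 0)) s :=
    (hd2 (s, x)).hasFDerivAt.comp_hasDerivAt s (htime s x)
  simpa using h.clm_apply (hasDerivAt_const s ((0 : ℝ), w))

section

variable {n : ℕ} {L : (Fin n → ℝ) × (Fin n → ℝ) → ℝ} {y : (Fin n → ℝ) × (Fin n → ℝ)}

lemma differentiableAt_D1 (h : DifferentiableAt ℝ (fderiv ℝ L) y) :
    DifferentiableAt ℝ (D1 L) y :=
  h.clm_comp (differentiableAt_const _)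

lemma differentiableAt_D2 (h : DifferentiableAt ℝ (fderiv ℝ L) y) :
    DifferentiableAt ℝ (D2 L) y :=
  h.clm_comp (differentiableAt_const _)

lemma fderiv_D1_apply (h : DifferentiableAt ℝ (fderiv ℝ L) y)
    (w : (Fin n → ℝ) × (Fin n → ℝ)) :
    fderiv ℝ (D1 L) y w
      = (fderiv ℝ (fderiv ℝ L) y w).comp (ContinuousLinearMap.inl ℝ _ _) := by
  have h' : fderiv ℝ (D1 L) y = _ := (h.hasFDerivAt.clm_comp (hasFDerivAt_const
    (ContinuousLinearMap.inl ℝ (Fin n → ℝ) (Fin n → ℝ)) y)).fderiv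
  simpa using congrArg (fun f => f w) h'

lemma fderiv_D2_apply (h : DifferentiableAt ℝ (fderiv ℝ L) y)
    (w : (Fin n → ℝ) × (Fin n → ℝ)) :
    fderiv ℝ (D2 L) y w
      = (fderiv ℝ (fderiv ℝ L) y w).comp (ContinuousLinearMap.inr ℝ _ _) := by
  have h' : fderiv ℝ (D2 L) y = _ := (h.hasFDerivAt.clm_comp (hasFDerivAt_const
    (ContinuousLinearMap.inr ℝ (Fin n → ℝ) (Fin n → ℝ)) y)).fderiv
  simpa using congrArg (fun f => f w) h'

lemma fderiv_Theta_apply (h : DifferentiableAt ℝ (fderiv ℝ L) y)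
    (w : (Fin n → ℝ) × (Fin n → ℝ)) :
    fderiv ℝ (Theta L) y w
      = (fderiv ℝ (D2 L) y w).comp (ContinuousLinearMap.fst ℝ _ _) := by
  have h' : fderiv ℝ (Theta L) y = _ := ((differentiableAt_D2 h).hasFDerivAt.clm_comp (hasFDerivAt_const
    (ContinuousLinearMap.fst ℝ (Fin n → ℝ) (Fin n → ℝ)) y)).fderiv
  simpa using congrArg (fun f => f w) h'

/-- The Lagrange 2-form in terms of the Hessian of `L`. -/
lemma omegaL_eq (h : DifferentiableAt ℝ (fderiv ℝ L) y)
    (w₁ w₂ : (Fin n → ℝ) × (Fin n → ℝ)) :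
    omegaL L y w₁ w₂
      = ((fderiv ℝ (fderiv ℝ L) y w₁).comp (ContinuousLinearMap.inr ℝ _ _)) w₂.1
        - ((fderiv ℝ (fderiv ℝ L) y w₂).comp (ContinuousLinearMap.inr ℝ _ _)) w₁.1 := by
  simp only [omegaL, fderiv_Theta_apply h, fderiv_D2_apply h]
  rfl

end

theorem statement3 {n : ℕ} (L : (Fin n → ℝ) × (Fin n → ℝ) → ℝ)
    (hL : ContDiff ℝ (⊤ : ℕ∞) L)
    (F : ℝ × ((Fin n → ℝ) × (Fin n → ℝ)) → (Fin n → ℝ) × (Fin n → ℝ))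
    (hF : ContDiff ℝ (⊤ : ℕ∞) F)
    (hF0 : ∀ x, F (0, x) = x)
    (hsecond : ∀ (x : (Fin n → ℝ) × (Fin n → ℝ)) (s : ℝ),
      HasDerivAt (fun r => (F (r, x)).1) ((F (s, x)).2) s)
    (hEL : ∀ (x : (Fin n → ℝ) × (Fin n → ℝ)) (s : ℝ),
      HasDerivAt (fun r => D2 L (F (r, x))) (D1 L (F (s, x))) s) :
    ∀ (t : ℝ) (x w₁ w₂ : (Fin n → ℝ) × (Fin n → ℝ)),
      omegaL L (F (t, x))
          (fderiv ℝ (fun x' => F (t, x')) x w₁) (fderiv ℝ (fun x' => F (t, x')) x w₂)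
        = omegaL L x w₁ w₂ := by
  intro t x w₁ w₂
  have hL3 : ContDiff ℝ 3 L := contDiff_infty.1 hL 3
  have hdL : Differentiable ℝ L := hL.differentiable (by simp)
  have hdL2 : Differentiable ℝ (fderiv ℝ L) :=
    (hL3.fderiv_right (m := 2) (by norm_num)).differentiable (by norm_num)
  have hD2 : ContDiff ℝ 2 (D2 L) :=
    (hL3.fderiv_right (m := 2) (by norm_num)).clm_comp contDiff_const
  have hF2 : ContDiff ℝ 2 F := contDiff_infty.1 hF 2
  have hdF : ∀ s, Differentiable ℝ (fun x' => F (s, x')) := fun s =>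
    (hF2.differentiable (by norm_num)).comp
      ((differentiable_const s).prodMk differentiable_id)
  have hp := hasDerivAt_fderiv_slice (G := fun y => D2 L (F y)) (H := fun y => D1 L (F y))
    (hD2.comp hF2) hEL
  have hQ := hasDerivAt_fderiv_slice (G := fun y => (F y).1) (H := fun y => (F y).2)
    (contDiff_fst.comp hF2) hsecond
  have hp' : ∀ s w, fderiv ℝ (fun x' => D2 L (F (s, x'))) x w
      = (fderiv ℝ (fderiv ℝ L) (F (s, x)) (fderiv ℝ (fun x' => F (s, x')) x w)).comp
        (ContinuousLinearMap.inr ℝ _ _) := fun s w => by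
    rw [← fderiv_D2_apply (hdL2 _)]
    have h := fderiv_comp x (hD2.differentiable (by norm_num) (F (s, x))) (hdF s x)
    exact congrArg (fun f => f w) h
  have hp1' : ∀ s w, fderiv ℝ (fun x' => D1 L (F (s, x'))) x w
      = (fderiv ℝ (fderiv ℝ L) (F (s, x)) (fderiv ℝ (fun x' => F (s, x')) x w)).comp
        (ContinuousLinearMap.inl ℝ _ _) := fun s w => by
    rw [← fderiv_D1_apply (hdL2 _)]
    have h := fderiv_comp x (differentiableAt_D1 (hdL2 (F (s, x)))) (hdF s x)
    exact congrArg (fun f => f w) h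
  have hQ' : ∀ s w, fderiv ℝ (fun x' => (F (s, x')).1) x w
      = (fderiv ℝ (fun x' => F (s, x')) x w).1 := fun s w => by
    rw [(hdF s x).hasFDerivAt.fst.fderiv]; rfl
  have hV' : ∀ s w, fderiv ℝ (fun x' => (F (s, x')).2) x w
      = (fderiv ℝ (fun x' => F (s, x')) x w).2 := fun s w => by
    rw [(hdF s x).hasFDerivAt.snd.fderiv]; rfl
  have hderiv : ∀ s, HasDerivAt (fun r => omegaL L (F (r, x))
      (fderiv ℝ (fun x' => F (r, x')) x w₁) (fderiv ℝ (fun x' => F (r, x')) x w₂)) 0 s := by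
    intro s
    have h := ((hp s x w₁).clm_apply (hQ s x w₂)).sub ((hp s x w₂).clm_apply (hQ s x w₁))
    simp only [hp', hp1', hQ', hV'] at h
    have hsymm := second_derivative_symmetric (fun y => (hdL y).hasFDerivAt)
      (hdL2 (F (s, x))).hasFDerivAt (fderiv ℝ (fun x' => F (s, x')) x w₁)
      (fderiv ℝ (fun x' => F (s, x')) x w₂)
    have hsplit : ∀ (f : ((Fin n → ℝ) × (Fin n → ℝ)) →L[ℝ] ℝ) (a : (Fin n → ℝ) × (Fin n → ℝ)),
        (f.comp (ContinuousLinearMap.inl ℝ _ _)) a.1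
          + (f.comp (ContinuousLinearMap.inr ℝ _ _)) a.2 = f a := fun f a => by
      simp [← map_add]
    rw [hsplit, hsplit, hsymm, sub_self] at h
    simp only [omegaL_eq (hdL2 _)]
    exact h
  have hconst := is_const_of_deriv_eq_zero (fun s => (hderiv s).differentiableAt)
    (fun s => (hderiv s).deriv) t 0
  simpa [hF0] using hconst

end Stmt3
end

section
/- Let L : ℝⁿ × ℝⁿ → ℝ be smooth and let q : ℝ → ℝⁿ be a smooth solution of the Euler–Lagrange equations on an interval I. Let δ and η be Jacobi fields along q on I. Then the function t ↦ D(D₂L)(q(t),q'(t))(δ(t),δ'(t))(η(t)) − D(D₂L)(q(t),q'(t))(η(t),η'(t))(δ(t)) is constant on I. -/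
namespace Stmt4

/-- Partial Fréchet derivative of `L` in its first `ℝⁿ` argument, as a linear functional. -/
noncomputable def D1 {n : ℕ} (L : (Fin n → ℝ) × (Fin n → ℝ) → ℝ)
    (p : (Fin n → ℝ) × (Fin n → ℝ)) : (Fin n → ℝ) →L[ℝ] ℝ :=
  (fderiv ℝ L p).comp (ContinuousLinearMap.inl ℝ (Fin n → ℝ) (Fin n → ℝ))

/-- Partial Fréchet derivative of `L` in its second `ℝⁿ` argument, as a linear functional. -/
noncomputable def D2 {n : ℕ} (L : (Fin n → ℝ) × (Fin n → ℝ) → ℝ)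
    (p : (Fin n → ℝ) × (Fin n → ℝ)) : (Fin n → ℝ) →L[ℝ] ℝ :=
  (fderiv ℝ L p).comp (ContinuousLinearMap.inr ℝ (Fin n → ℝ) (Fin n → ℝ))

/-- `D(D₁L)(p)(u)`: the full Fréchet derivative of the covector-valued map `p ↦ D₁L(p)`
at `p` in the direction `u`, again a linear functional on `ℝⁿ`. -/
noncomputable def DD1 {n : ℕ} (L : (Fin n → ℝ) × (Fin n → ℝ) → ℝ)
    (p u : (Fin n → ℝ) × (Fin n → ℝ)) : (Fin n → ℝ) →L[ℝ] ℝ :=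
  fderiv ℝ (fun p' => D1 L p') p u

/-- `D(D₂L)(p)(u)`: the full Fréchet derivative of the covector-valued map `p ↦ D₂L(p)`
at `p` in the direction `u`, again a linear functional on `ℝⁿ`. -/
noncomputable def DD2 {n : ℕ} (L : (Fin n → ℝ) × (Fin n → ℝ) → ℝ)
    (p u : (Fin n → ℝ) × (Fin n → ℝ)) : (Fin n → ℝ) →L[ℝ] ℝ :=
  fderiv ℝ (fun p' => D2 L p') p u

theorem DD1_apply_add_DD2_apply {n : ℕ} {L : (Fin n → ℝ) × (Fin n → ℝ) → ℝ}
    (hL : ContDiff ℝ (⊤ : ℕ∞) L) (p u w : (Fin n → ℝ) × (Fin n → ℝ)) :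
    DD1 L p u w.1 + DD2 L p u w.2 = fderiv ℝ (fderiv ℝ L) p u w := by
  have hd : DifferentiableAt ℝ (fderiv ℝ L) p :=
    ((hL.fderiv_right (m := 1) (by norm_cast)).differentiable one_ne_zero) p
  have h1 : DD1 L p u w.1 = fderiv ℝ (fderiv ℝ L) p u (w.1, 0) := by
    have h := (hd.hasFDerivAt.clm_comp (hasFDerivAt_const
      (ContinuousLinearMap.inl ℝ (Fin n → ℝ) (Fin n → ℝ)) p)).fderiv
    simp only [DD1, D1]
    rw [h]
    simp
  have h2 : DD2 L p u w.2 = fderiv ℝ (fderiv ℝ L) p u (0, w.2) := by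
    have h := (hd.hasFDerivAt.clm_comp (hasFDerivAt_const
      (ContinuousLinearMap.inr ℝ (Fin n → ℝ) (Fin n → ℝ)) p)).fderiv
    simp only [DD2, D2]
    rw [h]
    simp
  rw [h1, h2, ← map_add]
  simp

theorem DD1_apply_add_DD2_apply_comm {n : ℕ} {L : (Fin n → ℝ) × (Fin n → ℝ) → ℝ}
    (hL : ContDiff ℝ (⊤ : ℕ∞) L) (p u w : (Fin n → ℝ) × (Fin n → ℝ)) :
    DD1 L p u w.1 + DD2 L p u w.2 = DD1 L p w u.1 + DD2 L p w u.2 := by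
  rw [DD1_apply_add_DD2_apply hL, DD1_apply_add_DD2_apply hL]
  have h2 : ContDiff ℝ 2 L := hL.of_le (WithTop.coe_le_coe.mpr le_top)
  exact (h2.contDiffAt.isSymmSndFDerivAt (by simp)).eq u w

theorem statement4 {n : ℕ} (L : (Fin n → ℝ) × (Fin n → ℝ) → ℝ)
    (hL : ContDiff ℝ (⊤ : ℕ∞) L)
    (I : Set ℝ) (hI : I.OrdConnected)
    (q : ℝ → Fin n → ℝ) (hq : ContDiff ℝ (⊤ : ℕ∞) q)
    -- `q` solves the Euler–Lagrange equations on `I`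
    (hqEL : ∀ t ∈ I, HasDerivAt (fun s => D2 L (q s, deriv q s)) (D1 L (q t, deriv q t)) t)
    (δ η : ℝ → Fin n → ℝ) (hδ : ContDiff ℝ (⊤ : ℕ∞) δ) (hη : ContDiff ℝ (⊤ : ℕ∞) η)
    -- `δ` and `η` are Jacobi fields (first-variation solutions) along `q` on `I`
    (hδJ : ∀ t ∈ I, HasDerivAt
      (fun s => DD2 L (q s, deriv q s) (δ s, deriv δ s))
      (DD1 L (q t, deriv q t) (δ t, deriv δ t)) t)
    (hηJ : ∀ t ∈ I, HasDerivAt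
      (fun s => DD2 L (q s, deriv q s) (η s, deriv η s))
      (DD1 L (q t, deriv q t) (η t, deriv η t)) t) :
    ∀ s ∈ I, ∀ t ∈ I,
      DD2 L (q s, deriv q s) (δ s, deriv δ s) (η s)
          - DD2 L (q s, deriv q s) (η s, deriv η s) (δ s)
        = DD2 L (q t, deriv q t) (δ t, deriv δ t) (η t)
          - DD2 L (q t, deriv q t) (η t, deriv η t) (δ t) := by
  have hderiv : ∀ x ∈ I, HasDerivWithinAt
      (fun s => DD2 L (q s, deriv q s) (δ s, deriv δ s) (η s)
          - DD2 L (q s, deriv q s) (η s, deriv η s) (δ s)) 0 I x := by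
    intro x hx
    have hδ' := (hδ.differentiable (by simp) x).hasDerivAt
    have hη' := (hη.differentiable (by simp) x).hasDerivAt
    have h := ((hδJ x hx).clm_apply hη').sub ((hηJ x hx).clm_apply hδ')
    rw [sub_eq_zero.mpr (DD1_apply_add_DD2_apply_comm hL (q x, deriv q x)
      (δ x, deriv δ x) (η x, deriv η x))] at h
    exact h.hasDerivWithinAt
  intro s hs t ht
  have h := hI.convex.norm_image_sub_le_of_norm_hasDerivWithin_le (C := 0) hderiv
    (fun _ _ => by simp) ht hs
  rw [zero_mul] at h
  exact sub_eq_zero.mp (norm_le_zero_iff.mp h)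

end Stmt4
end

section
/- Let L : ℝⁿ × ℝⁿ → ℝ be smooth and let η : ℝ × ℝⁿ → ℝⁿ be a smooth map with η(0,·) = id such that L is invariant: L( η(s,q), D_q η(s,q)(v) ) = L(q,v) for all s ∈ ℝ and (q,v) ∈ ℝⁿ × ℝⁿ, where D_q η(s,q) is the Fréchet derivative of η(s,·) at q. Set ξ(q) = ∂η/∂s(0,q). Then for every smooth solution q : ℝ → ℝⁿ of the Euler–Lagrange equations on an interval I, the momentum t ↦ D₂L(q(t),q'(t))( ξ(q(t)) ) is constant on I (Noether's theorem). -/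
namespace Stmt5

/-- Partial Fréchet derivative of `L` in its first `ℝⁿ` argument, as a linear functional. -/
noncomputable def D1 {n : ℕ} (L : (Fin n → ℝ) × (Fin n → ℝ) → ℝ)
    (p : (Fin n → ℝ) × (Fin n → ℝ)) : (Fin n → ℝ) →L[ℝ] ℝ :=
  (fderiv ℝ L p).comp (ContinuousLinearMap.inl ℝ (Fin n → ℝ) (Fin n → ℝ))

/-- Partial Fréchet derivative of `L` in its second `ℝⁿ` argument, as a linear functional. -/
noncomputable def D2 {n : ℕ} (L : (Fin n → ℝ) × (Fin n → ℝ) → ℝ)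
    (p : (Fin n → ℝ) × (Fin n → ℝ)) : (Fin n → ℝ) →L[ℝ] ℝ :=
  (fderiv ℝ L p).comp (ContinuousLinearMap.inr ℝ (Fin n → ℝ) (Fin n → ℝ))

/-- The derivative of `η` in its first, scalar argument is the value of
the full derivative on `(1, 0)`. -/
theorem hasDerivAt_partial_fst {E F : Type*} [NormedAddCommGroup E] [NormedSpace ℝ E]
    [NormedAddCommGroup F] [NormedSpace ℝ F] {η : ℝ × E → F} {s : ℝ} {x : E}
    (h : DifferentiableAt ℝ η (s, x)) :
    HasDerivAt (fun r => η (r, x)) (fderiv ℝ η (s, x) (1, 0)) s :=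
  h.hasFDerivAt.comp_hasDerivAt s ((hasDerivAt_id s).prodMk (hasDerivAt_const s x))

theorem fderiv_partial_snd {E F : Type*} [NormedAddCommGroup E] [NormedSpace ℝ E]
    [NormedAddCommGroup F] [NormedSpace ℝ F] {η : ℝ × E → F} {s : ℝ} {x : E}
    (h : DifferentiableAt ℝ η (s, x)) (v : E) :
    fderiv ℝ (fun y => η (s, y)) x v = fderiv ℝ η (s, x) (0, v) := by
  have h1 := h.hasFDerivAt.comp x (hasFDerivAt_prodMk_right s x)
  have h2 := h1.fderiv
  simp only [Function.comp_def] at h2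
  rw [h2]
  simp

theorem fderiv_apply_eq_D1_add_D2 {n : ℕ} (L : (Fin n → ℝ) × (Fin n → ℝ) → ℝ)
    (p : (Fin n → ℝ) × (Fin n → ℝ)) (a b : Fin n → ℝ) :
    fderiv ℝ L p (a, b) = D1 L p a + D2 L p b := by
  simp [D1, D2, ← map_add]

/-- Differentiating the invariance of `L` in the flow parameter at the identity. -/
theorem D1_add_D2_eq_zero_of_invariant {n : ℕ} {L : (Fin n → ℝ) × (Fin n → ℝ) → ℝ}
    (hL : Differentiable ℝ L) {η : ℝ × (Fin n → ℝ) → Fin n → ℝ} (hη : ContDiff ℝ 2 η)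
    (hη0 : ∀ x, η (0, x) = x)
    (hinv : ∀ (s : ℝ) (Q v : Fin n → ℝ),
      L (η (s, Q), fderiv ℝ (fun Q' => η (s, Q')) Q v) = L (Q, v))
    (x v : Fin n → ℝ) :
    D1 L (x, v) (fderiv ℝ η (0, x) (1, 0)) +
      D2 L (x, v) (fderiv ℝ (fderiv ℝ η) (0, x) (1, 0) (0, v)) = 0 := by
  have hd : Differentiable ℝ η := hη.differentiable (by norm_num)
  have hd' : Differentiable ℝ (fderiv ℝ η) :=
    (hη.fderiv_right (m := 1) (by norm_num)).differentiable (by norm_num)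
  have hid : fderiv ℝ η (0, x) (0, v) = v := by
    rw [← fderiv_partial_snd (hd _) v]
    simp [hη0]
  have hvel : HasDerivAt (fun s => fderiv ℝ η (s, x) (0, v))
      (fderiv ℝ (fderiv ℝ η) (0, x) (1, 0) (0, v)) 0 := by
    simpa using (hasDerivAt_partial_fst (hd' (0, x))).clm_apply
      (hasDerivAt_const (0 : ℝ) ((0 : ℝ), v))
  have hpair := (hasDerivAt_partial_fst (hd (0, x))).prodMk hvel
  have hcomp := (hL (η (0, x), fderiv ℝ η (0, x) (0, v))).hasFDerivAt.comp_hasDerivAt 0 hpair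
  have hconst : (L ∘ fun s => (η (s, x), fderiv ℝ η (s, x) (0, v))) = fun _ => L (x, v) := by
    funext s
    rw [Function.comp_apply, ← fderiv_partial_snd (hd _) v, hinv]
  rw [hconst, hη0, hid, fderiv_apply_eq_D1_add_D2] at hcomp
  exact hcomp.unique (hasDerivAt_const _ _)

theorem statement5 {n : ℕ} (L : (Fin n → ℝ) × (Fin n → ℝ) → ℝ)
    (hL : ContDiff ℝ (⊤ : ℕ∞) L)
    (η : ℝ × (Fin n → ℝ) → Fin n → ℝ) (hη : ContDiff ℝ (⊤ : ℕ∞) η)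
    (hη0 : ∀ x, η (0, x) = x)
    -- invariance of the Lagrangian under the flow of the symmetry
    (hinv : ∀ (s : ℝ) (Q v : Fin n → ℝ),
      L (η (s, Q), fderiv ℝ (fun Q' => η (s, Q')) Q v) = L (Q, v))
    (ξ : (Fin n → ℝ) → Fin n → ℝ) (hξ : ∀ x, ξ x = deriv (fun s => η (s, x)) 0)
    (I : Set ℝ) (hI : I.OrdConnected)
    (q : ℝ → Fin n → ℝ) (hq : ContDiff ℝ (⊤ : ℕ∞) q)
    -- `q` solves the Euler–Lagrange equations on `I`
    (hqEL : ∀ t ∈ I, HasDerivAt (fun s => D2 L (q s, deriv q s)) (D1 L (q t, deriv q t)) t) :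
    ∀ s ∈ I, ∀ t ∈ I,
      D2 L (q s, deriv q s) (ξ (q s)) = D2 L (q t, deriv q t) (ξ (q t)) := by
  have hη2 : ContDiff ℝ 2 η := contDiff_infty.1 hη 2
  have hd : Differentiable ℝ η := hη2.differentiable (by norm_num)
  have hd' : Differentiable ℝ (fderiv ℝ η) :=
    (hη2.fderiv_right (m := 1) (by norm_num)).differentiable (by norm_num)
  have hξ' : ∀ x, ξ x = fderiv ℝ η (0, x) (1, 0) := fun x => by
    rw [hξ, (hasDerivAt_partial_fst (hd (0, x))).deriv]
  have hmom : ∀ t ∈ I, HasDerivAt (fun s => D2 L (q s, deriv q s) (ξ (q s))) 0 t := by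
    intro t ht
    have hqt : HasDerivAt q (deriv q t) t := (hq.differentiable (by simp) t).hasDerivAt
    have hsymm := hη2.contDiffAt.isSymmSndFDerivAt (x := (0, q t)) (by simp) (1, 0) (0, deriv q t)
    have hξq : HasDerivAt (fun s => ξ (q s))
        (fderiv ℝ (fderiv ℝ η) (0, q t) (1, 0) (0, deriv q t)) t := by
      simp only [hξ']
      have h := (hd' (0, q t)).hasFDerivAt.comp_hasDerivAt t
        ((hasDerivAt_const t (0 : ℝ)).prodMk hqt)
      rw [hsymm]
      simpa using h.clm_apply (hasDerivAt_const t ((1 : ℝ), (0 : Fin n → ℝ)))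
    have h := (hqEL t ht).clm_apply hξq
    rwa [hξ', D1_add_D2_eq_zero_of_invariant (hL.differentiable (by simp)) hη2 hη0 hinv] at h
  intro s hs t ht
  have h := hI.convex.norm_image_sub_le_of_norm_hasDerivWithin_le (C := 0)
    (fun r hr => (hmom r hr).hasDerivWithinAt) (fun r _ => by simp) ht hs
  rw [zero_mul] at h
  exact sub_eq_zero.mp (norm_le_zero_iff.mp h)

end Stmt5
end

section
/- Let L : ℝⁿ × ℝⁿ → ℝ be smooth, let (q_k)_{k∈ℤ} be a sequence in ℝⁿ satisfying the discrete Euler–Lagrange equations, and let (δ_k)_{k∈ℤ} and (η_k)_{k∈ℤ} be discrete Jacobi fields along (q_k). Then the discrete symplectic form evaluated on the two first variations, ω_k := D(D₂L)(q_{k+1}, q_k)(δ_{k+1}, δ_k)(η_k) − D(D₂L)(q_{k+1}, q_k)(η_{k+1}, η_k)(δ_k), is independent of k ∈ ℤ. -/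
namespace Stmt7

/-- Partial Fréchet derivative of the discrete Lagrangian `L` in its first argument. -/
noncomputable def D1 {n : ℕ} (L : (Fin n → ℝ) × (Fin n → ℝ) → ℝ)
    (p : (Fin n → ℝ) × (Fin n → ℝ)) : (Fin n → ℝ) →L[ℝ] ℝ :=
  (fderiv ℝ L p).comp (ContinuousLinearMap.inl ℝ (Fin n → ℝ) (Fin n → ℝ))

/-- Partial Fréchet derivative of the discrete Lagrangian `L` in its second argument. -/
noncomputable def D2 {n : ℕ} (L : (Fin n → ℝ) × (Fin n → ℝ) → ℝ)
    (p : (Fin n → ℝ) × (Fin n → ℝ)) : (Fin n → ℝ) →L[ℝ] ℝ :=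
  (fderiv ℝ L p).comp (ContinuousLinearMap.inr ℝ (Fin n → ℝ) (Fin n → ℝ))

/-- `D(D₁L)(p)(u)`: the full Fréchet derivative of `p ↦ D₁L(p)` at `p` in direction `u`. -/
noncomputable def DD1 {n : ℕ} (L : (Fin n → ℝ) × (Fin n → ℝ) → ℝ)
    (p u : (Fin n → ℝ) × (Fin n → ℝ)) : (Fin n → ℝ) →L[ℝ] ℝ :=
  fderiv ℝ (fun p' => D1 L p') p u

/-- `D(D₂L)(p)(u)`: the full Fréchet derivative of `p ↦ D₂L(p)` at `p` in direction `u`. -/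
noncomputable def DD2 {n : ℕ} (L : (Fin n → ℝ) × (Fin n → ℝ) → ℝ)
    (p u : (Fin n → ℝ) × (Fin n → ℝ)) : (Fin n → ℝ) →L[ℝ] ℝ :=
  fderiv ℝ (fun p' => D2 L p') p u

/-- The two blocks of the second derivative of `L` assemble to the full second derivative, whose
symmetry relates them. -/
theorem DD1_add_DD2_symm {n : ℕ} {L : (Fin n → ℝ) × (Fin n → ℝ) → ℝ} (hL : ContDiff ℝ 2 L)
    (p u w : (Fin n → ℝ) × (Fin n → ℝ)) :
    DD1 L p u w.1 + DD2 L p u w.2 = DD1 L p w u.1 + DD2 L p w u.2 := by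
  have hd : DifferentiableAt ℝ (fderiv ℝ L) p :=
    (hL.fderiv_right (m := 1) (by norm_num)).differentiable (by norm_num) p
  have h1 (a b : (Fin n → ℝ) × (Fin n → ℝ)) :
      DD1 L p a b.1 = fderiv ℝ (fderiv ℝ L) p a (b.1, 0) := by
    have h := hd.hasFDerivAt.clm_comp
      (hasFDerivAt_const (ContinuousLinearMap.inl ℝ (Fin n → ℝ) (Fin n → ℝ)) p)
    simp only [DD1, D1, h.fderiv]
    simp
  have h2 (a b : (Fin n → ℝ) × (Fin n → ℝ)) :
      DD2 L p a b.2 = fderiv ℝ (fderiv ℝ L) p a (0, b.2) := by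
    have h := hd.hasFDerivAt.clm_comp
      (hasFDerivAt_const (ContinuousLinearMap.inr ℝ (Fin n → ℝ) (Fin n → ℝ)) p)
    simp only [DD2, D2, h.fderiv]
    simp
  have hsymm : IsSymmSndFDerivAt ℝ L p := hL.contDiffAt.isSymmSndFDerivAt (by simp)
  simpa [h1, h2, ← map_add] using hsymm.eq u w

theorem statement7 {n : ℕ} (L : (Fin n → ℝ) × (Fin n → ℝ) → ℝ)
    (hL : ContDiff ℝ (⊤ : ℕ∞) L)
    (q δ η : ℤ → Fin n → ℝ)
    -- the discrete Euler–Lagrange equations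
    (hDEL : ∀ k : ℤ, D1 L (q k, q (k - 1)) + D2 L (q (k + 1), q k) = 0)
    -- `δ` and `η` are discrete Jacobi fields (first variations) along `q`
    (hδJ : ∀ k : ℤ, DD1 L (q k, q (k - 1)) (δ k, δ (k - 1))
      + DD2 L (q (k + 1), q k) (δ (k + 1), δ k) = 0)
    (hηJ : ∀ k : ℤ, DD1 L (q k, q (k - 1)) (η k, η (k - 1))
      + DD2 L (q (k + 1), q k) (η (k + 1), η k) = 0) :
    ∀ k l : ℤ,
      DD2 L (q (k + 1), q k) (δ (k + 1), δ k) (η k)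
          - DD2 L (q (k + 1), q k) (η (k + 1), η k) (δ k)
        = DD2 L (q (l + 1), q l) (δ (l + 1), δ l) (η l)
          - DD2 L (q (l + 1), q l) (η (l + 1), η l) (δ l) := by
  have hstep (k : ℤ) :
      DD2 L (q (k + 1), q k) (δ (k + 1), δ k) (η k)
          - DD2 L (q (k + 1), q k) (η (k + 1), η k) (δ k)
        = DD2 L (q (k + 1 + 1), q (k + 1)) (δ (k + 1 + 1), δ (k + 1)) (η (k + 1))
          - DD2 L (q (k + 1 + 1), q (k + 1)) (η (k + 1 + 1), η (k + 1)) (δ (k + 1)) := by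
    have hs := DD1_add_DD2_symm (contDiff_infty.1 hL 2) (q (k + 1), q k)
      (δ (k + 1), δ k) (η (k + 1), η k)
    have hδ := DFunLike.congr_fun (hδJ (k + 1)) (η (k + 1))
    have hη := DFunLike.congr_fun (hηJ (k + 1)) (δ (k + 1))
    simp only [add_sub_cancel_right, add_apply, zero_apply] at hδ hη
    dsimp only at hs
    linarith
  have hper : Function.Periodic (fun k : ℤ =>
      DD2 L (q (k + 1), q k) (δ (k + 1), δ k) (η k)
        - DD2 L (q (k + 1), q k) (η (k + 1), η k) (δ k)) 1 := fun k => (hstep k).symm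
  intro k l
  simpa using (hper.int_mul k 0).trans (hper.int_mul l 0).symm

end Stmt7
end

section
/- Let L : ℝⁿ × ℝⁿ → ℝ be smooth and let ξ : ℝⁿ → ℝⁿ be smooth such that L is infinitesimally invariant: DL(x,y)(ξ(x), ξ(y)) = 0 for all (x,y) ∈ ℝⁿ × ℝⁿ, where DL(x,y) is the full Fréchet derivative of L at (x,y). Then for every sequence (q_k)_{k∈ℤ} satisfying the discrete Euler–Lagrange equations, the discrete momentum J_k := D₁L(q_{k+1}, q_k)( ξ(q_{k+1}) ) is independent of k ∈ ℤ (discrete Noether theorem). -/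
namespace Stmt8

/-- Partial Fréchet derivative of the discrete Lagrangian `L` in its first argument. -/
noncomputable def D1 {n : ℕ} (L : (Fin n → ℝ) × (Fin n → ℝ) → ℝ)
    (p : (Fin n → ℝ) × (Fin n → ℝ)) : (Fin n → ℝ) →L[ℝ] ℝ :=
  (fderiv ℝ L p).comp (ContinuousLinearMap.inl ℝ (Fin n → ℝ) (Fin n → ℝ))

/-- Partial Fréchet derivative of the discrete Lagrangian `L` in its second argument. -/
noncomputable def D2 {n : ℕ} (L : (Fin n → ℝ) × (Fin n → ℝ) → ℝ)
    (p : (Fin n → ℝ) × (Fin n → ℝ)) : (Fin n → ℝ) →L[ℝ] ℝ :=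
  (fderiv ℝ L p).comp (ContinuousLinearMap.inr ℝ (Fin n → ℝ) (Fin n → ℝ))

/-- The full derivative of `L` is the sum of its two partial derivatives. -/
theorem D1_add_D2_apply {n : ℕ} (L : (Fin n → ℝ) × (Fin n → ℝ) → ℝ)
    (p : (Fin n → ℝ) × (Fin n → ℝ)) (u v : Fin n → ℝ) :
    D1 L p u + D2 L p v = fderiv ℝ L p (u, v) := by
  simp [D1, D2, ← map_add]

theorem statement8 {n : ℕ} (L : (Fin n → ℝ) × (Fin n → ℝ) → ℝ)
    (hL : ContDiff ℝ (⊤ : ℕ∞) L)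
    (ξ : (Fin n → ℝ) → Fin n → ℝ) (hξ : ContDiff ℝ (⊤ : ℕ∞) ξ)
    -- infinitesimal invariance of `L`
    (hinv : ∀ x y : Fin n → ℝ, fderiv ℝ L (x, y) (ξ x, ξ y) = 0)
    (q : ℤ → Fin n → ℝ)
    -- the discrete Euler–Lagrange equations
    (hDEL : ∀ k : ℤ, D1 L (q k, q (k - 1)) + D2 L (q (k + 1), q k) = 0) :
    ∀ k l : ℤ,
      D1 L (q (k + 1), q k) (ξ (q (k + 1))) = D1 L (q (l + 1), q l) (ξ (q (l + 1))) := by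
  have step (k : ℤ) : D1 L (q (k + 1), q k) (ξ (q (k + 1))) =
      D1 L (q (k - 1 + 1), q (k - 1)) (ξ (q (k - 1 + 1))) := by
    have h_inv := (D1_add_D2_apply L (q (k + 1), q k) _ _).trans (hinv (q (k + 1)) (q k))
    have h_del := DFunLike.congr_fun (hDEL k) (ξ (q k))
    simp only [add_apply, zero_apply] at h_del
    rw [sub_add_cancel]
    linarith
  have const (k : ℤ) : D1 L (q (k + 1), q k) (ξ (q (k + 1))) =
      D1 L (q (0 + 1), q 0) (ξ (q (0 + 1))) := by
    induction k using Int.induction_on with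
    | zero => rfl
    | succ i ih => rw [step, add_sub_cancel_right, ih]
    | pred i ih => rw [← step, ih]
  intro k l
  rw [const k, const l]

end Stmt8
end

section
/- Let L : ℝ × ℝ × ℝ → ℝ, (y,v₀,v₁) ↦ L(y,v₀,v₁), be smooth, let φ : ℝ × ℝ² → ℝ, (ε,x) ↦ φ_ε(x), be smooth, and let a₀ < b₀, a₁ < b₁. Set φ₀ = φ_{ε=0}, δφ(x) = ∂φ/∂ε(0,x), and j¹φ₀(x) = (φ₀(x), ∂₀φ₀(x), ∂₁φ₀(x)). Then d/dε|_{ε=0} ∫_{a₀}^{b₀} ∫_{a₁}^{b₁} L(φ_ε, ∂₀φ_ε, ∂₁φ_ε)(x) dx¹ dx⁰ = ∫_{a₀}^{b₀} ∫_{a₁}^{b₁} [ D_yL(j¹φ₀) − ∂₀( D_{v₀}L(j¹φ₀) ) − ∂₁( D_{v₁}L(j¹φ₀) ) ] δφ dx¹ dx⁰ + ∫_{a₁}^{b₁} ( [D_{v₀}L(j¹φ₀) δφ](b₀,x¹) − [D_{v₀}L(j¹φ₀) δφ](a₀,x¹) ) dx¹ + ∫_{a₀}^{b₀} ( [D_{v₁}L(j¹φ₀)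 δφ](x⁰,b₁) − [D_{v₁}L(j¹φ₀) δφ](x⁰,a₁) ) dx⁰. -/
open intervalIntegral

namespace Stmt9

/-- Partial derivative in the first coordinate `x⁰` of a scalar field on `ℝ²`. -/
noncomputable def pd0 (ψ : ℝ × ℝ → ℝ) (x : ℝ × ℝ) : ℝ := fderiv ℝ ψ x (1, 0)

/-- Partial derivative in the second coordinate `x¹` of a scalar field on `ℝ²`. -/
noncomputable def pd1 (ψ : ℝ × ℝ → ℝ) (x : ℝ × ℝ) : ℝ := fderiv ℝ ψ x (0, 1)

/-- The first jet `j¹ψ(x) = (ψ(x), ∂₀ψ(x), ∂₁ψ(x))`. -/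
noncomputable def jet1 (ψ : ℝ × ℝ → ℝ) (x : ℝ × ℝ) : ℝ × ℝ × ℝ := (ψ x, pd0 ψ x, pd1 ψ x)

/-- `D_yL`. -/
noncomputable def DyL (L : ℝ × ℝ × ℝ → ℝ) (p : ℝ × ℝ × ℝ) : ℝ := fderiv ℝ L p (1, 0, 0)

/-- `D_{v₀}L`. -/
noncomputable def Dv0L (L : ℝ × ℝ × ℝ → ℝ) (p : ℝ × ℝ × ℝ) : ℝ := fderiv ℝ L p (0, 1, 0)

/-- `D_{v₁}L`. -/
noncomputable def Dv1L (L : ℝ × ℝ × ℝ → ℝ) (p : ℝ × ℝ × ℝ) : ℝ := fderiv ℝ L p (0, 0, 1)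

theorem hasDerivAt_intervalIntegral_of_continuous {F F' : ℝ → ℝ → ℝ}
    (hF : Continuous (Function.uncurry F)) (hF' : Continuous (Function.uncurry F'))
    (hd : ∀ ε t, HasDerivAt (fun ε => F ε t) (F' ε t) ε) (a b ε₀ : ℝ) :
    HasDerivAt (fun ε => ∫ t in a..b, F ε t) (∫ t in a..b, F' ε₀ t) ε₀ := by
  obtain ⟨C, hC⟩ := ((isCompact_Icc (a := ε₀ - 1) (b := ε₀ + 1)).prod
    (isCompact_uIcc (a := a) (b := b))).exists_bound_of_continuousOn hF'.continuousOn
  have hFc (ε : ℝ) : Continuous (F ε) := hF.comp (Continuous.prodMk_right ε)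
  have hFc' (ε : ℝ) : Continuous (F' ε) := hF'.comp (Continuous.prodMk_right ε)
  refine (intervalIntegral.hasDerivAt_integral_of_dominated_loc_of_deriv_le
    (s := Set.Icc (ε₀ - 1) (ε₀ + 1)) (bound := fun _ => C)
    (Icc_mem_nhds (by linarith) (by linarith))
    (Filter.Eventually.of_forall fun ε => (hFc ε).aestronglyMeasurable)
    ((hFc ε₀).intervalIntegrable a b) (hFc' ε₀).aestronglyMeasurable ?_
    intervalIntegrable_const (Filter.Eventually.of_forall fun t _ ε _ => hd ε t)).2
  exact Filter.Eventually.of_forall fun t ht ε hε =>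
    hC (ε, t) ⟨hε, Set.uIoc_subset_uIcc ht⟩

theorem hasDerivAt_intervalIntegral₂_of_contDiff {G : ℝ × (ℝ × ℝ) → ℝ} (hG : ContDiff ℝ 1 G)
    (a₀ b₀ a₁ b₁ ε₀ : ℝ) :
    HasDerivAt (fun ε => ∫ x0 in a₀..b₀, ∫ x1 in a₁..b₁, G (ε, (x0, x1)))
      (∫ x0 in a₀..b₀, ∫ x1 in a₁..b₁, fderiv ℝ G (ε₀, (x0, x1)) (1, 0)) ε₀ := by
  have hGc : Continuous G := hG.continuous
  have hG' : Continuous fun p => fderiv ℝ G p (1, 0) :=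
    (hG.continuous_fderiv one_ne_zero).clm_apply continuous_const
  refine hasDerivAt_intervalIntegral_of_continuous
    (F := fun ε x0 => ∫ x1 in a₁..b₁, G (ε, (x0, x1)))
    (F' := fun ε x0 => ∫ x1 in a₁..b₁, fderiv ℝ G (ε, (x0, x1)) (1, 0)) ?_ ?_ ?_ a₀ b₀ ε₀
  · exact continuous_parametric_intervalIntegral_of_continuous'
      (f := fun (p : ℝ × ℝ) x1 => G (p.1, (p.2, x1))) (by fun_prop) a₁ b₁
  · exact continuous_parametric_intervalIntegral_of_continuous'
      (f := fun (p : ℝ × ℝ) x1 => fderiv ℝ G (p.1, (p.2, x1)) (1, 0))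
      (hG'.comp (by fun_prop : Continuous fun q : (ℝ × ℝ) × ℝ => (q.1.1, (q.1.2, q.2)))) a₁ b₁
  · intro ε x0
    refine hasDerivAt_intervalIntegral_of_continuous
      (F := fun ε x1 => G (ε, (x0, x1)))
      (F' := fun ε x1 => fderiv ℝ G (ε, (x0, x1)) (1, 0)) ?_ ?_ ?_ a₁ b₁ ε
    · exact hGc.comp (by fun_prop : Continuous fun q : ℝ × ℝ => (q.1, (x0, q.2)))
    · exact hG'.comp (by fun_prop : Continuous fun q : ℝ × ℝ => (q.1, (x0, q.2)))
    · intro ε x1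
      exact ((hG.differentiable one_ne_zero) _).hasFDerivAt.comp_hasDerivAt ε
        ((hasDerivAt_id ε).prodMk (hasDerivAt_const ε (x0, x1)))

theorem hasFDerivAt_slice {f : ℝ × (ℝ × ℝ) → ℝ} (hf : Differentiable ℝ f) (ε : ℝ) (x : ℝ × ℝ) :
    HasFDerivAt (fun x => f (ε, x))
      ((fderiv ℝ f (ε, x)).comp (ContinuousLinearMap.inr ℝ ℝ (ℝ × ℝ))) x :=
  (hf (ε, x)).hasFDerivAt.comp x (hasFDerivAt_prodMk_right ε x)

theorem jet1_slice {φ : ℝ × (ℝ × ℝ) → ℝ} (hφ : Differentiable ℝ φ) (ε : ℝ) (x : ℝ × ℝ) :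
    jet1 (fun x => φ (ε, x)) x =
      (φ (ε, x), fderiv ℝ φ (ε, x) (0, (1, 0)), fderiv ℝ φ (ε, x) (0, (0, 1))) := by
  simp [jet1, pd0, pd1, (hasFDerivAt_slice hφ ε x).fderiv]

theorem fderiv_apply_eq_partials (L : ℝ × ℝ × ℝ → ℝ) (p : ℝ × ℝ × ℝ) (u v w : ℝ) :
    fderiv ℝ L p (u, v, w) = DyL L p * u + Dv0L L p * v + Dv1L L p * w := by
  have h : ((u, v, w) : ℝ × ℝ × ℝ) =
      u • ((1, 0, 0) : ℝ × ℝ × ℝ) + v • ((0, 1, 0) : ℝ × ℝ × ℝ) + w • ((0, 0, 1) : ℝ × ℝ × ℝ) := by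
    simp
  rw [h, map_add, map_add, map_smul, map_smul, map_smul]
  simp only [DyL, Dv0L, Dv1L, smul_eq_mul]
  ring

theorem fderiv_fderiv_apply {φ : ℝ × (ℝ × ℝ) → ℝ} (hφ : ContDiff ℝ (⊤ : ℕ∞) φ)
    (p v w : ℝ × (ℝ × ℝ)) :
    fderiv ℝ (fun q => fderiv ℝ φ q v) p w = fderiv ℝ (fderiv ℝ φ) p w v := by
  have h : Differentiable ℝ (fderiv ℝ φ) :=
    (hφ.fderiv_right (m := 1) (by norm_cast)).differentiable one_ne_zero
  simp [fderiv_clm_apply (h p) (differentiableAt_const v)]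

theorem fderiv_fderiv_apply_comm {φ : ℝ × (ℝ × ℝ) → ℝ} (hφ : ContDiff ℝ (⊤ : ℕ∞) φ)
    (p v w : ℝ × (ℝ × ℝ)) :
    fderiv ℝ (fun q => fderiv ℝ φ q v) p w = fderiv ℝ (fun q => fderiv ℝ φ q w) p v := by
  rw [fderiv_fderiv_apply hφ, fderiv_fderiv_apply hφ]
  exact hφ.contDiffAt.isSymmSndFDerivAt (by simp; norm_cast) w v

theorem contDiff_fderiv_apply_const {E : Type*} [NormedAddCommGroup E] [NormedSpace ℝ E]
    {f : E → ℝ} (hf : ContDiff ℝ (⊤ : ℕ∞) f) (v : E) :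
    ContDiff ℝ (⊤ : ℕ∞) fun p => fderiv ℝ f p v :=
  (hf.fderiv_right (by norm_cast)).clm_apply contDiff_const

theorem contDiff_jet1 {ψ : ℝ × ℝ → ℝ} (hψ : ContDiff ℝ (⊤ : ℕ∞) ψ) :
    ContDiff ℝ (⊤ : ℕ∞) (jet1 ψ) :=
  hψ.prodMk ((contDiff_fderiv_apply_const hψ _).prodMk (contDiff_fderiv_apply_const hψ _))

/-- First variation of the Lagrangian density, before integration by parts. -/
theorem fderiv_lagrangian_jet_apply {L : ℝ × ℝ × ℝ → ℝ} (hL : ContDiff ℝ (⊤ : ℕ∞) L)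
    {φ : ℝ × (ℝ × ℝ) → ℝ} (hφ : ContDiff ℝ (⊤ : ℕ∞) φ) (ε : ℝ) (x : ℝ × ℝ) :
    fderiv ℝ (fun p : ℝ × (ℝ × ℝ) => L (jet1 (fun x => φ (p.1, x)) p.2)) (ε, x) (1, 0) =
      DyL L (jet1 (fun x => φ (ε, x)) x) * fderiv ℝ φ (ε, x) (1, 0)
        + Dv0L L (jet1 (fun x => φ (ε, x)) x) * pd0 (fun x => fderiv ℝ φ (ε, x) (1, 0)) x
        + Dv1L L (jet1 (fun x => φ (ε, x)) x) * pd1 (fun x => fderiv ℝ φ (ε, x) (1, 0)) x := by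
  have hne : ((⊤ : ℕ∞) : WithTop ℕ∞) ≠ 0 := by simp
  have hd : Differentiable ℝ φ := hφ.differentiable hne
  have hdv (v) : Differentiable ℝ fun q => fderiv ℝ φ q v :=
    (contDiff_fderiv_apply_const hφ v).differentiable hne
  simp only [jet1_slice hd]
  have hJ := (hd (ε, x)).hasFDerivAt.prodMk
    ((hdv (0, (1, 0)) (ε, x)).hasFDerivAt.prodMk (hdv (0, (0, 1)) (ε, x)).hasFDerivAt)
  have hLJ := ((hL.differentiable hne) _).hasFDerivAt.comp (ε, x) hJ
  have := hLJ.fderiv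
  simp only [Function.comp_def] at this
  rw [this]
  simp only [ContinuousLinearMap.comp_apply, ContinuousLinearMap.prod_apply,
    fderiv_apply_eq_partials L]
  simp only [pd0, pd1, (hasFDerivAt_slice (hdv (1, 0)) ε x).fderiv,
    ContinuousLinearMap.comp_apply, ContinuousLinearMap.inr_apply]
  rw [fderiv_fderiv_apply_comm hφ _ (0, (1, 0)), fderiv_fderiv_apply_comm hφ _ (0, (0, 1))]

theorem contDiff_lagrangian_jet {L : ℝ × ℝ × ℝ → ℝ} (hL : ContDiff ℝ (⊤ : ℕ∞) L)
    {φ : ℝ × (ℝ × ℝ) → ℝ} (hφ : ContDiff ℝ (⊤ : ℕ∞) φ) :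
    ContDiff ℝ (⊤ : ℕ∞)
      (fun p : ℝ × (ℝ × ℝ) => L (jet1 (fun x => φ (p.1, x)) p.2)) := by
  simp only [jet1_slice (hφ.differentiable (by simp))]
  exact hL.comp (hφ.prodMk ((contDiff_fderiv_apply_const hφ _).prodMk
    (contDiff_fderiv_apply_const hφ _)))

theorem intervalIntegral₂_add {f g : ℝ × ℝ → ℝ} (hf : Continuous f) (hg : Continuous g)
    (a₀ b₀ a₁ b₁ : ℝ) :
    (∫ x0 in a₀..b₀, ∫ x1 in a₁..b₁, (f (x0, x1) + g (x0, x1))) =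
      (∫ x0 in a₀..b₀, ∫ x1 in a₁..b₁, f (x0, x1))
        + ∫ x0 in a₀..b₀, ∫ x1 in a₁..b₁, g (x0, x1) := by
  have hc {h : ℝ × ℝ → ℝ} (hh : Continuous h) :
      Continuous fun x0 => ∫ x1 in a₁..b₁, h (x0, x1) :=
    continuous_parametric_intervalIntegral_of_continuous'
      (f := fun x0 x1 => h (x0, x1)) hh a₁ b₁
  rw [← integral_add ((hc hf).intervalIntegrable _ _) ((hc hg).intervalIntegrable _ _)]
  congr 1 with x0
  exact integral_add ((hf.comp (Continuous.prodMk_right x0)).intervalIntegrable _ _)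
    ((hg.comp (Continuous.prodMk_right x0)).intervalIntegrable _ _)

theorem integral_pd0_add_pd1 {f g : ℝ × ℝ → ℝ} (hf : ContDiff ℝ 1 f) (hg : ContDiff ℝ 1 g)
    (a₀ b₀ a₁ b₁ : ℝ) :
    (∫ x0 in a₀..b₀, ∫ x1 in a₁..b₁, (pd0 f (x0, x1) + pd1 g (x0, x1))) =
      (∫ x1 in a₁..b₁, (f (b₀, x1) - f (a₀, x1)))
        + ∫ x0 in a₀..b₀, (g (x0, b₁) - g (x0, a₁)) := by
  have hfc := hf.continuous
  have hgc := hg.continuous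
  have key := MeasureTheory.integral2_divergence_prod_of_hasFDerivAt f g (fderiv ℝ f) (fderiv ℝ g)
    a₀ a₁ b₀ b₁ hfc.continuousOn hgc.continuousOn
    (fun x _ => (hf.differentiable one_ne_zero x).hasFDerivAt)
    (fun x _ => (hg.differentiable one_ne_zero x).hasFDerivAt)
    ((((hf.continuous_fderiv one_ne_zero).clm_apply continuous_const).add
      ((hg.continuous_fderiv one_ne_zero).clm_apply continuous_const)).continuousOn.integrableOn_compact
        (isCompact_uIcc.prod isCompact_uIcc))
  have hint {h : ℝ → ℝ} (hh : Continuous h) (a b : ℝ) :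
      IntervalIntegrable h MeasureTheory.volume a b := hh.intervalIntegrable a b
  rw [integral_sub (hint (by fun_prop) _ _) (hint (by fun_prop) _ _),
    integral_sub (hint (by fun_prop) _ _) (hint (by fun_prop) _ _)]
  simp only [pd0, pd1]
  rw [key]
  ring

theorem pd0_mul {f g : ℝ × ℝ → ℝ} (hf : Differentiable ℝ f) (hg : Differentiable ℝ g)
    (x : ℝ × ℝ) : pd0 (fun x => f x * g x) x = f x * pd0 g x + pd0 f x * g x := by
  simp only [pd0, fderiv_fun_mul (hf x) (hg x), add_apply, smul_apply, smul_eq_mul]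
  ring

theorem pd1_mul {f g : ℝ × ℝ → ℝ} (hf : Differentiable ℝ f) (hg : Differentiable ℝ g)
    (x : ℝ × ℝ) : pd1 (fun x => f x * g x) x = f x * pd1 g x + pd1 f x * g x := by
  simp only [pd1, fderiv_fun_mul (hf x) (hg x), add_apply, smul_apply, smul_eq_mul]
  ring

theorem statement9 (L : ℝ × ℝ × ℝ → ℝ) (hL : ContDiff ℝ (⊤ : ℕ∞) L)
    (φ : ℝ × (ℝ × ℝ) → ℝ) (hφ : ContDiff ℝ (⊤ : ℕ∞) φ)
    (a₀ b₀ a₁ b₁ : ℝ) (h₀ : a₀ < b₀) (h₁ : a₁ < b₁)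
    (φ₀ : ℝ × ℝ → ℝ) (hφ₀ : ∀ x, φ₀ x = φ (0, x))
    (δφ : ℝ × ℝ → ℝ) (hδφ : ∀ x, δφ x = deriv (fun ε => φ (ε, x)) 0) :
    HasDerivAt
      (fun ε : ℝ => ∫ x0 in a₀..b₀, ∫ x1 in a₁..b₁,
        L (jet1 (fun x => φ (ε, x)) (x0, x1)))
      ((∫ x0 in a₀..b₀, ∫ x1 in a₁..b₁,
          (DyL L (jet1 φ₀ (x0, x1))
              - pd0 (fun x => Dv0L L (jet1 φ₀ x)) (x0, x1)
              - pd1 (fun x => Dv1L L (jet1 φ₀ x)) (x0, x1)) * δφ (x0, x1))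
        + (∫ x1 in a₁..b₁,
            (Dv0L L (jet1 φ₀ (b₀, x1)) * δφ (b₀, x1)
              - Dv0L L (jet1 φ₀ (a₀, x1)) * δφ (a₀, x1)))
        + (∫ x0 in a₀..b₀,
            (Dv1L L (jet1 φ₀ (x0, b₁)) * δφ (x0, b₁)
              - Dv1L L (jet1 φ₀ (x0, a₁)) * δφ (x0, a₁)))) 0 := by
  have hne : ((⊤ : ℕ∞) : WithTop ℕ∞) ≠ 0 := by simp
  have hone : (1 : WithTop ℕ∞) ≤ ((⊤ : ℕ∞) : WithTop ℕ∞) := by norm_cast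
  have hδ : δφ = fun x => fderiv ℝ φ (0, x) (1, 0) := by
    funext x
    rw [hδφ x]
    exact ((hφ.differentiable hne (0, x)).hasFDerivAt.comp_hasDerivAt (0 : ℝ)
      ((hasDerivAt_id (0 : ℝ)).prodMk (hasDerivAt_const (0 : ℝ) x))).deriv
  have hφ₀' : φ₀ = fun x => φ (0, x) := funext hφ₀
  have hδs : ContDiff ℝ (⊤ : ℕ∞) δφ := by
    rw [hδ]
    exact (contDiff_fderiv_apply_const hφ (1, 0)).comp (contDiff_prodMk_right 0)
  have hjet : ContDiff ℝ (⊤ : ℕ∞) (jet1 φ₀) := by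
    rw [hφ₀']
    exact contDiff_jet1 (hφ.comp (contDiff_prodMk_right 0))
  have hy : ContDiff ℝ (⊤ : ℕ∞) fun x => DyL L (jet1 φ₀ x) :=
    (contDiff_fderiv_apply_const hL _).comp hjet
  have hv0 : ContDiff ℝ (⊤ : ℕ∞) fun x => Dv0L L (jet1 φ₀ x) :=
    (contDiff_fderiv_apply_const hL _).comp hjet
  have hv1 : ContDiff ℝ (⊤ : ℕ∞) fun x => Dv1L L (jet1 φ₀ x) :=
    (contDiff_fderiv_apply_const hL _).comp hjet
  have hf := hv0.mul hδs
  have hg := hv1.mul hδs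
  have key := hasDerivAt_intervalIntegral₂_of_contDiff
    ((contDiff_lagrangian_jet hL hφ).of_le hone) a₀ b₀ a₁ b₁ 0
  simp only [fderiv_lagrangian_jet_apply hL hφ] at key
  rw [← hφ₀', ← hδ] at key
  convert key using 1
  rw [add_assoc, ← integral_pd0_add_pd1 (hf.of_le hone) (hg.of_le hone), ← intervalIntegral₂_add
    (f := fun x => (DyL L (jet1 φ₀ x) - pd0 (fun x => Dv0L L (jet1 φ₀ x)) x
      - pd1 (fun x => Dv1L L (jet1 φ₀ x)) x) * δφ x)
    (g := fun x => pd0 (fun x => Dv0L L (jet1 φ₀ x) * δφ x) x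
      + pd1 (fun x => Dv1L L (jet1 φ₀ x) * δφ x) x)
    (((hy.sub (contDiff_fderiv_apply_const hv0 _)).sub
      (contDiff_fderiv_apply_const hv1 _)).mul hδs).continuous
    ((contDiff_fderiv_apply_const hf _).add (contDiff_fderiv_apply_const hg _)).continuous]
  congr 1 with x0
  congr 1 with x1
  rw [pd0_mul (hv0.differentiable hne) (hδs.differentiable hne),
    pd1_mul (hv1.differentiable hne) (hδs.differentiable hne), hδ]
  ring

end Stmt9
end

section
/- Let n ≥ 0 and N ≥ 1, let L : ℝᴺ × (ℝᴺ)^{n+1} → ℝ be smooth, let φ : ℝ^{n+1} → ℝᴺ be a smooth solution of the Euler–Lagrange field equations for L, and let V, W : ℝ^{n+1} → ℝᴺ be smooth solutions of the first-variation (linearized Euler–Lagrange) equations along φ. Then the multisymplectic form formula holds in divergence form: Σ_{μ=0}^{n} ∂_μ [ x ↦ δ_W p^μ(x)(V(x)) − δ_V p^μ(x)(W(x)) ] = 0 identically on ℝ^{n+1}. -/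
open scoped BigOperators

namespace Stmt10

/-- The inclusion `ℝᴺ →L (Fin (n+1) → ℝᴺ)` into the `μ`-th slot. -/
noncomputable def sing (n N : ℕ) (μ : Fin (n + 1)) :
    (Fin N → ℝ) →L[ℝ] (Fin (n + 1) → Fin N → ℝ) :=
  ContinuousLinearMap.pi fun ν =>
    if ν = μ then ContinuousLinearMap.id ℝ (Fin N → ℝ) else 0

/-- `D_yL(p)`: partial Fréchet derivative of `L` in the `y` argument. -/
noncomputable def DyF {n N : ℕ}
    (L : (Fin N → ℝ) × (Fin (n + 1) → Fin N → ℝ) → ℝ)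
    (p : (Fin N → ℝ) × (Fin (n + 1) → Fin N → ℝ)) : (Fin N → ℝ) →L[ℝ] ℝ :=
  (fderiv ℝ L p).comp (ContinuousLinearMap.inl ℝ (Fin N → ℝ) (Fin (n + 1) → Fin N → ℝ))

/-- `D_{v_μ}L(p)`: partial Fréchet derivative of `L` in the `v_μ` argument. -/
noncomputable def DvF {n N : ℕ}
    (L : (Fin N → ℝ) × (Fin (n + 1) → Fin N → ℝ) → ℝ) (μ : Fin (n + 1))
    (p : (Fin N → ℝ) × (Fin (n + 1) → Fin N → ℝ)) : (Fin N → ℝ) →L[ℝ] ℝ :=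
  (fderiv ℝ L p).comp
    ((ContinuousLinearMap.inr ℝ (Fin N → ℝ) (Fin (n + 1) → Fin N → ℝ)).comp (sing n N μ))

/-- The first jet `j¹φ(x) = (φ(x), ∂₀φ(x), …, ∂ₙφ(x))`. -/
noncomputable def jet {n N : ℕ} (φ : (Fin (n + 1) → ℝ) → Fin N → ℝ)
    (x : Fin (n + 1) → ℝ) : (Fin N → ℝ) × (Fin (n + 1) → Fin N → ℝ) :=
  (φ x, fun μ => fderiv ℝ φ x (Pi.single μ 1))

/-- `φ` satisfies the Euler–Lagrange field equations for `L`. -/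
def IsELSolution {n N : ℕ} (L : (Fin N → ℝ) × (Fin (n + 1) → Fin N → ℝ) → ℝ)
    (φ : (Fin (n + 1) → ℝ) → Fin N → ℝ) : Prop :=
  ∀ x : Fin (n + 1) → ℝ,
    DyF L (jet φ x)
      = ∑ μ : Fin (n + 1), fderiv ℝ (fun x' => DvF L μ (jet φ x')) x (Pi.single μ 1)

/-- `δ_V p^μ(x) = D(D_{v_μ}L)(j¹φ(x))(j¹V(x))`, a linear functional on `ℝᴺ`. -/
noncomputable def dvarp {n N : ℕ} (L : (Fin N → ℝ) × (Fin (n + 1) → Fin N → ℝ) → ℝ)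
    (φ V : (Fin (n + 1) → ℝ) → Fin N → ℝ) (μ : Fin (n + 1)) (x : Fin (n + 1) → ℝ) :
    (Fin N → ℝ) →L[ℝ] ℝ :=
  fderiv ℝ (fun p => DvF L μ p) (jet φ x) (jet V x)

/-- `V` satisfies the first-variation (linearized Euler–Lagrange) equations along `φ`. -/
def IsFirstVariation {n N : ℕ} (L : (Fin N → ℝ) × (Fin (n + 1) → Fin N → ℝ) → ℝ)
    (φ V : (Fin (n + 1) → ℝ) → Fin N → ℝ) : Prop :=
  ∀ x : Fin (n + 1) → ℝ,
    fderiv ℝ (fun p => DyF L p) (jet φ x) (jet V x)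
      = ∑ μ : Fin (n + 1), fderiv ℝ (fun x' => dvarp L φ V μ x') x (Pi.single μ 1)

theorem sum_inr_sing {n N : ℕ} (v : Fin (n + 1) → Fin N → ℝ) :
    ∑ μ, ContinuousLinearMap.inr ℝ (Fin N → ℝ) (Fin (n + 1) → Fin N → ℝ) (sing n N μ (v μ))
      = (0, v) := by
  rw [← map_sum]
  have h : ∑ μ, sing n N μ (v μ) = v := by
    funext ν
    have (μ : Fin (n + 1)) : sing n N μ (v μ) ν = if ν = μ then v μ else 0 := by
      by_cases hν : ν = μ <;> simp [sing, hν]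
    simp [Finset.sum_apply, this]
  rw [h, ContinuousLinearMap.inr_apply]

theorem contDiff_jet {n N : ℕ} {φ : (Fin (n + 1) → ℝ) → Fin N → ℝ}
    (hφ : ContDiff ℝ (⊤ : ℕ∞) φ) : ContDiff ℝ (⊤ : ℕ∞) (jet φ) :=
  hφ.prodMk <| contDiff_pi.2 fun _ =>
    (hφ.fderiv_right (by simp)).clm_apply contDiff_const

theorem fderiv_fderiv_comp_apply {E F : Type*} [NormedAddCommGroup E] [NormedSpace ℝ E]
    [NormedAddCommGroup F] [NormedSpace ℝ F] {L : E → ℝ} (hL : ContDiff ℝ (⊤ : ℕ∞) L)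
    (A : F →L[ℝ] E) (p q : E) (u : F) :
    fderiv ℝ (fun p => (fderiv ℝ L p).comp A) p q u = fderiv ℝ (fderiv ℝ L) p q (A u) := by
  have hd : DifferentiableAt ℝ (fderiv ℝ L) p :=
    ((hL.fderiv_right (m := (⊤ : ℕ∞)) (by simp)).differentiable (by simp)) p
  rw [fderiv_clm_comp hd (differentiableAt_const A)]
  simp

theorem contDiff_dvarp {n N : ℕ} {L : (Fin N → ℝ) × (Fin (n + 1) → Fin N → ℝ) → ℝ}
    (hL : ContDiff ℝ (⊤ : ℕ∞) L) {φ V : (Fin (n + 1) → ℝ) → Fin N → ℝ}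
    (hφ : ContDiff ℝ (⊤ : ℕ∞) φ) (hV : ContDiff ℝ (⊤ : ℕ∞) V) (μ : Fin (n + 1)) :
    ContDiff ℝ (⊤ : ℕ∞) (dvarp L φ V μ) := by
  have h : ContDiff ℝ (⊤ : ℕ∞) (DvF L μ) :=
    (hL.fderiv_right (by simp)).clm_comp contDiff_const
  exact ((h.fderiv_right (m := (⊤ : ℕ∞)) (by simp)).comp (contDiff_jet hφ)).clm_apply
    (contDiff_jet hV)

theorem differentiable_dvarp_apply {n N : ℕ}
    {L : (Fin N → ℝ) × (Fin (n + 1) → Fin N → ℝ) → ℝ}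
    (hL : ContDiff ℝ (⊤ : ℕ∞) L) {φ V W : (Fin (n + 1) → ℝ) → Fin N → ℝ}
    (hφ : ContDiff ℝ (⊤ : ℕ∞) φ) (hV : ContDiff ℝ (⊤ : ℕ∞) V) (hW : ContDiff ℝ (⊤ : ℕ∞) W)
    (μ : Fin (n + 1)) : Differentiable ℝ fun x => dvarp L φ W μ x (V x) :=
  ((contDiff_dvarp hL hφ hW μ).clm_apply hV).differentiable (by simp)

/-- If `W` solves the first-variation equations, the divergence of `δ_W p(V)` is the Hessian
of `L` evaluated on the jets of `W` and `V`. -/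
theorem sum_fderiv_dvarp_apply {n N : ℕ} {L : (Fin N → ℝ) × (Fin (n + 1) → Fin N → ℝ) → ℝ}
    (hL : ContDiff ℝ (⊤ : ℕ∞) L) {φ V W : (Fin (n + 1) → ℝ) → Fin N → ℝ}
    (hφ : ContDiff ℝ (⊤ : ℕ∞) φ) (hV : ContDiff ℝ (⊤ : ℕ∞) V) (hW : ContDiff ℝ (⊤ : ℕ∞) W)
    (hWfv : IsFirstVariation L φ W) (x : Fin (n + 1) → ℝ) :
    ∑ μ, fderiv ℝ (fun x' => dvarp L φ W μ x' (V x')) x (Pi.single μ 1)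
      = fderiv ℝ (fderiv ℝ L) (jet φ x) (jet W x) (jet V x) := by
  have hprod (μ : Fin (n + 1)) :
      fderiv ℝ (fun x' => dvarp L φ W μ x' (V x')) x (Pi.single μ 1)
        = fderiv ℝ (fun x' => dvarp L φ W μ x') x (Pi.single μ 1) (V x)
          + dvarp L φ W μ x (fderiv ℝ V x (Pi.single μ 1)) := by
    rw [fderiv_clm_apply ((contDiff_dvarp hL hφ hW μ).differentiable (by simp) x)
      (hV.differentiable (by simp) x)]
    simp [add_comm]
  have hslot (μ : Fin (n + 1)) (u : Fin N → ℝ) :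
      dvarp L φ W μ x u = fderiv ℝ (fderiv ℝ L) (jet φ x) (jet W x)
        (ContinuousLinearMap.inr ℝ (Fin N → ℝ) (Fin (n + 1) → Fin N → ℝ) (sing n N μ u)) :=
    fderiv_fderiv_comp_apply hL _ _ _ _
  have hbase : fderiv ℝ (fun p => DyF L p) (jet φ x) (jet W x) (V x)
      = fderiv ℝ (fderiv ℝ L) (jet φ x) (jet W x) (V x, 0) :=
    fderiv_fderiv_comp_apply hL _ _ _ _
  simp_rw [hprod, Finset.sum_add_distrib, hslot]
  rw [← map_sum, sum_inr_sing fun μ => fderiv ℝ V x (Pi.single μ 1),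
    ← sum_apply, ← hWfv x, hbase, ← map_add]
  simp [jet]

theorem statement10 (n N : ℕ) (hN : 1 ≤ N)
    (L : (Fin N → ℝ) × (Fin (n + 1) → Fin N → ℝ) → ℝ) (hL : ContDiff ℝ (⊤ : ℕ∞) L)
    (φ : (Fin (n + 1) → ℝ) → Fin N → ℝ) (hφ : ContDiff ℝ (⊤ : ℕ∞) φ)
    (hφEL : IsELSolution L φ)
    (V W : (Fin (n + 1) → ℝ) → Fin N → ℝ)
    (hV : ContDiff ℝ (⊤ : ℕ∞) V) (hW : ContDiff ℝ (⊤ : ℕ∞) W)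
    (hVfv : IsFirstVariation L φ V) (hWfv : IsFirstVariation L φ W) :
    ∀ x : Fin (n + 1) → ℝ,
      ∑ μ : Fin (n + 1),
        fderiv ℝ (fun x' => dvarp L φ W μ x' (V x') - dvarp L φ V μ x' (W x'))
          x (Pi.single μ 1) = 0 := by
  intro x
  have hsymm : IsSymmSndFDerivAt ℝ L (jet φ x) :=
    (contDiff_infty.1 hL 2).contDiffAt.isSymmSndFDerivAt
      (by simp)
  have hsub (μ : Fin (n + 1)) :
      fderiv ℝ (fun x' => dvarp L φ W μ x' (V x') - dvarp L φ V μ x' (W x')) x (Pi.single μ 1)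
        = fderiv ℝ (fun x' => dvarp L φ W μ x' (V x')) x (Pi.single μ 1)
          - fderiv ℝ (fun x' => dvarp L φ V μ x' (W x')) x (Pi.single μ 1) := by
    rw [fderiv_fun_sub (differentiable_dvarp_apply hL hφ hV hW μ x)
      (differentiable_dvarp_apply hL hφ hW hV μ x)]
    rfl
  simp_rw [hsub, Finset.sum_sub_distrib]
  rw [sum_fderiv_dvarp_apply hL hφ hV hW hWfv, sum_fderiv_dvarp_apply hL hφ hW hV hVfv,
    hsymm.eq, sub_self]

end Stmt10
end

section
/- Let n ≥ 0 and N ≥ 1, let L : ℝᴺ × (ℝᴺ)^{n+1} → ℝ be smooth, and let ξ : ℝᴺ → ℝᴺ be a smooth infinitesimal vertical symmetry of L, i.e. for all (y, v₀, …, vₙ): D_yL(y,v)(ξ(y)) + Σ_{μ=0}^{n} D_{v_μ}L(y,v)( Dξ(y)(v_μ) ) = 0, where Dξ(y) is the Fréchet derivative of ξ at y. Then for every smooth solution φ : ℝ^{n+1} → ℝᴺ of the Euler–Lagrange field equations for L, the Noether current is divergence-free: Σ_{μ=0}^{n} ∂_μ [ x ↦ D_{v_μ}L(j¹φ(x))(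 ξ(φ(x)) ) ] = 0 identically on ℝ^{n+1} (covariant Noether theorem). -/
open scoped BigOperators

namespace Stmt12

/-- The inclusion `ℝᴺ →L (Fin (n+1) → ℝᴺ)` into the `μ`-th slot. -/
noncomputable def sing (n N : ℕ) (μ : Fin (n + 1)) :
    (Fin N → ℝ) →L[ℝ] (Fin (n + 1) → Fin N → ℝ) :=
  ContinuousLinearMap.pi fun ν =>
    if ν = μ then ContinuousLinearMap.id ℝ (Fin N → ℝ) else 0

/-- `D_yL(p)`: partial Fréchet derivative of `L` in the `y` argument. -/
noncomputable def DyF {n N : ℕ}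
    (L : (Fin N → ℝ) × (Fin (n + 1) → Fin N → ℝ) → ℝ)
    (p : (Fin N → ℝ) × (Fin (n + 1) → Fin N → ℝ)) : (Fin N → ℝ) →L[ℝ] ℝ :=
  (fderiv ℝ L p).comp (ContinuousLinearMap.inl ℝ (Fin N → ℝ) (Fin (n + 1) → Fin N → ℝ))

/-- `D_{v_μ}L(p)`: partial Fréchet derivative of `L` in the `v_μ` argument. -/
noncomputable def DvF {n N : ℕ}
    (L : (Fin N → ℝ) × (Fin (n + 1) → Fin N → ℝ) → ℝ) (μ : Fin (n + 1))
    (p : (Fin N → ℝ) × (Fin (n + 1) → Fin N → ℝ)) : (Fin N → ℝ) →L[ℝ] ℝ :=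
  (fderiv ℝ L p).comp
    ((ContinuousLinearMap.inr ℝ (Fin N → ℝ) (Fin (n + 1) → Fin N → ℝ)).comp (sing n N μ))

/-- The first jet `j¹φ(x) = (φ(x), ∂₀φ(x), …, ∂ₙφ(x))`. -/
noncomputable def jet {n N : ℕ} (φ : (Fin (n + 1) → ℝ) → Fin N → ℝ)
    (x : Fin (n + 1) → ℝ) : (Fin N → ℝ) × (Fin (n + 1) → Fin N → ℝ) :=
  (φ x, fun μ => fderiv ℝ φ x (Pi.single μ 1))

/-- `φ` satisfies the Euler–Lagrange field equations for `L`. -/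
def IsELSolution {n N : ℕ} (L : (Fin N → ℝ) × (Fin (n + 1) → Fin N → ℝ) → ℝ)
    (φ : (Fin (n + 1) → ℝ) → Fin N → ℝ) : Prop :=
  ∀ x : Fin (n + 1) → ℝ,
    DyF L (jet φ x)
      = ∑ μ : Fin (n + 1), fderiv ℝ (fun x' => DvF L μ (jet φ x')) x (Pi.single μ 1)

theorem contDiff_jet {n N : ℕ} {φ : (Fin (n + 1) → ℝ) → Fin N → ℝ}
    (hφ : ContDiff ℝ (⊤ : ℕ∞) φ) : ContDiff ℝ (⊤ : ℕ∞) (jet φ) :=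
  hφ.prodMk (contDiff_pi.2 fun _ =>
    (hφ.fderiv_right (m := (⊤ : ℕ∞)) le_rfl).clm_apply contDiff_const)

theorem contDiff_DvF {n N : ℕ} {L : (Fin N → ℝ) × (Fin (n + 1) → Fin N → ℝ) → ℝ}
    (hL : ContDiff ℝ (⊤ : ℕ∞) L) (μ : Fin (n + 1)) : ContDiff ℝ (⊤ : ℕ∞) (DvF L μ) :=
  (hL.fderiv_right (m := (⊤ : ℕ∞)) le_rfl).clm_comp contDiff_const

theorem statement12 (n N : ℕ) (hN : 1 ≤ N)
    (L : (Fin N → ℝ) × (Fin (n + 1) → Fin N → ℝ) → ℝ) (hL : ContDiff ℝ (⊤ : ℕ∞) L)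
    (ξ : (Fin N → ℝ) → Fin N → ℝ) (hξ : ContDiff ℝ (⊤ : ℕ∞) ξ)
    -- `ξ` is an infinitesimal vertical symmetry of `L`
    (hinv : ∀ (y : Fin N → ℝ) (v : Fin (n + 1) → Fin N → ℝ),
      DyF L (y, v) (ξ y) + ∑ μ : Fin (n + 1), DvF L μ (y, v) (fderiv ℝ ξ y (v μ)) = 0)
    (φ : (Fin (n + 1) → ℝ) → Fin N → ℝ) (hφ : ContDiff ℝ (⊤ : ℕ∞) φ)
    (hφEL : IsELSolution L φ) :
    ∀ x : Fin (n + 1) → ℝ,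
      ∑ μ : Fin (n + 1),
        fderiv ℝ (fun x' => DvF L μ (jet φ x') (ξ (φ x'))) x (Pi.single μ 1) = 0 := by
  intro x
  have hne : ((⊤ : ℕ∞) : WithTop ℕ∞) ≠ 0 := by simp
  have hξφ : HasFDerivAt (fun x' => ξ (φ x')) ((fderiv ℝ ξ (φ x)).comp (fderiv ℝ φ x)) x :=
    (hξ.differentiable hne (φ x)).hasFDerivAt.comp x (hφ.differentiable hne x).hasFDerivAt
  have product_rule : ∀ μ : Fin (n + 1),
      fderiv ℝ (fun x' => DvF L μ (jet φ x') (ξ (φ x'))) x (Pi.single μ 1)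
        = fderiv ℝ (fun x' => DvF L μ (jet φ x')) x (Pi.single μ 1) (ξ (φ x))
          + DvF L μ (jet φ x) (fderiv ℝ ξ (φ x) (fderiv ℝ φ x (Pi.single μ 1))) := fun μ => by
    have hmom : DifferentiableAt ℝ (fun x' => DvF L μ (jet φ x')) x :=
      ((contDiff_DvF hL μ).comp (contDiff_jet hφ)).differentiable hne x
    rw [(hmom.hasFDerivAt.clm_apply hξφ).fderiv]
    simp [add_comm]
  rw [Finset.sum_congr rfl fun μ _ => product_rule μ, Finset.sum_add_distrib,
    ← sum_apply, ← hφEL x]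
  exact hinv (φ x) fun μ => fderiv ℝ φ x (Pi.single μ 1)

end Stmt12
end

section
/- Let m, N ≥ 1, let L : ℝᵐ × ℝᵐ × ℝᵐ → ℝ be smooth, and let ξ : ℝᵐ → ℝᵐ be smooth with DL(a,b,c)(ξ(a), ξ(b), ξ(c)) = 0 for all (a,b,c) ∈ (ℝᵐ)³, where DL(a,b,c) is the full Fréchet derivative of L. Let y : (ℤ/Nℤ) × ℤ → ℝᵐ satisfy the discrete Euler–Lagrange field (DELF) equations. Then the total discrete momentum Σ_{i ∈ ℤ/Nℤ} D₁L( y_{i,j}, y_{i,j+1}, y_{i+1,j+1} )( ξ(y_{i,j}) ) is independent of j ∈ ℤ (discrete Noether theorem in conservation form). -/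
open scoped BigOperators

namespace Stmt13

/-- `D₁L`: partial Fréchet derivative in the first `ℝᵐ` argument. -/
noncomputable def D1L {m : ℕ} (L : (Fin m → ℝ) × (Fin m → ℝ) × (Fin m → ℝ) → ℝ)
    (p : (Fin m → ℝ) × (Fin m → ℝ) × (Fin m → ℝ)) : (Fin m → ℝ) →L[ℝ] ℝ :=
  (fderiv ℝ L p).comp (ContinuousLinearMap.inl ℝ (Fin m → ℝ) ((Fin m → ℝ) × (Fin m → ℝ)))

/-- `D₂L`: partial Fréchet derivative in the second `ℝᵐ` argument. -/
noncomputable def D2L {m : ℕ} (L : (Fin m → ℝ) × (Fin m → ℝ) × (Fin m → ℝ) → ℝ)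
    (p : (Fin m → ℝ) × (Fin m → ℝ) × (Fin m → ℝ)) : (Fin m → ℝ) →L[ℝ] ℝ :=
  (fderiv ℝ L p).comp
    ((ContinuousLinearMap.inr ℝ (Fin m → ℝ) ((Fin m → ℝ) × (Fin m → ℝ))).comp
      (ContinuousLinearMap.inl ℝ (Fin m → ℝ) (Fin m → ℝ)))

/-- `D₃L`: partial Fréchet derivative in the third `ℝᵐ` argument. -/
noncomputable def D3L {m : ℕ} (L : (Fin m → ℝ) × (Fin m → ℝ) × (Fin m → ℝ) → ℝ)
    (p : (Fin m → ℝ) × (Fin m → ℝ) × (Fin m → ℝ)) : (Fin m → ℝ) →L[ℝ] ℝ :=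
  (fderiv ℝ L p).comp
    ((ContinuousLinearMap.inr ℝ (Fin m → ℝ) ((Fin m → ℝ) × (Fin m → ℝ))).comp
      (ContinuousLinearMap.inr ℝ (Fin m → ℝ) (Fin m → ℝ)))

/-- The discrete Euler–Lagrange field (DELF) equations for a spatially periodic field. -/
def DELF {m N : ℕ} (L : (Fin m → ℝ) × (Fin m → ℝ) × (Fin m → ℝ) → ℝ)
    (y : ZMod N → ℤ → Fin m → ℝ) : Prop :=
  ∀ (i : ZMod N) (j : ℤ),
    D1L L (y i j, y i (j + 1), y (i + 1) (j + 1))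
      + D2L L (y i (j - 1), y i j, y (i + 1) j)
      + D3L L (y (i - 1) (j - 1), y (i - 1) j, y i j) = 0

theorem D1L_add_D2L_add_D3L_apply {m : ℕ} (L : (Fin m → ℝ) × (Fin m → ℝ) × (Fin m → ℝ) → ℝ)
    (p : (Fin m → ℝ) × (Fin m → ℝ) × (Fin m → ℝ)) (u v w : Fin m → ℝ) :
    D1L L p u + D2L L p v + D3L L p w = fderiv ℝ L p (u, v, w) := by
  simp [D1L, D2L, D3L, ← map_add]

/-- The total discrete momentum agrees on two consecutive time slices. -/
theorem sum_momentum_succ {m N : ℕ} [NeZero N]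
    (L : (Fin m → ℝ) × (Fin m → ℝ) × (Fin m → ℝ) → ℝ) (ξ : (Fin m → ℝ) → Fin m → ℝ)
    (hinv : ∀ a b c : Fin m → ℝ, fderiv ℝ L (a, b, c) (ξ a, ξ b, ξ c) = 0)
    (y : ZMod N → ℤ → Fin m → ℝ) (hy : DELF L y) (j : ℤ) :
    ∑ i : ZMod N, D1L L (y i (j + 1), y i (j + 1 + 1), y (i + 1) (j + 1 + 1)) (ξ (y i (j + 1)))
      = ∑ i : ZMod N, D1L L (y i j, y i (j + 1), y (i + 1) (j + 1)) (ξ (y i j)) := by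
  have hshift := Equiv.sum_comp (Equiv.addRight (1 : ZMod N)) fun i =>
    D3L L (y (i - 1) j, y (i - 1) (j + 1), y i (j + 1)) (ξ (y i (j + 1)))
  simp only [Equiv.coe_addRight, add_sub_cancel_right] at hshift
  have hfield := Finset.sum_eq_zero (s := Finset.univ) fun (i : ZMod N) _ =>
    DFunLike.congr_fun (hy i (j + 1)) (ξ (y i (j + 1)))
  have hsymm := Finset.sum_eq_zero (s := Finset.univ) fun (i : ZMod N) _ =>
    (D1L_add_D2L_add_D3L_apply L _ _ _ _).trans (hinv (y i j) (y i (j + 1)) (y (i + 1) (j + 1)))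
  simp only [add_sub_cancel_right, add_apply, Finset.sum_add_distrib] at hfield hsymm
  linarith

theorem statement13 (m N : ℕ) (hm : 1 ≤ m) (hN : 1 ≤ N) [NeZero N]
    (L : (Fin m → ℝ) × (Fin m → ℝ) × (Fin m → ℝ) → ℝ) (hL : ContDiff ℝ (⊤ : ℕ∞) L)
    (ξ : (Fin m → ℝ) → Fin m → ℝ) (hξ : ContDiff ℝ (⊤ : ℕ∞) ξ)
    -- infinitesimal invariance of `L`
    (hinv : ∀ a b c : Fin m → ℝ, fderiv ℝ L (a, b, c) (ξ a, ξ b, ξ c) = 0)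
    (y : ZMod N → ℤ → Fin m → ℝ) (hy : DELF L y) :
    ∀ j j' : ℤ,
      ∑ i : ZMod N, D1L L (y i j, y i (j + 1), y (i + 1) (j + 1)) (ξ (y i j))
        = ∑ i : ZMod N, D1L L (y i j', y i (j' + 1), y (i + 1) (j' + 1)) (ξ (y i j')) := by
  have hconst (j : ℤ) :
      ∑ i : ZMod N, D1L L (y i j, y i (j + 1), y (i + 1) (j + 1)) (ξ (y i j))
        = ∑ i : ZMod N, D1L L (y i 0, y i (0 + 1), y (i + 1) (0 + 1)) (ξ (y i 0)) := by
    induction j using Int.induction_on with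
    | zero => rfl
    | succ k ih => exact (sum_momentum_succ L ξ hinv y hy _).trans ih
    | pred k ih =>
      have h := sum_momentum_succ L ξ hinv y hy (-(k : ℤ) - 1)
      simp only [sub_add_cancel] at h ih ⊢
      exact h.symm.trans ih
  exact fun j j' => (hconst j).trans (hconst j').symm

end Stmt13
end

section
/- Let m, N ≥ 1 and let L : ℝᵐ × ℝᵐ × ℝᵐ → ℝ be smooth. Let y : (ℤ/Nℤ) × ℤ → ℝᵐ satisfy the discrete Euler–Lagrange field (DELF) equations, and let V, W : (ℤ/Nℤ) × ℤ → ℝᵐ be discrete first variations along y. For a field u write j(u)_{i,j} = (u_{i,j}, u_{i,j+1}, u_{i+1,j+1}) ∈ (ℝᵐ)³ and Δ_{i,j} = j(y)_{i,j}. Then the total discrete multisymplectic 2-form on a time slice, Σ_{i ∈ ℤ/Nℤ} [ D(D₁L)(Δ_{i,j})( j(V)_{i,j} )( W_{i,j} ) − D(D₁L)(Δ_{i,j})( j(W)_{i,j} )( V_{i,j} ) ], is independent of j ∈ ℤ (discrete multisymplectic form formula in conservation form). -/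
open scoped BigOperators

namespace Stmt14

/-- `D₁L`: partial Fréchet derivative in the first `ℝᵐ` argument. -/
noncomputable def D1L {m : ℕ} (L : (Fin m → ℝ) × (Fin m → ℝ) × (Fin m → ℝ) → ℝ)
    (p : (Fin m → ℝ) × (Fin m → ℝ) × (Fin m → ℝ)) : (Fin m → ℝ) →L[ℝ] ℝ :=
  (fderiv ℝ L p).comp (ContinuousLinearMap.inl ℝ (Fin m → ℝ) ((Fin m → ℝ) × (Fin m → ℝ)))

/-- `D₂L`: partial Fréchet derivative in the second `ℝᵐ` argument. -/
noncomputable def D2L {m : ℕ} (L : (Fin m → ℝ) × (Fin m → ℝ) × (Fin m → ℝ) → ℝ)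
    (p : (Fin m → ℝ) × (Fin m → ℝ) × (Fin m → ℝ)) : (Fin m → ℝ) →L[ℝ] ℝ :=
  (fderiv ℝ L p).comp
    ((ContinuousLinearMap.inr ℝ (Fin m → ℝ) ((Fin m → ℝ) × (Fin m → ℝ))).comp
      (ContinuousLinearMap.inl ℝ (Fin m → ℝ) (Fin m → ℝ)))

/-- `D₃L`: partial Fréchet derivative in the third `ℝᵐ` argument. -/
noncomputable def D3L {m : ℕ} (L : (Fin m → ℝ) × (Fin m → ℝ) × (Fin m → ℝ) → ℝ)
    (p : (Fin m → ℝ) × (Fin m → ℝ) × (Fin m → ℝ)) : (Fin m → ℝ) →L[ℝ] ℝ :=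
  (fderiv ℝ L p).comp
    ((ContinuousLinearMap.inr ℝ (Fin m → ℝ) ((Fin m → ℝ) × (Fin m → ℝ))).comp
      (ContinuousLinearMap.inr ℝ (Fin m → ℝ) (Fin m → ℝ)))

/-- `D(D₁L)(p)(u)`: full Fréchet derivative of `p ↦ D₁L(p)` at `p` in direction `u`. -/
noncomputable def DD1L {m : ℕ} (L : (Fin m → ℝ) × (Fin m → ℝ) × (Fin m → ℝ) → ℝ)
    (p u : (Fin m → ℝ) × (Fin m → ℝ) × (Fin m → ℝ)) : (Fin m → ℝ) →L[ℝ] ℝ :=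
  fderiv ℝ (fun p' => D1L L p') p u

/-- `D(D₂L)(p)(u)`. -/
noncomputable def DD2L {m : ℕ} (L : (Fin m → ℝ) × (Fin m → ℝ) × (Fin m → ℝ) → ℝ)
    (p u : (Fin m → ℝ) × (Fin m → ℝ) × (Fin m → ℝ)) : (Fin m → ℝ) →L[ℝ] ℝ :=
  fderiv ℝ (fun p' => D2L L p') p u

/-- `D(D₃L)(p)(u)`. -/
noncomputable def DD3L {m : ℕ} (L : (Fin m → ℝ) × (Fin m → ℝ) × (Fin m → ℝ) → ℝ)
    (p u : (Fin m → ℝ) × (Fin m → ℝ) × (Fin m → ℝ)) : (Fin m → ℝ) →L[ℝ] ℝ :=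
  fderiv ℝ (fun p' => D3L L p') p u

/-- The "discrete jet" `j(u)_{i,j} = (u_{i,j}, u_{i,j+1}, u_{i+1,j+1})`. -/
def jY {m N : ℕ} (u : ZMod N → ℤ → Fin m → ℝ) (i : ZMod N) (j : ℤ) :
    (Fin m → ℝ) × (Fin m → ℝ) × (Fin m → ℝ) :=
  (u i j, u i (j + 1), u (i + 1) (j + 1))

/-- The discrete Euler–Lagrange field (DELF) equations for a spatially periodic field. -/
def DELF {m N : ℕ} (L : (Fin m → ℝ) × (Fin m → ℝ) × (Fin m → ℝ) → ℝ)
    (y : ZMod N → ℤ → Fin m → ℝ) : Prop :=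
  ∀ (i : ZMod N) (j : ℤ),
    D1L L (y i j, y i (j + 1), y (i + 1) (j + 1))
      + D2L L (y i (j - 1), y i j, y (i + 1) j)
      + D3L L (y (i - 1) (j - 1), y (i - 1) j, y i j) = 0

/-- `V` is a discrete first variation along a DELF solution `y`. -/
def IsDiscreteFirstVariation {m N : ℕ}
    (L : (Fin m → ℝ) × (Fin m → ℝ) × (Fin m → ℝ) → ℝ)
    (y V : ZMod N → ℤ → Fin m → ℝ) : Prop :=
  ∀ (i : ZMod N) (j : ℤ),
    DD1L L (jY y i j) (jY V i j)
      + DD2L L (jY y i (j - 1)) (jY V i (j - 1))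
      + DD3L L (jY y (i - 1) (j - 1)) (jY V (i - 1) (j - 1)) = 0

theorem DD1L_apply {m : ℕ} {L : (Fin m → ℝ) × (Fin m → ℝ) × (Fin m → ℝ) → ℝ}
    {p : (Fin m → ℝ) × (Fin m → ℝ) × (Fin m → ℝ)} (h : DifferentiableAt ℝ (fderiv ℝ L) p)
    (u : (Fin m → ℝ) × (Fin m → ℝ) × (Fin m → ℝ)) (w : Fin m → ℝ) :
    DD1L L p u w = fderiv ℝ (fderiv ℝ L) p u (w, 0, 0) := by
  unfold DD1L D1L
  rw [(h.hasFDerivAt.clm_comp (hasFDerivAt_const _ p)).fderiv]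
  simp [← Prod.zero_eq_mk]

theorem DD2L_apply {m : ℕ} {L : (Fin m → ℝ) × (Fin m → ℝ) × (Fin m → ℝ) → ℝ}
    {p : (Fin m → ℝ) × (Fin m → ℝ) × (Fin m → ℝ)} (h : DifferentiableAt ℝ (fderiv ℝ L) p)
    (u : (Fin m → ℝ) × (Fin m → ℝ) × (Fin m → ℝ)) (w : Fin m → ℝ) :
    DD2L L p u w = fderiv ℝ (fderiv ℝ L) p u (0, w, 0) := by
  unfold DD2L D2L
  rw [(h.hasFDerivAt.clm_comp (hasFDerivAt_const _ p)).fderiv]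
  simp

theorem DD3L_apply {m : ℕ} {L : (Fin m → ℝ) × (Fin m → ℝ) × (Fin m → ℝ) → ℝ}
    {p : (Fin m → ℝ) × (Fin m → ℝ) × (Fin m → ℝ)} (h : DifferentiableAt ℝ (fderiv ℝ L) p)
    (u : (Fin m → ℝ) × (Fin m → ℝ) × (Fin m → ℝ)) (w : Fin m → ℝ) :
    DD3L L p u w = fderiv ℝ (fderiv ℝ L) p u (0, 0, w) := by
  unfold DD3L D3L
  rw [(h.hasFDerivAt.clm_comp (hasFDerivAt_const _ p)).fderiv]
  simp

/-- The three partial second derivatives assemble to the Hessian of `L`. -/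
theorem DD1L_add_DD2L_add_DD3L {m : ℕ} {L : (Fin m → ℝ) × (Fin m → ℝ) × (Fin m → ℝ) → ℝ}
    {p : (Fin m → ℝ) × (Fin m → ℝ) × (Fin m → ℝ)} (h : DifferentiableAt ℝ (fderiv ℝ L) p)
    (u w : (Fin m → ℝ) × (Fin m → ℝ) × (Fin m → ℝ)) :
    DD1L L p u w.1 + DD2L L p u w.2.1 + DD3L L p u w.2.2 = fderiv ℝ (fderiv ℝ L) p u w := by
  rw [DD1L_apply h, DD2L_apply h, DD3L_apply h, ← map_add, ← map_add]
  simp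

/-- The three discrete Poincaré–Cartan two-forms of a triangle sum to zero. -/
theorem DD_antisymm_sum_eq_zero {m : ℕ} {L : (Fin m → ℝ) × (Fin m → ℝ) × (Fin m → ℝ) → ℝ}
    (hL : ContDiff ℝ 2 L) (p v w : (Fin m → ℝ) × (Fin m → ℝ) × (Fin m → ℝ)) :
    (DD1L L p v w.1 - DD1L L p w v.1) + (DD2L L p v w.2.1 - DD2L L p w v.2.1)
      + (DD3L L p v w.2.2 - DD3L L p w v.2.2) = 0 := by
  have hd : DifferentiableAt ℝ (fderiv ℝ L) p :=
    ((hL.fderiv_right (m := 1) (by norm_num)).differentiable one_ne_zero) p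
  have hs : fderiv ℝ (fderiv ℝ L) p v w = fderiv ℝ (fderiv ℝ L) p w v :=
    (hL.contDiffAt.isSymmSndFDerivAt (by simp)).eq v w
  linear_combination DD1L_add_DD2L_add_DD3L hd v w - DD1L_add_DD2L_add_DD3L hd w v + hs

/-- The first variation equation at `(i, j + 1)`, contracted with a vector. -/
theorem IsDiscreteFirstVariation.apply_succ {m N : ℕ}
    {L : (Fin m → ℝ) × (Fin m → ℝ) × (Fin m → ℝ) → ℝ} {y V : ZMod N → ℤ → Fin m → ℝ}
    (hV : IsDiscreteFirstVariation L y V) (i : ZMod N) (j : ℤ) (w : Fin m → ℝ) :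
    DD1L L (jY y i (j + 1)) (jY V i (j + 1)) w + DD2L L (jY y i j) (jY V i j) w
      + DD3L L (jY y (i - 1) j) (jY V (i - 1) j) w = 0 := by
  simpa using DFunLike.congr_fun (hV i (j + 1)) w

/-- Conservation of the multisymplectic form over one time step. -/
theorem sum_multisymplectic_succ {m N : ℕ} [NeZero N]
    {L : (Fin m → ℝ) × (Fin m → ℝ) × (Fin m → ℝ) → ℝ} (hL : ContDiff ℝ 2 L)
    {y V W : ZMod N → ℤ → Fin m → ℝ}
    (hV : IsDiscreteFirstVariation L y V) (hW : IsDiscreteFirstVariation L y W) (j : ℤ) :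
    ∑ i : ZMod N, (DD1L L (jY y i (j + 1)) (jY V i (j + 1)) (W i (j + 1))
        - DD1L L (jY y i (j + 1)) (jY W i (j + 1)) (V i (j + 1)))
      = ∑ i : ZMod N,
        (DD1L L (jY y i j) (jY V i j) (W i j) - DD1L L (jY y i j) (jY W i j) (V i j)) := by
  let ω₂ : ZMod N → ℝ := fun i =>
    DD2L L (jY y i j) (jY V i j) (W i (j + 1)) - DD2L L (jY y i j) (jY W i j) (V i (j + 1))
  let ω₃ : ZMod N → ℝ := fun i =>
    DD3L L (jY y i j) (jY V i j) (W (i + 1) (j + 1))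
      - DD3L L (jY y i j) (jY W i j) (V (i + 1) (j + 1))
  have hshift : ∑ i, ω₃ (i - 1) = ∑ i, ω₃ i := (Equiv.subRight (1 : ZMod N)).sum_comp ω₃
  calc
    _ = ∑ i, (-ω₂ i - ω₃ (i - 1)) := Finset.sum_congr rfl fun i _ => by
      simp only [ω₂, ω₃, sub_add_cancel]
      linear_combination hV.apply_succ i j (W i (j + 1)) - hW.apply_succ i j (V i (j + 1))
    _ = ∑ i, (-ω₂ i - ω₃ i) := by simp only [Finset.sum_sub_distrib, hshift]
    _ = _ := Finset.sum_congr rfl fun i _ => by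
      have h := DD_antisymm_sum_eq_zero hL (jY y i j) (jY V i j) (jY W i j)
      simp only [ω₂, ω₃]
      simp only [jY] at h ⊢
      linear_combination -h

theorem statement14 (m N : ℕ) (hm : 1 ≤ m) (hN : 1 ≤ N) [NeZero N]
    (L : (Fin m → ℝ) × (Fin m → ℝ) × (Fin m → ℝ) → ℝ) (hL : ContDiff ℝ (⊤ : ℕ∞) L)
    (y : ZMod N → ℤ → Fin m → ℝ) (hy : DELF L y)
    (V W : ZMod N → ℤ → Fin m → ℝ)
    (hV : IsDiscreteFirstVariation L y V) (hW : IsDiscreteFirstVariation L y W) :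
    ∀ j j' : ℤ,
      ∑ i : ZMod N,
        (DD1L L (jY y i j) (jY V i j) (W i j) - DD1L L (jY y i j) (jY W i j) (V i j))
        = ∑ i : ZMod N,
            (DD1L L (jY y i j') (jY V i j') (W i j')
              - DD1L L (jY y i j') (jY W i j') (V i j')) := by
  have hL2 : ContDiff ℝ 2 L := contDiff_infty.1 hL 2
  have hper : Function.Periodic (fun j : ℤ => ∑ i : ZMod N,
      (DD1L L (jY y i j) (jY V i j) (W i j) - DD1L L (jY y i j) (jY W i j) (V i j))) 1 :=
    fun j => sum_multisymplectic_succ hL2 hV hW j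
  intro j j'
  simpa using (hper.int_mul_eq j).trans (hper.int_mul_eq j').symm

end Stmt14
end

section
/- Let m, N ≥ 1 and let L : ℝᵐ × ℝᵐ × ℝᵐ → ℝ be smooth. Define the discrete Lagrangian L̃ : ((ℤ/Nℤ) → ℝᵐ) × ((ℤ/Nℤ) → ℝᵐ) → ℝ by L̃(A,B) = Σ_{i ∈ ℤ/Nℤ} L(A_i, B_i, B_{i+1}). Then a sequence Q : ℤ → ((ℤ/Nℤ) → ℝᵐ) satisfies the Moser–Veselov discrete Euler–Lagrange equations for L̃, namely that for every j the Fréchet derivative with respect to the middle variable B of the function B ↦ L̃(Q^{j−1}, B) + L̃(B, Q^{j+1}) vanishes at B = Q^{j}, if and only if the field y : (ℤ/Nℤ) × ℤ → ℝᵐ defined by y_{i,j} = Q^{j}_i satisfies the discrete Euler–Lagrange field (DELF) equations for L. -/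
open scoped BigOperators

namespace Stmt15

/-- `D₁L`: partial Fréchet derivative in the first `ℝᵐ` argument. -/
noncomputable def D1L {m : ℕ} (L : (Fin m → ℝ) × (Fin m → ℝ) × (Fin m → ℝ) → ℝ)
    (p : (Fin m → ℝ) × (Fin m → ℝ) × (Fin m → ℝ)) : (Fin m → ℝ) →L[ℝ] ℝ :=
  (fderiv ℝ L p).comp (ContinuousLinearMap.inl ℝ (Fin m → ℝ) ((Fin m → ℝ) × (Fin m → ℝ)))

/-- `D₂L`: partial Fréchet derivative in the second `ℝᵐ` argument. -/
noncomputable def D2L {m : ℕ} (L : (Fin m → ℝ) × (Fin m → ℝ) × (Fin m → ℝ) → ℝ)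
    (p : (Fin m → ℝ) × (Fin m → ℝ) × (Fin m → ℝ)) : (Fin m → ℝ) →L[ℝ] ℝ :=
  (fderiv ℝ L p).comp
    ((ContinuousLinearMap.inr ℝ (Fin m → ℝ) ((Fin m → ℝ) × (Fin m → ℝ))).comp
      (ContinuousLinearMap.inl ℝ (Fin m → ℝ) (Fin m → ℝ)))

/-- `D₃L`: partial Fréchet derivative in the third `ℝᵐ` argument. -/
noncomputable def D3L {m : ℕ} (L : (Fin m → ℝ) × (Fin m → ℝ) × (Fin m → ℝ) → ℝ)
    (p : (Fin m → ℝ) × (Fin m → ℝ) × (Fin m → ℝ)) : (Fin m → ℝ) →L[ℝ] ℝ :=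
  (fderiv ℝ L p).comp
    ((ContinuousLinearMap.inr ℝ (Fin m → ℝ) ((Fin m → ℝ) × (Fin m → ℝ))).comp
      (ContinuousLinearMap.inr ℝ (Fin m → ℝ) (Fin m → ℝ)))

/-- The discrete Euler–Lagrange field (DELF) equations for a spatially periodic field. -/
def DELF {m N : ℕ} (L : (Fin m → ℝ) × (Fin m → ℝ) × (Fin m → ℝ) → ℝ)
    (y : ZMod N → ℤ → Fin m → ℝ) : Prop :=
  ∀ (i : ZMod N) (j : ℤ),
    D1L L (y i j, y i (j + 1), y (i + 1) (j + 1))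
      + D2L L (y i (j - 1), y i j, y (i + 1) j)
      + D3L L (y (i - 1) (j - 1), y (i - 1) j, y i j) = 0

/-- The discrete Lagrangian `L̃(A,B) = Σ_i L(A_i, B_i, B_{i+1})` on the configuration
space `(ℤ/Nℤ) → ℝᵐ` of spatially periodic configurations. -/
noncomputable def Ltil {m N : ℕ} [NeZero N]
    (L : (Fin m → ℝ) × (Fin m → ℝ) × (Fin m → ℝ) → ℝ)
    (A B : ZMod N → Fin m → ℝ) : ℝ :=
  ∑ i : ZMod N, L (A i, B i, B (i + 1))

theorem hasFDerivAt_D1L {m : ℕ} {L : (Fin m → ℝ) × (Fin m → ℝ) × (Fin m → ℝ) → ℝ}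
    (hL : Differentiable ℝ L) (a b c : Fin m → ℝ) :
    HasFDerivAt (fun x => L (x, b, c)) (D1L L (a, b, c)) a :=
  (hL (a, b, c)).hasFDerivAt.comp a (hasFDerivAt_prodMk_left a (b, c))

theorem fderiv_apply_inr {m : ℕ} (L : (Fin m → ℝ) × (Fin m → ℝ) × (Fin m → ℝ) → ℝ)
    (p : (Fin m → ℝ) × (Fin m → ℝ) × (Fin m → ℝ)) (v w : Fin m → ℝ) :
    fderiv ℝ L p (0, v, w) = D2L L p v + D3L L p w := by
  simp [D2L, D3L, ← map_add]

theorem hasFDerivAt_Ltil_left {m N : ℕ} [NeZero N]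
    {L : (Fin m → ℝ) × (Fin m → ℝ) × (Fin m → ℝ) → ℝ}
    (hL : Differentiable ℝ L) (A B : ZMod N → Fin m → ℝ) :
    HasFDerivAt (fun X => Ltil L X B)
      (∑ i, (D1L L (A i, B i, B (i + 1))).comp (ContinuousLinearMap.proj i)) A :=
  HasFDerivAt.fun_sum fun i _ =>
    HasFDerivAt.comp (f := fun X : ZMod N → Fin m → ℝ => X i) A
      (hasFDerivAt_D1L hL (A i) (B i) (B (i + 1))) (hasFDerivAt_apply i A)

theorem hasFDerivAt_Ltil_right {m N : ℕ} [NeZero N]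
    {L : (Fin m → ℝ) × (Fin m → ℝ) × (Fin m → ℝ) → ℝ}
    (hL : Differentiable ℝ L) (A B : ZMod N → Fin m → ℝ) :
    HasFDerivAt (fun X => Ltil L A X)
      (∑ i, ((D2L L (A i, B i, B (i + 1))).comp (ContinuousLinearMap.proj i)
        + (D3L L (A i, B i, B (i + 1))).comp (ContinuousLinearMap.proj (i + 1)))) B := by
  refine HasFDerivAt.fun_sum fun i _ => ?_
  have h := HasFDerivAt.comp (f := fun X : ZMod N → Fin m → ℝ => (A i, X i, X (i + 1))) B
    (hL (A i, B i, B (i + 1))).hasFDerivAt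
    ((hasFDerivAt_const (A i) B).prodMk
      ((hasFDerivAt_apply i B).prodMk (hasFDerivAt_apply (i + 1) B)))
  refine h.congr_fderiv ?_
  ext1 v
  exact fderiv_apply_inr L _ (v i) (v (i + 1))

/-- The first variation of the discrete action, with the sum reorganized by lattice sites. -/
theorem fderiv_Ltil_add_Ltil_apply {m N : ℕ} [NeZero N]
    {L : (Fin m → ℝ) × (Fin m → ℝ) × (Fin m → ℝ) → ℝ}
    (hL : Differentiable ℝ L) (A B C v : ZMod N → Fin m → ℝ) :
    fderiv ℝ (fun X => Ltil L A X + Ltil L X C) B v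
      = ∑ i, (D1L L (B i, C i, C (i + 1)) + D2L L (A i, B i, B (i + 1))
          + D3L L (A (i - 1), B (i - 1), B i)) (v i) := by
  rw [((hasFDerivAt_Ltil_right hL A B).fun_add (hasFDerivAt_Ltil_left hL B C)).fderiv]
  have shift : ∑ i, D3L L (A i, B i, B (i + 1)) (v (i + 1))
      = ∑ i, D3L L (A (i - 1), B (i - 1), B i) (v i) :=
    Fintype.sum_equiv (Equiv.addRight 1) _ _ fun i => by simp
  simp only [add_apply, sum_apply, ContinuousLinearMap.comp_apply,
    ContinuousLinearMap.proj_apply, Finset.sum_add_distrib, shift]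
  ring

theorem sum_clm_apply_eq_zero_iff {ι E : Type*} [Fintype ι] [NormedAddCommGroup E]
    [NormedSpace ℝ E] (f : ι → E →L[ℝ] ℝ) :
    (∀ v : ι → E, ∑ i, f i (v i) = 0) ↔ ∀ i, f i = 0 := by
  classical
  refine ⟨fun h i => ?_, fun h v => by simp [h]⟩
  ext w
  rw [zero_apply, ← h (Pi.single i w), Finset.sum_eq_single i]
  · simp
  · intro k _ hk
    simp [hk]
  · simp

theorem statement15 (m N : ℕ) (hm : 1 ≤ m) (hN : 1 ≤ N) [NeZero N]
    (L : (Fin m → ℝ) × (Fin m → ℝ) × (Fin m → ℝ) → ℝ) (hL : ContDiff ℝ (⊤ : ℕ∞) L)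
    (Q : ℤ → ZMod N → Fin m → ℝ) :
    (∀ j : ℤ, fderiv ℝ (fun B => Ltil L (Q (j - 1)) B + Ltil L B (Q (j + 1))) (Q j) = 0)
      ↔ DELF L (fun i j => Q j i) := by
  have hd : Differentiable ℝ L := hL.differentiable (by simp)
  simp only [ContinuousLinearMap.ext_iff, fderiv_Ltil_add_Ltil_apply hd,
    zero_apply]
  simp only [sum_clm_apply_eq_zero_iff]
  exact forall_comm

end Stmt15
end

section
/- Let n ≥ 0, N ≥ 1, let U ⊆ ℝ^{n+1} be open, and let γ : U × ℝᴺ → Hom(ℝ^{n+1}, ℝᴺ) be smooth (Hom denoting continuous linear maps). Define R_γ(x,y)(v,w) := [ Dγ(x,y)( v, γ(x,y)v ) ](w) − [ Dγ(x,y)( w, γ(x,y)w ) ](v) for v, w ∈ ℝ^{n+1}, where Dγ(x,y) : ℝ^{n+1} × ℝᴺ → Hom(ℝ^{n+1}, ℝᴺ) is the Fréchet derivative of γ at (x,y). Then R_γ vanishes identically on U × ℝᴺ if and only if γ is locally holonomic: for every (x₀,y₀) ∈ U × ℝᴺ there exist an open set Ω ⊆ U with x₀ ∈ Ω and a smooth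 map φ : Ω → ℝᴺ with φ(x₀) = y₀ and Dφ(x) = γ(x, φ(x)) for all x ∈ Ω. -/
open Set Metric Filter Topology
open scoped NNReal ContDiff

/-- A Picard–Lindelöf solution that stays in the ball on which the vector field is controlled. -/
theorem IsPicardLindelof.exists_hasDerivWithinAt_mem_closedBall
    {E : Type*} [NormedAddCommGroup E] [NormedSpace ℝ E] [CompleteSpace E]
    {f : ℝ → E → E} {tmin tmax : ℝ} {t₀ : Icc tmin tmax} {x₀ : E} {a L K : ℝ≥0}
    (hf : IsPicardLindelof f t₀ x₀ a 0 L K) :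
    ∃ α : ℝ → E, α t₀ = x₀ ∧ ∀ t ∈ Icc tmin tmax, α t ∈ closedBall x₀ a ∧
      HasDerivWithinAt α (f t (α t)) (Icc tmin tmax) t := by
  have hx : x₀ ∈ closedBall x₀ ((0 : ℝ≥0) : ℝ) := mem_closedBall_self le_rfl
  obtain ⟨α, hα⟩ := ODE.FunSpace.exists_isFixedPt_next hf hx
  refine ⟨α.compProj, by rw [ODE.FunSpace.compProj_val, ← hα, ODE.FunSpace.next_apply₀],
    fun t ht ↦ ⟨α.compProj_mem_closedBall hf.mul_max_le, ?_⟩⟩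
  apply ODE.hasDerivWithinAt_picard_Icc t₀.2 hf.continuousOn_uncurry
    α.continuous_compProj.continuousOn (fun _ _ ↦ α.compProj_mem_closedBall hf.mul_max_le)
    x₀ ht |>.congr_of_mem _ ht
  intro t' ht'
  nth_rw 1 [← hα]
  rw [ODE.FunSpace.compProj_of_mem ht', ODE.FunSpace.next_apply]

theorem gronwallBound_zero_eq_mul (K ε x : ℝ) :
    gronwallBound 0 K ε x = ε * gronwallBound 0 K 1 x := by
  unfold gronwallBound
  split_ifs <;> ring

/-- First-order Taylor estimate for a map whose derivative is Lipschitz on a convex set. -/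
theorem Convex.norm_sub_sub_fderiv_le_of_lipschitzOnWith
    {E F : Type*} [NormedAddCommGroup E] [NormedSpace ℝ E] [NormedAddCommGroup F] [NormedSpace ℝ F]
    {f : E → F} {f' : E → E →L[ℝ] F} {s : Set E} {K : ℝ≥0} (hs : Convex ℝ s)
    (hf : ∀ x ∈ s, HasFDerivAt f (f' x) x) (hK : LipschitzOnWith K f' s)
    {x y : E} (hx : x ∈ s) (hy : y ∈ s) :
    ‖f y - f x - f' x (y - x)‖ ≤ K * ‖y - x‖ ^ 2 := by
  have hseg : segment ℝ x y ⊆ s := hs.segment_subset hx hy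
  rw [pow_two, ← mul_assoc]
  refine (convex_segment x y).norm_image_sub_le_of_norm_hasFDerivWithin_le'
    (fun z hz ↦ (hf z (hseg hz)).hasFDerivWithinAt) (fun z hz ↦ ?_)
    (left_mem_segment ℝ x y) (right_mem_segment ℝ x y)
  refine (hK.norm_sub_le (hseg hz) hx).trans ?_
  gcongr
  exact norm_sub_le_of_mem_segment hz

section Connection

variable {E F : Type*} [NormedAddCommGroup E] [NormedSpace ℝ E]
  [NormedAddCommGroup F] [NormedSpace ℝ F] {γ : E × F → E →L[ℝ] F}
  {x₀ : E} {y₀ : F} {ρ K K' M : ℝ≥0}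

theorem add_smul_mem_closedBall {v : E} (hv : ‖v‖ ≤ ρ) {t : ℝ} (ht : t ∈ Icc (0 : ℝ) 1) :
    x₀ + t • v ∈ closedBall x₀ ρ := by
  rw [mem_closedBall_iff_norm, add_sub_cancel_left, norm_smul, Real.norm_of_nonneg ht.1]
  nlinarith [norm_nonneg v, ht.2]

/-- Lipschitz bound for the vector field governing parallel transport along a ray. -/
theorem lipschitzOnWith_radial (hK : LipschitzOnWith K γ (closedBall (x₀, y₀) ρ))
    {v : E} (hv : ‖v‖ ≤ ρ) {t : ℝ} (ht : t ∈ Icc (0 : ℝ) 1) :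
    LipschitzOnWith (K * ρ) (fun y ↦ γ (x₀ + t • v, y) v) (closedBall y₀ ρ) := by
  refine LipschitzOnWith.of_dist_le_mul fun a ha b hb ↦ ?_
  have h := hK.norm_sub_le (x := (x₀ + t • v, a)) (y := (x₀ + t • v, b))
    (by rw [← closedBall_prod_same]; exact ⟨add_smul_mem_closedBall hv ht, ha⟩)
    (by rw [← closedBall_prod_same]; exact ⟨add_smul_mem_closedBall hv ht, hb⟩)
  rw [Prod.mk_sub_mk, sub_self, Prod.norm_mk, norm_zero, max_eq_right (norm_nonneg _)] at h
  rw [dist_eq_norm, dist_eq_norm, ← sub_apply, NNReal.coe_mul]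
  calc ‖(γ (x₀ + t • v, a) - γ (x₀ + t • v, b)) v‖
      ≤ ‖γ (x₀ + t • v, a) - γ (x₀ + t • v, b)‖ * ‖v‖ := ContinuousLinearMap.le_opNorm _ _
    _ ≤ (K * ‖a - b‖) * ρ := by gcongr
    _ = K * ρ * ‖a - b‖ := by ring

/-- Parallel transport along short rays exists and stays in a prescribed ball. -/
theorem exists_radial_solution [CompleteSpace F]
    (hK : LipschitzOnWith K γ (closedBall (x₀, y₀) ρ))
    (hM : ∀ p ∈ closedBall (x₀, y₀) (ρ : ℝ), ‖γ p‖ ≤ M)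
    {v : E} (hv : ‖v‖ ≤ ρ) (hMv : M * ‖v‖ ≤ ρ / 2) :
    ∃ α : ℝ → F, α 0 = y₀ ∧ ∀ t ∈ Icc (0 : ℝ) 1, α t ∈ closedBall y₀ (ρ / 2) ∧
      HasDerivWithinAt α (γ (x₀ + t • v, α t) v) (Icc 0 1) t := by
  have hhalf : closedBall y₀ ((ρ / 2 : ℝ≥0) : ℝ) ⊆ closedBall y₀ ρ :=
    closedBall_subset_closedBall (by push_cast; linarith [ρ.2])
  have hmem {t : ℝ} (ht : t ∈ Icc (0 : ℝ) 1) {y : F} (hy : y ∈ closedBall y₀ ((ρ / 2 : ℝ≥0) : ℝ)) :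
      (x₀ + t • v, y) ∈ closedBall (x₀, y₀) (ρ : ℝ) := by
    rw [← closedBall_prod_same]
    exact ⟨add_smul_mem_closedBall hv ht, hhalf hy⟩
  have hPL : IsPicardLindelof (fun t y ↦ γ (x₀ + t • v, y) v)
      (⟨0, by simp⟩ : Icc (0 : ℝ) 1) y₀ (ρ / 2) 0 (M * ‖v‖₊) (K * ρ) :=
    { lipschitzOnWith := fun t ht ↦ (lipschitzOnWith_radial hK hv ht).mono hhalf
      continuousOn := fun y hy ↦ by
        have h : ContinuousOn (fun t : ℝ ↦ γ (x₀ + t • v, y)) (Icc 0 1) :=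
          hK.continuousOn.comp (by fun_prop) fun t ht ↦ hmem ht hy
        exact h.clm_apply continuousOn_const
      norm_le := fun t ht y hy ↦ by
        refine (ContinuousLinearMap.le_opNorm _ _).trans ?_
        push_cast
        gcongr
        exact hM _ (hmem ht hy)
      mul_max_le := by simpa using hMv }
  simpa using hPL.exists_hasDerivWithinAt_mem_closedBall

/-- Two radial solutions of a flat connection differ, to first order, by the connection itself. -/
theorem norm_radial_sub_sub_le {γ' : E × F → E × F →L[ℝ] E →L[ℝ] F}
    (hγ : ∀ p ∈ closedBall (x₀, y₀) (ρ : ℝ), HasFDerivAt γ (γ' p) p)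
    (hK : LipschitzOnWith K γ (closedBall (x₀, y₀) ρ))
    (hK' : LipschitzOnWith K' γ' (closedBall (x₀, y₀) ρ))
    (hM : ∀ p ∈ closedBall (x₀, y₀) (ρ : ℝ), ‖γ p‖ ≤ M) (hM1 : 1 ≤ M)
    (hflat : ∀ p ∈ closedBall (x₀, y₀) (ρ : ℝ), ∀ v w, γ' p (v, γ p v) w = γ' p (w, γ p w) v)
    {v h : E} (hv : ‖v‖ ≤ ρ) (hvh : ‖v + h‖ ≤ ρ) (hh : M * ‖h‖ ≤ ρ / 2) {y z : ℝ → F}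
    (hy : ∀ t ∈ Icc (0 : ℝ) 1, y t ∈ closedBall y₀ (ρ / 2) ∧
      HasDerivWithinAt y (γ (x₀ + t • v, y t) v) (Icc 0 1) t)
    (hz : ∀ t ∈ Icc (0 : ℝ) 1, z t ∈ closedBall y₀ (ρ / 2) ∧
      HasDerivWithinAt z (γ (x₀ + t • (v + h), z t) (v + h)) (Icc 0 1) t)
    (h0 : z 0 = y 0) :
    ‖z 1 - y 1 - γ (x₀ + v, y 1) h‖ ≤
      (K' * M ^ 2 * ρ + K * M) * gronwallBound 0 (K * ρ) 1 1 * ‖h‖ ^ 2 := by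
  have hhalf : closedBall y₀ ((ρ : ℝ) / 2) ⊆ closedBall y₀ ρ :=
    closedBall_subset_closedBall (by linarith [ρ.2])
  have hp {t : ℝ} (ht : t ∈ Icc (0 : ℝ) 1) : (x₀ + t • v, y t) ∈ closedBall (x₀, y₀) (ρ : ℝ) := by
    rw [← closedBall_prod_same]
    exact ⟨add_smul_mem_closedBall hv ht, hhalf (hy t ht).1⟩
  set w : ℝ → F := fun t ↦ y t + t • γ (x₀ + t • v, y t) h with hw
  have hGh {t : ℝ} (ht : t ∈ Icc (0 : ℝ) 1) : ‖t • γ (x₀ + t • v, y t) h‖ ≤ M * ‖h‖ := by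
    rw [norm_smul, Real.norm_of_nonneg ht.1]
    have h1 : ‖γ (x₀ + t • v, y t) h‖ ≤ M * ‖h‖ :=
      (ContinuousLinearMap.le_opNorm _ _).trans (by gcongr; exact hM _ (hp ht))
    nlinarith [norm_nonneg (γ (x₀ + t • v, y t) h), ht.2]
  have hwmem {t : ℝ} (ht : t ∈ Icc (0 : ℝ) 1) : w t ∈ closedBall y₀ (ρ : ℝ) := by
    have h1 := (hy t ht).1
    rw [mem_closedBall_iff_norm] at h1 ⊢
    calc ‖w t - y₀‖ = ‖(y t - y₀) + t • γ (x₀ + t • v, y t) h‖ :=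
          congrArg norm (add_sub_right_comm _ _ _)
      _ ≤ ‖y t - y₀‖ + ‖t • γ (x₀ + t • v, y t) h‖ := norm_add_le _ _
      _ ≤ ρ := by linarith [hGh ht]
  have hw' {t : ℝ} (ht : t ∈ Icc (0 : ℝ) 1) : HasDerivWithinAt w
      (γ (x₀ + t • v, y t) v + (t • γ' (x₀ + t • v, y t) (v, γ (x₀ + t • v, y t) v) h
        + (1 : ℝ) • γ (x₀ + t • v, y t) h)) (Icc 0 1) t := by
    have hline : HasDerivWithinAt (fun s : ℝ ↦ x₀ + s • v) v (Icc 0 1) t := by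
      simpa using ((hasDerivWithinAt_id t (Icc (0 : ℝ) 1)).smul_const v).const_add x₀
    have hG := (hγ _ (hp ht)).comp_hasDerivWithinAt t (hline.prodMk (hy t ht).2)
    have hGh := hG.clm_apply (hasDerivWithinAt_const t (Icc (0 : ℝ) 1) h)
    simp only [map_zero, add_zero] at hGh
    exact (hy t ht).2.add ((hasDerivWithinAt_id t (Icc (0 : ℝ) 1)).smul hGh)
  have herr {t : ℝ} (ht : t ∈ Icc (0 : ℝ) 1) :
      dist (γ (x₀ + t • v, y t) v + (t • γ' (x₀ + t • v, y t) (v, γ (x₀ + t • v, y t) v) h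
        + (1 : ℝ) • γ (x₀ + t • v, y t) h)) (γ (x₀ + t • (v + h), w t) (v + h))
      ≤ (K' * M ^ 2 * ρ + K * M) * ‖h‖ ^ 2 := by
    set p := (x₀ + t • v, y t) with hp_def
    set q := (x₀ + t • (v + h), w t) with hq_def
    have hq : q ∈ closedBall (x₀, y₀) (ρ : ℝ) := by
      rw [← closedBall_prod_same]
      exact ⟨add_smul_mem_closedBall hvh ht, hwmem ht⟩
    have hqp : q - p = t • (h, γ p h) := by
      simp [hq_def, hp_def, hw]
    have hqp_norm : ‖q - p‖ ≤ M * ‖h‖ := by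
      rw [hqp, Prod.smul_mk, Prod.norm_mk]
      refine max_le ?_ (hGh ht)
      rw [norm_smul, Real.norm_of_nonneg ht.1]
      exact mul_le_mul_of_nonneg_right (ht.2.trans hM1) (norm_nonneg _)
    have htaylor := (convex_closedBall (x₀, y₀) (ρ : ℝ)).norm_sub_sub_fderiv_le_of_lipschitzOnWith
      hγ hK' (hp ht) hq
    have hlip := hK.norm_sub_le hq (hp ht)
    have hdecomp : γ q (v + h) - (γ p v + (t • γ' p (v, γ p v) h + (1 : ℝ) • γ p h))
        = (γ q - γ p - γ' p (q - p)) v + (γ q - γ p) h := by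
      have : γ' p (q - p) v = t • γ' p (v, γ p v) h := by
        rw [hqp, map_smul, smul_apply, hflat p (hp ht) h v]
      simp only [sub_apply, this, map_add, one_smul]
      abel
    rw [dist_comm, dist_eq_norm, hdecomp]
    calc ‖(γ q - γ p - γ' p (q - p)) v + (γ q - γ p) h‖
        ≤ ‖γ q - γ p - γ' p (q - p)‖ * ‖v‖ + ‖γ q - γ p‖ * ‖h‖ :=
          (norm_add_le _ _).trans (add_le_add (ContinuousLinearMap.le_opNorm _ _)
            (ContinuousLinearMap.le_opNorm _ _))
      _ ≤ (K' * (M * ‖h‖) ^ 2) * ρ + (K * (M * ‖h‖)) * ‖h‖ := by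
          gcongr
          · exact htaylor.trans (by gcongr)
          · exact hlip.trans (by gcongr)
      _ = _ := by ring
  have hIci {f : ℝ → F} {f' : F} {t : ℝ} (ht : t ∈ Ico (0 : ℝ) 1)
      (hf : HasDerivWithinAt f f' (Icc 0 1) t) : HasDerivWithinAt f f' (Ici t) t :=
    hf.mono_of_mem_nhdsWithin (mem_of_superset (Icc_mem_nhdsGE ht.2) (Icc_subset_Icc_left ht.1))
  have hgron := dist_le_of_approx_trajectories_ODE_of_mem
    (v := fun t y ↦ γ (x₀ + t • (v + h), y) (v + h)) (s := fun _ ↦ closedBall y₀ ρ)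
    (K := K * ρ) (f := z) (g := w) (a := 0) (b := 1) (δ := 0) (εf := 0)
    (fun t ht ↦ lipschitzOnWith_radial hK hvh (Ico_subset_Icc_self ht))
    (fun t ht ↦ (hz t ht).2.continuousWithinAt)
    (fun t ht ↦ hIci ht (hz t (Ico_subset_Icc_self ht)).2)
    (fun t ht ↦ (dist_self _).le)
    (fun t ht ↦ hhalf (hz t (Ico_subset_Icc_self ht)).1)
    (fun t ht ↦ (hw' ht).continuousWithinAt)
    (fun t ht ↦ hIci ht (hw' (Ico_subset_Icc_self ht)))
    (fun t ht ↦ herr (Ico_subset_Icc_self ht))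
    (fun t ht ↦ hwmem (Ico_subset_Icc_self ht))
    (by simp [hw, h0]) 1 (by simp)
  rw [gronwallBound_zero_eq_mul, dist_eq_norm] at hgron
  simp only [hw, one_smul, sub_zero, zero_add, NNReal.coe_mul] at hgron
  rw [sub_sub]
  exact hgron.trans_eq (by ring)

/-- **Frobenius theorem**, quantitative local form: a flat connection with Lipschitz derivative on a
ball has a horizontal section through the centre of that ball. -/
theorem exists_hasFDerivAt_of_flat [CompleteSpace F] {γ' : E × F → E × F →L[ℝ] E →L[ℝ] F}
    (hρ : 0 < ρ) (hγ : ∀ p ∈ closedBall (x₀, y₀) (ρ : ℝ), HasFDerivAt γ (γ' p) p)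
    (hK : LipschitzOnWith K γ (closedBall (x₀, y₀) ρ))
    (hK' : LipschitzOnWith K' γ' (closedBall (x₀, y₀) ρ))
    (hM : ∀ p ∈ closedBall (x₀, y₀) (ρ : ℝ), ‖γ p‖ ≤ M) (hM1 : 1 ≤ M)
    (hflat : ∀ p ∈ closedBall (x₀, y₀) (ρ : ℝ), ∀ v w, γ' p (v, γ p v) w = γ' p (w, γ p w) v) :
    ∃ ε > 0, ∃ φ : E → F, φ x₀ = y₀ ∧ ∀ x ∈ ball x₀ ε, HasFDerivAt φ (γ (x, φ x)) x := by
  have hM1' : (1 : ℝ) ≤ M := hM1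
  have hρ' : (0 : ℝ) < ρ := hρ
  have hM0 : (0 : ℝ) < M := by linarith
  set ε : ℝ := ρ / 2 / M with hε
  have hε0 : 0 < ε := by positivity
  have hMv {v : E} (hv : ‖v‖ < ε) : M * ‖v‖ ≤ ρ / 2 := by
    rw [hε, lt_div_iff₀ hM0] at hv
    linarith
  have hvρ {v : E} (hv : ‖v‖ < ε) : ‖v‖ ≤ ρ := by
    nlinarith [hMv hv, norm_nonneg v]
  have hex (v : E) : ∃ α : ℝ → F, ‖v‖ < ε → α 0 = y₀ ∧
      ∀ t ∈ Icc (0 : ℝ) 1, α t ∈ closedBall y₀ (ρ / 2) ∧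
        HasDerivWithinAt α (γ (x₀ + t • v, α t) v) (Icc 0 1) t := by
    by_cases hv : ‖v‖ < ε
    · obtain ⟨α, hα⟩ := exists_radial_solution hK hM (hvρ hv) (hMv hv)
      exact ⟨α, fun _ ↦ hα⟩
    · exact ⟨fun _ ↦ 0, fun h ↦ absurd h hv⟩
  choose α hα using hex
  refine ⟨ε, hε0, fun x ↦ α (x - x₀) 1, ?_, fun x hx ↦ ?_⟩
  · have h0 : ‖(0 : E)‖ < ε := by simpa using hε0
    beta_reduce
    rw [sub_self, ← (hα 0 h0).1]
    refine constant_of_has_deriv_right_zero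
      (fun t ht ↦ ((hα 0 h0).2 t ht).2.continuousWithinAt) (fun t ht ↦ ?_) 1 (by simp)
    simpa using ((hα 0 h0).2 t (Ico_subset_Icc_self ht)).2.mono_of_mem_nhdsWithin
      (mem_of_superset (Icc_mem_nhdsGE ht.2) (Icc_subset_Icc_left ht.1))
  · have hv : ‖x - x₀‖ < ε := mem_ball_iff_norm.1 hx
    rw [hasFDerivAt_iff_isLittleO_nhds_zero]
    have hO : (fun h : E ↦ α (x + h - x₀) 1 - α (x - x₀) 1 - γ (x, α (x - x₀) 1) h)
        =O[𝓝 0] fun h ↦ ‖h‖ ^ 2 := by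
      refine Asymptotics.IsBigO.of_bound
        ((K' * M ^ 2 * ρ + K * M) * gronwallBound 0 (K * ρ) 1 1) ?_
      have h1 : ∀ᶠ h : E in 𝓝 0, ‖h‖ < ε :=
        (continuous_norm.tendsto' (0 : E) 0 norm_zero).eventually_lt_const hε0
      have h2 : ∀ᶠ h : E in 𝓝 0, ‖x - x₀ + h‖ < ε :=
        (Continuous.tendsto' (by fun_prop) (0 : E) ‖x - x₀‖ (by simp)).eventually_lt_const hv
      filter_upwards [h1, h2] with h hh hvh
      have := norm_radial_sub_sub_le hγ hK hK' hM hM1 hflat (hvρ hv) (hvρ hvh) (hMv hh)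
        (hα _ hv).2 (hα _ hvh).2 ((hα _ hvh).1.trans (hα _ hv).1.symm)
      rw [add_sub_cancel] at this
      rwa [add_sub_right_comm, norm_pow, norm_norm]
    exact hO.trans_isLittleO (Asymptotics.isLittleO_norm_pow_id one_lt_two)

/-- A flat `C²` connection has a horizontal section through every point. -/
theorem ContDiffAt.exists_hasFDerivAt_of_flat [CompleteSpace F] (hγ : ContDiffAt ℝ 2 γ (x₀, y₀))
    (hflat : ∀ᶠ p in 𝓝 (x₀, y₀), ∀ v w,
      fderiv ℝ γ p (v, γ p v) w = fderiv ℝ γ p (w, γ p w) v) :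
    ∃ ε > 0, ∃ φ : E → F, φ x₀ = y₀ ∧ ∀ x ∈ ball x₀ ε, HasFDerivAt φ (γ (x, φ x)) x := by
  obtain ⟨K, s, hs, hK⟩ := (hγ.of_le one_le_two).exists_lipschitzOnWith
  obtain ⟨K', s', hs', hK'⟩ :=
    (hγ.fderiv_right (m := 1) (by norm_num)).exists_lipschitzOnWith
  have hd : ∀ᶠ p in 𝓝 (x₀, y₀), HasFDerivAt γ (fderiv ℝ γ p) p :=
    (hγ.eventually (by simp)).mono fun p hp ↦ (hp.differentiableAt two_ne_zero).hasFDerivAt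
  have hb : ∀ᶠ p in 𝓝 (x₀, y₀), ‖γ p‖ ≤ ‖γ (x₀, y₀)‖₊ + 1 :=
    (hγ.continuousAt.norm.eventually_lt_const (lt_add_one _)).mono fun p hp ↦ hp.le
  obtain ⟨r, hr, hball⟩ := nhds_basis_closedBall.mem_iff.1
    (inter_mem (inter_mem hs hs') (inter_mem (inter_mem hd hb) hflat))
  lift r to ℝ≥0 using hr.le
  exact _root_.exists_hasFDerivAt_of_flat (M := ‖γ (x₀, y₀)‖₊ + 1) (by exact_mod_cast hr)
    (fun p hp ↦ (hball hp).2.1.1) (hK.mono fun p hp ↦ (hball hp).1.1)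
    (hK'.mono fun p hp ↦ (hball hp).1.2) (fun p hp ↦ (hball hp).2.1.2) le_add_self
    (fun p hp ↦ (hball hp).2.2)

/-- Horizontal sections of a smooth connection are smooth. -/
theorem ContDiffOn.of_hasFDerivAt_connection {s : Set (E × F)} {Ω : Set E} {φ : E → F}
    (hγ : ContDiffOn ℝ ∞ γ s) (hΩ : IsOpen Ω) (hs : ∀ x ∈ Ω, (x, φ x) ∈ s)
    (hφ : ∀ x ∈ Ω, HasFDerivAt φ (γ (x, φ x)) x) : ContDiffOn ℝ ∞ φ Ω := by
  rw [contDiffOn_infty]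
  intro n
  induction n with
  | zero => exact contDiffOn_zero.2 fun x hx ↦ (hφ x hx).continuousAt.continuousWithinAt
  | succ n ih =>
    push_cast
    refine (contDiffOn_succ_iff_hasFDerivWithinAt_of_uniqueDiffOn hΩ.uniqueDiffOn).2
      ⟨by simp, fun x ↦ γ (x, φ x), ?_, fun x hx ↦ (hφ x hx).hasFDerivWithinAt⟩
    exact (hγ.of_le (mod_cast le_top)).comp (contDiffOn_id.prodMk ih) hs

/-- A connection is flat along each of its horizontal sections. -/
theorem fderiv_connection_symm {φ : E → F}
    (hγ : DifferentiableAt ℝ γ (x₀, φ x₀)) (hφ : ∀ᶠ x in 𝓝 x₀, HasFDerivAt φ (γ (x, φ x)) x)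
    (v w : E) :
    fderiv ℝ γ (x₀, φ x₀) (v, γ (x₀, φ x₀) v) w =
      fderiv ℝ γ (x₀, φ x₀) (w, γ (x₀, φ x₀) w) v :=
  second_derivative_symmetric_of_eventually hφ
    (hγ.hasFDerivAt.comp x₀ ((hasFDerivAt_id x₀).prodMk hφ.self_of_nhds)) v w

end Connection

namespace Stmt16

theorem statement16 (n N : ℕ)
    (U : Set (Fin (n + 1) → ℝ)) (hU : IsOpen U)
    (γ : (Fin (n + 1) → ℝ) × (Fin N → ℝ) → ((Fin (n + 1) → ℝ) →L[ℝ] (Fin N → ℝ)))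
    (hγ : ContDiffOn ℝ (⊤ : ℕ∞) γ (U ×ˢ (Set.univ : Set (Fin N → ℝ)))) :
    -- the curvature `R_γ` vanishes identically on `U × ℝᴺ`
    (∀ x ∈ U, ∀ (y : Fin N → ℝ) (v w : Fin (n + 1) → ℝ),
        fderiv ℝ γ (x, y) (v, γ (x, y) v) w - fderiv ℝ γ (x, y) (w, γ (x, y) w) v = 0)
      ↔
    -- `γ` is locally holonomic
    (∀ x₀ ∈ U, ∀ y₀ : Fin N → ℝ,
        ∃ (Ω : Set (Fin (n + 1) → ℝ)) (φ : (Fin (n + 1) → ℝ) → Fin N → ℝ),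
          IsOpen Ω ∧ Ω ⊆ U ∧ x₀ ∈ Ω ∧ ContDiffOn ℝ (⊤ : ℕ∞) φ Ω ∧ φ x₀ = y₀ ∧
            ∀ x ∈ Ω, HasFDerivAt φ (γ (x, φ x)) x) := by
  have hopen : IsOpen (U ×ˢ (univ : Set (Fin N → ℝ))) := hU.prod isOpen_univ
  constructor
  · intro hflat x₀ hx₀ y₀
    have hmem : U ×ˢ (univ : Set (Fin N → ℝ)) ∈ 𝓝 (x₀, y₀) := hopen.mem_nhds ⟨hx₀, mem_univ _⟩
    obtain ⟨ε, hε, φ, hφ₀, hφ⟩ := ContDiffAt.exists_hasFDerivAt_of_flat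
      ((hγ.contDiffAt hmem).of_le (WithTop.coe_le_coe.2 le_top))
      (mem_of_superset hmem fun p hp v w ↦ sub_eq_zero.1 (hflat p.1 hp.1 p.2 v w))
    have hΩ : IsOpen (ball x₀ ε ∩ U) := isOpen_ball.inter hU
    have hφ' : ∀ x ∈ ball x₀ ε ∩ U, HasFDerivAt φ (γ (x, φ x)) x := fun x hx ↦ hφ x hx.1
    exact ⟨ball x₀ ε ∩ U, φ, hΩ, inter_subset_right, ⟨mem_ball_self hε, hx₀⟩,
      hγ.of_hasFDerivAt_connection hΩ (fun x hx ↦ ⟨hx.2, mem_univ _⟩) hφ', hφ₀, hφ'⟩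
  · intro hhol x hx y v w
    obtain ⟨Ω, φ, hΩ, -, hxΩ, -, rfl, hφ⟩ := hhol x hx y
    exact sub_eq_zero.2 (fderiv_connection_symm
      ((hγ.contDiffAt (hopen.mem_nhds ⟨hx, mem_univ _⟩)).differentiableAt (by simp))
      (mem_of_superset (hΩ.mem_nhds hxΩ) hφ) v w)

end Stmt16
end

section
/- Let L : ℝ × ℝ × ℝ → ℝ, (y,v₀,v₁) ↦ L(y,v₀,v₁), be smooth, let ℓ > 0, and let φ : ℝ² → ℝ be a smooth solution of the Euler–Lagrange field equations for L that is ℓ-periodic in the second coordinate: φ(x⁰, x¹ + ℓ) = φ(x⁰, x¹) for all (x⁰,x¹). Let V, W : ℝ² → ℝ be smooth, ℓ-periodic in the second coordinate, and solutions of the first-variation (linearized Euler–Lagrange) equations along φ. Then the spatially integrated symplectic form t ↦ ∫₀^ℓ [ V(t,x)·δ_W p⁰(t,x) − W(t,x)·δ_V p⁰(t,x) ] dx is constant in t ∈ ℝ. -/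
open intervalIntegral

namespace Stmt17

/-- Partial derivative in the first coordinate `x⁰` of a scalar field on `ℝ²`. -/
noncomputable def pd0 (ψ : ℝ × ℝ → ℝ) (x : ℝ × ℝ) : ℝ := fderiv ℝ ψ x (1, 0)

/-- Partial derivative in the second coordinate `x¹` of a scalar field on `ℝ²`. -/
noncomputable def pd1 (ψ : ℝ × ℝ → ℝ) (x : ℝ × ℝ) : ℝ := fderiv ℝ ψ x (0, 1)

/-- The first jet `j¹ψ(x) = (ψ(x), ∂₀ψ(x), ∂₁ψ(x))`. -/
noncomputable def jet1 (ψ : ℝ × ℝ → ℝ) (x : ℝ × ℝ) : ℝ × ℝ × ℝ := (ψ x, pd0 ψ x, pd1 ψ x)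

/-- `D_yL`. -/
noncomputable def DyL (L : ℝ × ℝ × ℝ → ℝ) (p : ℝ × ℝ × ℝ) : ℝ := fderiv ℝ L p (1, 0, 0)

/-- `D_{v₀}L`. -/
noncomputable def Dv0L (L : ℝ × ℝ × ℝ → ℝ) (p : ℝ × ℝ × ℝ) : ℝ := fderiv ℝ L p (0, 1, 0)

/-- `D_{v₁}L`. -/
noncomputable def Dv1L (L : ℝ × ℝ × ℝ → ℝ) (p : ℝ × ℝ × ℝ) : ℝ := fderiv ℝ L p (0, 0, 1)

/-- `δ_V p⁰(x) = D(D_{v₀}L)(j¹φ(x))(j¹V(x))`. -/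
noncomputable def dvp0 (L : ℝ × ℝ × ℝ → ℝ) (φ V : ℝ × ℝ → ℝ) (x : ℝ × ℝ) : ℝ :=
  fderiv ℝ (fun p => Dv0L L p) (jet1 φ x) (jet1 V x)

/-- `δ_V p¹(x) = D(D_{v₁}L)(j¹φ(x))(j¹V(x))`. -/
noncomputable def dvp1 (L : ℝ × ℝ × ℝ → ℝ) (φ V : ℝ × ℝ → ℝ) (x : ℝ × ℝ) : ℝ :=
  fderiv ℝ (fun p => Dv1L L p) (jet1 φ x) (jet1 V x)

/-- `φ` satisfies the Euler–Lagrange field equations for `L`. -/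
def IsEL (L : ℝ × ℝ × ℝ → ℝ) (φ : ℝ × ℝ → ℝ) : Prop :=
  ∀ x : ℝ × ℝ,
    DyL L (jet1 φ x)
      = pd0 (fun y => Dv0L L (jet1 φ y)) x + pd1 (fun y => Dv1L L (jet1 φ y)) x

/-- `V` satisfies the first-variation (linearized Euler–Lagrange) equations along `φ`. -/
def IsFV (L : ℝ × ℝ × ℝ → ℝ) (φ V : ℝ × ℝ → ℝ) : Prop :=
  ∀ x : ℝ × ℝ,
    fderiv ℝ (fun p => DyL L p) (jet1 φ x) (jet1 V x)
      = pd0 (dvp0 L φ V) x + pd1 (dvp1 L φ V) x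

/-- Directional derivatives of a smooth function on a normed space are smooth. -/
theorem contDiff_fderiv_apply_const {E : Type*} [NormedAddCommGroup E] [NormedSpace ℝ E]
    {f : E → ℝ} (hf : ContDiff ℝ (⊤ : ℕ∞) f) (v : E) :
    ContDiff ℝ (⊤ : ℕ∞) (fun x => fderiv ℝ f x v) :=
  (hf.fderiv_right (m := (⊤ : ℕ∞)) (by simp)).clm_apply contDiff_const

theorem contDiff_jet1 {ψ : ℝ × ℝ → ℝ} (hψ : ContDiff ℝ (⊤ : ℕ∞) ψ) :
    ContDiff ℝ (⊤ : ℕ∞) (jet1 ψ) :=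
  hψ.prodMk ((contDiff_fderiv_apply_const hψ (1, 0)).prodMk
    (contDiff_fderiv_apply_const hψ (0, 1)))

/-- The linearization of a smooth function of the first jet is smooth. -/
theorem contDiff_fderiv_jet1 {F : ℝ × ℝ × ℝ → ℝ} (hF : ContDiff ℝ (⊤ : ℕ∞) F)
    {φ V : ℝ × ℝ → ℝ} (hφ : ContDiff ℝ (⊤ : ℕ∞) φ) (hV : ContDiff ℝ (⊤ : ℕ∞) V) :
    ContDiff ℝ (⊤ : ℕ∞) (fun x => fderiv ℝ F (jet1 φ x) (jet1 V x)) :=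
  ((hF.fderiv_right (m := (⊤ : ℕ∞)) (by simp)).comp (contDiff_jet1 hφ)).clm_apply
    (contDiff_jet1 hV)

theorem contDiff_dvp0 {L : ℝ × ℝ × ℝ → ℝ} (hL : ContDiff ℝ (⊤ : ℕ∞) L)
    {φ V : ℝ × ℝ → ℝ} (hφ : ContDiff ℝ (⊤ : ℕ∞) φ) (hV : ContDiff ℝ (⊤ : ℕ∞) V) :
    ContDiff ℝ (⊤ : ℕ∞) (dvp0 L φ V) :=
  contDiff_fderiv_jet1 (contDiff_fderiv_apply_const hL (0, 1, 0)) hφ hV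

theorem contDiff_dvp1 {L : ℝ × ℝ × ℝ → ℝ} (hL : ContDiff ℝ (⊤ : ℕ∞) L)
    {φ V : ℝ × ℝ → ℝ} (hφ : ContDiff ℝ (⊤ : ℕ∞) φ) (hV : ContDiff ℝ (⊤ : ℕ∞) V) :
    ContDiff ℝ (⊤ : ℕ∞) (dvp1 L φ V) :=
  contDiff_fderiv_jet1 (contDiff_fderiv_apply_const hL (0, 0, 1)) hφ hV

theorem fderiv_fderiv_apply_const {E : Type*} [NormedAddCommGroup E] [NormedSpace ℝ E]
    {f : E → ℝ} (hf : ContDiff ℝ (⊤ : ℕ∞) f) (p u v : E) :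
    fderiv ℝ (fun q => fderiv ℝ f q v) p u = fderiv ℝ (fderiv ℝ f) p u v := by
  have h : DifferentiableAt ℝ (fderiv ℝ f) p :=
    (hf.fderiv_right (m := (⊤ : ℕ∞)) (by simp)).differentiable (by simp) p
  rw [fderiv_clm_apply h (differentiableAt_const v)]
  simp

theorem jet1_periodic {ψ : ℝ × ℝ → ℝ} {ℓ : ℝ}
    (h : ∀ x0 x1 : ℝ, ψ (x0, x1 + ℓ) = ψ (x0, x1)) (x0 x1 : ℝ) :
    jet1 ψ (x0, x1 + ℓ) = jet1 ψ (x0, x1) := by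
  have hshift : (fun x : ℝ × ℝ => ψ (x + (0, ℓ))) = ψ := by
    funext ⟨a, b⟩
    simpa using h a b
  have hd : fderiv ℝ ψ (x0, x1 + ℓ) = fderiv ℝ ψ (x0, x1) := by
    conv_rhs => rw [← hshift, fderiv_comp_add_right]
    simp
  simp only [jet1, pd0, pd1, hd, h]

/-- The sum of products of the components of `j¹V` with the linearizations of the components of
`DL` in the direction `j¹W` is the Hessian of `L` evaluated at `j¹W` and `j¹V`. -/
theorem jet1_pairing {L : ℝ × ℝ × ℝ → ℝ} (hL : ContDiff ℝ (⊤ : ℕ∞) L)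
    (φ V W : ℝ × ℝ → ℝ) (x : ℝ × ℝ) :
    V x * fderiv ℝ (fun p => DyL L p) (jet1 φ x) (jet1 W x)
        + pd0 V x * dvp0 L φ W x + pd1 V x * dvp1 L φ W x
      = fderiv ℝ (fderiv ℝ L) (jet1 φ x) (jet1 W x) (jet1 V x) := by
  have hdecomp : jet1 V x
      = V x • ((1, 0, 0) : ℝ × ℝ × ℝ) + pd0 V x • ((0, 1, 0) : ℝ × ℝ × ℝ)
        + pd1 V x • ((0, 0, 1) : ℝ × ℝ × ℝ) := by
    simp [jet1]
  unfold dvp0 dvp1 DyL Dv0L Dv1L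
  simp only [fderiv_fderiv_apply_const hL]
  conv_rhs => rw [hdecomp]
  simp only [map_add, map_smul, smul_eq_mul]

/-- The multisymplectic conservation law: the symplectic current of two solutions of the
first-variation equations is divergence-free. -/
theorem symplectic_current_divergence_eq_zero {L : ℝ × ℝ × ℝ → ℝ}
    (hL : ContDiff ℝ (⊤ : ℕ∞) L) {φ V W : ℝ × ℝ → ℝ} (hφ : ContDiff ℝ (⊤ : ℕ∞) φ)
    (hV : ContDiff ℝ (⊤ : ℕ∞) V) (hW : ContDiff ℝ (⊤ : ℕ∞) W)
    (hVfv : IsFV L φ V) (hWfv : IsFV L φ W) (x : ℝ × ℝ) :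
    pd0 (fun y => V y * dvp0 L φ W y - W y * dvp0 L φ V y) x
      + pd1 (fun y => V y * dvp1 L φ W y - W y * dvp1 L φ V y) x = 0 := by
  have hleib {A B C D : ℝ × ℝ → ℝ} (hA : ContDiff ℝ (⊤ : ℕ∞) A) (hB : ContDiff ℝ (⊤ : ℕ∞) B)
      (hC : ContDiff ℝ (⊤ : ℕ∞) C) (hD : ContDiff ℝ (⊤ : ℕ∞) D) (v : ℝ × ℝ) :
      fderiv ℝ (fun y => A y * B y - C y * D y) x v
        = A x * fderiv ℝ B x v + B x * fderiv ℝ A x v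
          - (C x * fderiv ℝ D x v + D x * fderiv ℝ C x v) := by
    have hA' := (hA.differentiable (by simp) x).hasFDerivAt
    have hB' := (hB.differentiable (by simp) x).hasFDerivAt
    have hC' := (hC.differentiable (by simp) x).hasFDerivAt
    have hD' := (hD.differentiable (by simp) x).hasFDerivAt
    rw [((hA'.fun_mul hB').fun_sub (hC'.fun_mul hD')).fderiv]
    simp
  have hsymm : fderiv ℝ (fderiv ℝ L) (jet1 φ x) (jet1 W x) (jet1 V x)
      = fderiv ℝ (fderiv ℝ L) (jet1 φ x) (jet1 V x) (jet1 W x) :=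
    (hL.contDiffAt.isSymmSndFDerivAt (by
      simpa using WithTop.coe_le_coe.mpr (le_top : (2 : ℕ∞) ≤ ⊤))).eq _ _
  rw [← jet1_pairing hL, ← jet1_pairing hL, hVfv x, hWfv x] at hsymm
  unfold pd0 pd1 at hsymm ⊢
  rw [hleib hV (contDiff_dvp0 hL hφ hW) hW (contDiff_dvp0 hL hφ hV),
    hleib hV (contDiff_dvp1 hL hφ hW) hW (contDiff_dvp1 hL hφ hV)]
  linear_combination hsymm

theorem statement17 (L : ℝ × ℝ × ℝ → ℝ) (hL : ContDiff ℝ (⊤ : ℕ∞) L)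
    (ℓ : ℝ) (hℓ : 0 < ℓ)
    (φ : ℝ × ℝ → ℝ) (hφ : ContDiff ℝ (⊤ : ℕ∞) φ)
    (hφEL : IsEL L φ)
    (hφper : ∀ x0 x1 : ℝ, φ (x0, x1 + ℓ) = φ (x0, x1))
    (V W : ℝ × ℝ → ℝ) (hV : ContDiff ℝ (⊤ : ℕ∞) V) (hW : ContDiff ℝ (⊤ : ℕ∞) W)
    (hVper : ∀ x0 x1 : ℝ, V (x0, x1 + ℓ) = V (x0, x1))
    (hWper : ∀ x0 x1 : ℝ, W (x0, x1 + ℓ) = W (x0, x1))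
    (hVfv : IsFV L φ V) (hWfv : IsFV L φ W) :
    ∀ t t' : ℝ,
      (∫ x in (0:ℝ)..ℓ,
          (V (t, x) * dvp0 L φ W (t, x) - W (t, x) * dvp0 L φ V (t, x)))
        = ∫ x in (0:ℝ)..ℓ,
            (V (t', x) * dvp0 L φ W (t', x) - W (t', x) * dvp0 L φ V (t', x)) := by
  intro t t'
  have hF := (hV.mul (contDiff_dvp0 hL hφ hW)).sub (hW.mul (contDiff_dvp0 hL hφ hV))
  have hG := (hV.mul (contDiff_dvp1 hL hφ hW)).sub (hW.mul (contDiff_dvp1 hL hφ hV))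
  have hdiv := symplectic_current_divergence_eq_zero hL hφ hV hW hVfv hWfv
  have hint := MeasureTheory.integral2_divergence_prod_of_hasFDerivAt_off_countable
    (fun y => V y * dvp0 L φ W y - W y * dvp0 L φ V y)
    (fun y => V y * dvp1 L φ W y - W y * dvp1 L φ V y)
    _ _ t 0 t' ℓ ∅ Set.countable_empty hF.continuous.continuousOn hG.continuous.continuousOn
    (fun x _ => (hF.differentiable (by simp) x).hasFDerivAt)
    (fun x _ => (hG.differentiable (by simp) x).hasFDerivAt)
    (by
      refine (MeasureTheory.integrableOn_zero).congr_fun (fun x _ => (hdiv x).symm) ?_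
      exact measurableSet_uIcc.prod measurableSet_uIcc)
  have hper (x : ℝ) : V (x, ℓ) * dvp1 L φ W (x, ℓ) - W (x, ℓ) * dvp1 L φ V (x, ℓ)
      = V (x, 0) * dvp1 L φ W (x, 0) - W (x, 0) * dvp1 L φ V (x, 0) := by
    have hφj := jet1_periodic hφper x 0
    have hVj := jet1_periodic hVper x 0
    have hWj := jet1_periodic hWper x 0
    have hV0 := hVper x 0
    have hW0 := hWper x 0
    rw [zero_add] at hφj hVj hWj hV0 hW0
    simp only [dvp1, hφj, hVj, hWj, hV0, hW0]
  have hzero : (∫ x in t..t', ∫ y in (0 : ℝ)..ℓ,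
      (fderiv ℝ (fun y => V y * dvp0 L φ W y - W y * dvp0 L φ V y) (x, y) (1, 0)
        + fderiv ℝ (fun y => V y * dvp1 L φ W y - W y * dvp1 L φ V y) (x, y) (0, 1))) = 0 := by
    have hdiv' (x y : ℝ) := hdiv (x, y)
    unfold pd0 pd1 at hdiv'
    simp only [hdiv', intervalIntegral.integral_zero]
  have hint' := hzero.symm.trans hint
  simp only [hper] at hint'
  linarith

end Stmt17
end

section
/- Let L : ℝ × ℝ × ℝ → ℝ, (y,v₀,v₁) ↦ L(y,v₀,v₁), be smooth, and let ξ : ℝ → ℝ be smooth such that for all (y,v₀,v₁): D_yL(y,v₀,v₁)·ξ(y) + D_{v₀}L(y,v₀,v₁)·ξ'(y)v₀ + D_{v₁}L(y,v₀,v₁)·ξ'(y)v₁ = 0. Let ℓ > 0 and let φ : ℝ² → ℝ be a smooth solution of the Euler–Lagrange field equations for L that is ℓ-periodic in the second coordinate: φ(x⁰, x¹ + ℓ) = φ(x⁰, x¹). Then the spatially integrated Noether momentum t ↦ ∫₀^ℓ D_{v₀}L( j¹φ(t,x) )·ξ( φ(t,x) ) dx is constant in t ∈ ℝ. -/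
open intervalIntegral

namespace Stmt18

/-- Partial derivative in the first coordinate `x⁰` of a scalar field on `ℝ²`. -/
noncomputable def pd0 (ψ : ℝ × ℝ → ℝ) (x : ℝ × ℝ) : ℝ := fderiv ℝ ψ x (1, 0)

/-- Partial derivative in the second coordinate `x¹` of a scalar field on `ℝ²`. -/
noncomputable def pd1 (ψ : ℝ × ℝ → ℝ) (x : ℝ × ℝ) : ℝ := fderiv ℝ ψ x (0, 1)

/-- The first jet `j¹ψ(x) = (ψ(x), ∂₀ψ(x), ∂₁ψ(x))`. -/
noncomputable def jet1 (ψ : ℝ × ℝ → ℝ) (x : ℝ × ℝ) : ℝ × ℝ × ℝ := (ψ x, pd0 ψ x, pd1 ψ x)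

/-- `D_yL`. -/
noncomputable def DyL (L : ℝ × ℝ × ℝ → ℝ) (p : ℝ × ℝ × ℝ) : ℝ := fderiv ℝ L p (1, 0, 0)

/-- `D_{v₀}L`. -/
noncomputable def Dv0L (L : ℝ × ℝ × ℝ → ℝ) (p : ℝ × ℝ × ℝ) : ℝ := fderiv ℝ L p (0, 1, 0)

/-- `D_{v₁}L`. -/
noncomputable def Dv1L (L : ℝ × ℝ × ℝ → ℝ) (p : ℝ × ℝ × ℝ) : ℝ := fderiv ℝ L p (0, 0, 1)

/-- `φ` satisfies the Euler–Lagrange field equations for `L`. -/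
def IsEL (L : ℝ × ℝ × ℝ → ℝ) (φ : ℝ × ℝ → ℝ) : Prop :=
  ∀ x : ℝ × ℝ,
    DyL L (jet1 φ x)
      = pd0 (fun y => Dv0L L (jet1 φ y)) x + pd1 (fun y => Dv1L L (jet1 φ y)) x

theorem pd0_mul {f g : ℝ × ℝ → ℝ} {x : ℝ × ℝ} (hf : DifferentiableAt ℝ f x)
    (hg : DifferentiableAt ℝ g x) :
    pd0 (fun y => f y * g y) x = f x * pd0 g x + g x * pd0 f x := by
  simp [pd0, fderiv_fun_mul hf hg]

theorem pd1_mul {f g : ℝ × ℝ → ℝ} {x : ℝ × ℝ} (hf : DifferentiableAt ℝ f x)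
    (hg : DifferentiableAt ℝ g x) :
    pd1 (fun y => f y * g y) x = f x * pd1 g x + g x * pd1 f x := by
  simp [pd1, fderiv_fun_mul hf hg]

theorem pd0_comp {ξ : ℝ → ℝ} {φ : ℝ × ℝ → ℝ} {x : ℝ × ℝ} (hξ : DifferentiableAt ℝ ξ (φ x))
    (hφ : DifferentiableAt ℝ φ x) : pd0 (fun y => ξ (φ y)) x = deriv ξ (φ x) * pd0 φ x := by
  have h := hξ.hasDerivAt.comp_hasFDerivAt x hφ.hasFDerivAt
  change fderiv ℝ (ξ ∘ φ) x (1, 0) = _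
  rw [h.fderiv]
  rfl

theorem pd1_comp {ξ : ℝ → ℝ} {φ : ℝ × ℝ → ℝ} {x : ℝ × ℝ} (hξ : DifferentiableAt ℝ ξ (φ x))
    (hφ : DifferentiableAt ℝ φ x) : pd1 (fun y => ξ (φ y)) x = deriv ξ (φ x) * pd1 φ x := by
  have h := hξ.hasDerivAt.comp_hasFDerivAt x hφ.hasFDerivAt
  change fderiv ℝ (ξ ∘ φ) x (0, 1) = _
  rw [h.fderiv]
  rfl

theorem contDiff_fderiv_apply {E : Type*} [NormedAddCommGroup E] [NormedSpace ℝ E] {f : E → ℝ}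
    (hf : ContDiff ℝ (⊤ : ℕ∞) f) (v : E) : ContDiff ℝ (⊤ : ℕ∞) fun x => fderiv ℝ f x v :=
  (hf.fderiv_right (by simp)).clm_apply contDiff_const

theorem contDiff_jet1 {φ : ℝ × ℝ → ℝ} (hφ : ContDiff ℝ (⊤ : ℕ∞) φ) :
    ContDiff ℝ (⊤ : ℕ∞) (jet1 φ) :=
  hφ.prodMk ((contDiff_fderiv_apply hφ _).prodMk (contDiff_fderiv_apply hφ _))

theorem differentiable_fderiv_apply_jet1 {L : ℝ × ℝ × ℝ → ℝ} (hL : ContDiff ℝ (⊤ : ℕ∞) L)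
    {φ : ℝ × ℝ → ℝ} (hφ : ContDiff ℝ (⊤ : ℕ∞) φ) (v : ℝ × ℝ × ℝ) :
    Differentiable ℝ fun y => fderiv ℝ L (jet1 φ y) v :=
  ((contDiff_fderiv_apply hL v).comp (contDiff_jet1 hφ)).differentiable (by simp)

/-- The jet of a field that is invariant under a translation is invariant as well. -/
theorem jet1_add_of_periodic {φ : ℝ × ℝ → ℝ} {a : ℝ × ℝ} (h : ∀ x, φ (x + a) = φ x)
    (x : ℝ × ℝ) : jet1 φ (x + a) = jet1 φ x := by
  have hd : fderiv ℝ φ (x + a) = fderiv ℝ φ x := by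
    rw [← fderiv_comp_add_right, funext h]
  simp [jet1, pd0, pd1, h, hd]

/-- The spatial integral of the density of a conserved current is constant in time if the flux
takes equal values at the two ends of the spatial interval. -/
theorem integral_eq_of_divergence_eq_zero {f g : ℝ × ℝ → ℝ} (hf : Differentiable ℝ f)
    (hg : Differentiable ℝ g) (hdiv : ∀ x, pd0 f x + pd1 g x = 0) {a b : ℝ}
    (hper : ∀ t, g (t, b) = g (t, a)) (t t' : ℝ) :
    ∫ x in a..b, f (t, x) = ∫ x in a..b, f (t', x) := by
  have hdiv' : ∀ x, fderiv ℝ f x (1, 0) + fderiv ℝ g x (0, 1) = 0 := hdiv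
  have h := MeasureTheory.integral2_divergence_prod_of_hasFDerivAt f g (fderiv ℝ f) (fderiv ℝ g)
    t' a t b hf.continuous.continuousOn hg.continuous.continuousOn
    (fun x _ => (hf x).hasFDerivAt) (fun x _ => (hg x).hasFDerivAt)
    (by simp only [hdiv']; exact MeasureTheory.integrableOn_zero)
  simp only [hdiv', hper, intervalIntegral.integral_zero] at h
  linarith

/-- **Noether's theorem**: the current of a vertical symmetry is conserved along solutions. -/
theorem noether_current_divergence {L : ℝ × ℝ × ℝ → ℝ} (hL : ContDiff ℝ (⊤ : ℕ∞) L)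
    {ξ : ℝ → ℝ} (hξ : Differentiable ℝ ξ)
    (hinv : ∀ y v0 v1 : ℝ,
      DyL L (y, v0, v1) * ξ y + Dv0L L (y, v0, v1) * (deriv ξ y * v0)
        + Dv1L L (y, v0, v1) * (deriv ξ y * v1) = 0)
    {φ : ℝ × ℝ → ℝ} (hφ : ContDiff ℝ (⊤ : ℕ∞) φ) (hφEL : IsEL L φ) (x : ℝ × ℝ) :
    pd0 (fun y => Dv0L L (jet1 φ y) * ξ (φ y)) x
      + pd1 (fun y => Dv1L L (jet1 φ y) * ξ (φ y)) x = 0 := by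
  have hd : Differentiable ℝ φ := hφ.differentiable (by simp)
  have h0 : Differentiable ℝ fun y => Dv0L L (jet1 φ y) :=
    differentiable_fderiv_apply_jet1 hL hφ _
  have h1 : Differentiable ℝ fun y => Dv1L L (jet1 φ y) :=
    differentiable_fderiv_apply_jet1 hL hφ _
  have hξφ : Differentiable ℝ fun y => ξ (φ y) := hξ.comp hd
  rw [pd0_mul (h0 x) (hξφ x), pd1_mul (h1 x) (hξφ x), pd0_comp (hξ _) (hd x),
    pd1_comp (hξ _) (hd x)]
  have hsymm : DyL L (jet1 φ x) * ξ (φ x) + Dv0L L (jet1 φ x) * (deriv ξ (φ x) * pd0 φ x)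
      + Dv1L L (jet1 φ x) * (deriv ξ (φ x) * pd1 φ x) = 0 := hinv _ _ _
  linear_combination hsymm - ξ (φ x) * hφEL x

theorem statement18 (L : ℝ × ℝ × ℝ → ℝ) (hL : ContDiff ℝ (⊤ : ℕ∞) L)
    (ξ : ℝ → ℝ) (hξ : ContDiff ℝ (⊤ : ℕ∞) ξ)
    -- infinitesimal invariance of `L` under the vertical symmetry generated by `ξ`
    (hinv : ∀ y v0 v1 : ℝ,
      DyL L (y, v0, v1) * ξ y + Dv0L L (y, v0, v1) * (deriv ξ y * v0)
        + Dv1L L (y, v0, v1) * (deriv ξ y * v1) = 0)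
    (ℓ : ℝ) (hℓ : 0 < ℓ)
    (φ : ℝ × ℝ → ℝ) (hφ : ContDiff ℝ (⊤ : ℕ∞) φ)
    (hφEL : IsEL L φ)
    (hφper : ∀ x0 x1 : ℝ, φ (x0, x1 + ℓ) = φ (x0, x1)) :
    ∀ t t' : ℝ,
      (∫ x in (0:ℝ)..ℓ, Dv0L L (jet1 φ (t, x)) * ξ (φ (t, x)))
        = ∫ x in (0:ℝ)..ℓ, Dv0L L (jet1 φ (t', x)) * ξ (φ (t', x)) := by
  have hdξ : Differentiable ℝ ξ := hξ.differentiable (by simp)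
  have hdφ : Differentiable ℝ φ := hφ.differentiable (by simp)
  have h0 : Differentiable ℝ fun y => Dv0L L (jet1 φ y) :=
    differentiable_fderiv_apply_jet1 hL hφ _
  have h1 : Differentiable ℝ fun y => Dv1L L (jet1 φ y) :=
    differentiable_fderiv_apply_jet1 hL hφ _
  have hper : ∀ x, φ (x + (0, ℓ)) = φ x := fun ⟨x0, x1⟩ => by
    simpa using hφper x0 x1
  refine integral_eq_of_divergence_eq_zero (h0.mul (hdξ.comp hdφ)) (h1.mul (hdξ.comp hdφ))
    (noether_current_divergence hL hdξ hinv hφ hφEL) fun t => ?_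
  have hjet : jet1 φ (t, ℓ) = jet1 φ (t, 0) := by
    simpa using jet1_add_of_periodic hper (t, 0)
  have hval : φ (t, ℓ) = φ (t, 0) := by simpa using hφper t 0
  simp [hjet, hval]

end Stmt18
end
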